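/- There is a constant d0 > 0 such that for all d ≥ d0 and all even L ≥ 4: the π_3-measure of the set of proper 3-colorings χ of T_{L,d} satisfying |χ⁻¹(0)∩E| ≥ L^d/(4 d^{1/2}) and admitting a family of standard even cutsets (W_1,γ_1),…,(W_m,γ_m) with pairwise disjoint sets W_i, each with |W_i| ≤ L^d/2 and |γ_i| < L^{d−1}, whose sets W_i together cover χ⁻¹(0)∩E, is at most exp( −4 L^{d−1} / (d^4 (log L)^2) ). -/

import Mathlib

open Finset

/-- Vertices of the discrete torus `T_{L,d}`: functions from `Fin d` to `Fin L`. -/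
abbrev TV (L d : ℕ) : Type := Fin d → Fin L

/-- Adjacency in the discrete torus `T_{L,d}`: `x` and `y` differ in exactly one
coordinate, and differ by `1 (mod L)` in that coordinate. -/
def TorusAdj {L d : ℕ} (x y : TV L d) : Prop :=
  ∃ i : Fin d, x i ≠ y i ∧
    ((y i : ℕ) = ((x i : ℕ) + 1) % L ∨ (x i : ℕ) = ((y i : ℕ) + 1) % L) ∧
    ∀ j : Fin d, j ≠ i → x j = y j

instance {L d : ℕ} (x y : TV L d) : Decidable (TorusAdj x y) := by
  unfold TorusAdj; infer_instance

/-- A vertex of the torus is even if its coordinate sum is even. -/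
def IsEvenVtx {L d : ℕ} (x : TV L d) : Prop := (∑ i, (x i : ℕ)) % 2 = 0

instance {L d : ℕ} (x : TV L d) : Decidable (IsEvenVtx x) := by
  unfold IsEvenVtx; infer_instance

/-- Proper 3-colorings of `T_{L,d}`. -/
def ProperColoring (L d : ℕ) (χ : TV L d → Fin 3) : Prop :=
  ∀ x y : TV L d, TorusAdj x y → χ x ≠ χ y

instance (L d : ℕ) : DecidablePred (ProperColoring L d) := by
  intro χ; unfold ProperColoring; infer_instance

/-- The set (as a type) of proper 3-colorings of `T_{L,d}`. -/
abbrev Coloring3 (L d : ℕ) : Type := {χ : TV L d → Fin 3 // ProperColoring L d χ}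

/-- `|χ⁻¹(0) ∩ E|`: the number of even vertices colored 0. -/
noncomputable def zeroEvenCount (L d : ℕ) (χ : TV L d → Fin 3) : ℕ :=
  Nat.card {v : TV L d // χ v = 0 ∧ IsEvenVtx v}

/-- `|χ⁻¹(0) ∩ O|`: the number of odd vertices colored 0. -/
noncomputable def zeroOddCount (L d : ℕ) (χ : TV L d → Fin 3) : ℕ :=
  Nat.card {v : TV L d // χ v = 0 ∧ ¬ IsEvenVtx v}

/-- Balanced colorings: `||χ⁻¹(0)∩E| - |χ⁻¹(0)∩O|| ≤ ρ L^d / 2`. -/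
def BalancedColoring (L d : ℕ) (ρ : ℝ) (χ : TV L d → Fin 3) : Prop :=
  |(zeroEvenCount L d χ : ℝ) - (zeroOddCount L d χ : ℝ)| ≤ ρ * (L : ℝ) ^ d / 2

/-- Colorings where color 0 predominates on the even sublattice:
`|χ⁻¹(0)∩E| > |χ⁻¹(0)∩O| + ρ L^d / 2`. -/
def EvenMajorityColoring (L d : ℕ) (ρ : ℝ) (χ : TV L d → Fin 3) : Prop :=
  (zeroOddCount L d χ : ℝ) + ρ * (L : ℝ) ^ d / 2 < (zeroEvenCount L d χ : ℝ)

/-- The uniform measure, on proper 3-colorings of `T_{L,d}`, of the set of proper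
3-colorings satisfying the predicate `P`. -/
noncomputable def pi3 (L d : ℕ) (P : (TV L d → Fin 3) → Prop) : ℝ :=
  (Nat.card {χ : TV L d → Fin 3 // ProperColoring L d χ ∧ P χ} : ℝ) /
    (Nat.card (Coloring3 L d) : ℝ)

/-- The binary entropy function `H(x) = -x log₂ x - (1-x) log₂ (1-x)`. -/
noncomputable def binEntropy (x : ℝ) : ℝ :=
  -(x * Real.logb 2 x) - (1 - x) * Real.logb 2 (1 - x)

/-- External vertex boundary `∂_ext X`. -/
def extBdry {L d : ℕ} (X : Set (TV L d)) : Set (TV L d) :=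
  {y | y ∉ X ∧ ∃ x ∈ X, TorusAdj y x}

/-- Internal vertex boundary `∂_int X`. -/
def intBdry {L d : ℕ} (X : Set (TV L d)) : Set (TV L d) :=
  {x | x ∈ X ∧ ∃ y, y ∉ X ∧ TorusAdj x y}

/-- The even part `W ∩ E`. -/
def evenPart {L d : ℕ} (W : Set (TV L d)) : Set (TV L d) := {v ∈ W | IsEvenVtx v}

/-- The odd part `W ∩ O`. -/
def oddPart {L d : ℕ} (W : Set (TV L d)) : Set (TV L d) := {v ∈ W | ¬ IsEvenVtx v}

/-- The size `|∇(W)|` of the edge boundary of `W`: each boundary edge is counted once,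
as the ordered pair whose first coordinate is inside `W`. -/
noncomputable def cutsetCard (L d : ℕ) (W : Set (TV L d)) : ℕ :=
  Nat.card {p : TV L d × TV L d // p.1 ∈ W ∧ p.2 ∉ W ∧ TorusAdj p.1 p.2}

/-- A standard even cutset of a proper 3-coloring `χ`, given by its interior `W`
(with `γ = ∇(W)`): `∂_int W ⊆ O`, `∂_ext W ⊆ E`, the boundary is 0-free,
`W∩O = ∂_ext(W∩E)`, `W∩E = {y ∈ E : ∂y ⊆ W∩O}`, and
`|γ| ≥ max{|W|^{1-1/d}, d^{1.9}}`. -/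
def StandardEvenCutset (L d : ℕ) (χ : TV L d → Fin 3) (W : Set (TV L d)) : Prop :=
  (∀ x ∈ intBdry W, ¬ IsEvenVtx x) ∧
  (∀ x ∈ extBdry W, IsEvenVtx x) ∧
  (∀ x ∈ intBdry W ∪ extBdry W, χ x ≠ 0) ∧
  oddPart W = extBdry (evenPart W) ∧
  evenPart W = {y | IsEvenVtx y ∧ ∀ z, TorusAdj y z → z ∈ oddPart W} ∧
  max ((Nat.card ↥W : ℝ) ^ (1 - 1 / (d : ℝ))) ((d : ℝ) ^ (1.9 : ℝ)) ≤ (cutsetCard L d W : ℝ)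

set_option linter.unusedSectionVars false

/-- A symmetric generating set `Γ` of a finite abelian group together with a vertex class `E`
such that every generator exchanges `E` and its complement. -/
structure BipCayley {V : Type*} [AddCommGroup V] (Γ E : Finset V) : Prop where
  neg_mem : ∀ f ∈ Γ, -f ∈ Γ
  parity : ∀ x, ∀ f ∈ Γ, (x + f ∈ E ↔ x ∉ E)

/-- A pair `A ⊆ E`, `G ⊆ Eᶜ` such that `G` contains the neighbourhood of `A` and `A` is the set of
all even vertices whose neighbourhood lies in `G`. -/
structure ClosedPair {V : Type*} [AddCommGroup V] (Γ E A G : Finset V) : Prop where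
  even : ∀ x ∈ A, x ∈ E
  odd : ∀ u ∈ G, u ∉ E
  nb : ∀ x ∈ A, ∀ f ∈ Γ, x + f ∈ G
  closed : ∀ x ∈ E, (∀ f ∈ Γ, x + f ∈ G) → x ∈ A

/-- Proper 3-colourings of the Cayley graph. -/
def CayleyProper {V : Type*} [AddCommGroup V] (Γ : Finset V) (χ : V → Fin 3) : Prop :=
  ∀ x, ∀ f ∈ Γ, χ x ≠ χ (x + f)

/-- The boundary of the pair `(A, G)` carries no colour `0`, while each vertex of `G` on the
boundary has a neighbour in `A` of colour `0`. -/
structure ZeroFree {V : Type*} [AddCommGroup V] (Γ A G : Finset V) (χ : V → Fin 3) : Prop where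
  inner : ∀ u ∈ G, ∀ f ∈ Γ, u + f ∉ A → χ u ≠ 0
  outer : ∀ u ∈ G, ∀ f ∈ Γ, u + f ∉ A → χ (u + f) ≠ 0
  touch : ∀ u ∈ G, ∀ f ∈ Γ, u + f ∉ A → ∃ g ∈ Γ, u + g ∈ A ∧ χ (u + g) = 0

/-- `(F, S)` approximates `(A, G)` with degree defect at most `ψ`. -/
structure ApproxPair {V : Type*} [AddCommGroup V] [DecidableEq V] (Γ A G F S : Finset V)
    (ψ : ℕ) : Prop where
  sub_odd : ∀ u ∈ F, u ∈ G
  sub_even : ∀ x ∈ A, x ∈ S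
  deg_even : ∀ x ∈ S, (Γ.filter (fun f => x + f ∉ F)).card ≤ ψ
  deg_odd : ∀ u ∈ G, u ∉ F → (Γ.filter (fun f => u + f ∈ S)).card ≤ ψ

section Encoding

variable {V : Type*} [AddCommGroup V] [DecidableEq V]

/-- All neighbours of `x` in `F` carry the same nonzero colour. -/
def MonoNonzero (Γ F : Finset V) (χ : V → Fin 3) (x : V) : Prop :=
  ∃ c : Fin 3, c ≠ 0 ∧ ∀ f ∈ Γ, x + f ∈ F → χ (x + f) = c

open Classical in
/-- The recoloured colouring: the colouring inside the region is shifted by `e` and negated, and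
the freed odd vertices are set to `0` on `ω`. -/
noncomputable def shiftRecolor (Γ F A G : Finset V) (e : V) (χ : V → Fin 3) (ω : Finset V) :
    V → Fin 3 := fun v =>
  if v ∈ A then -χ (v - e)
  else if v ∈ G then
    (if v - e ∈ A ∧ ¬ MonoNonzero Γ F χ (v - e) then -χ (v - e)
      else if v ∈ ω then 0 else χ v)
  else χ v

open Classical in
/-- The auxiliary set needed to invert `shiftRecolor`. -/
noncomputable def shiftBits (Γ F A S : Finset V) (e : V) (χ : V → Fin 3) (ω : Finset V) :
    Finset V :=
  S.filter (fun x => if MonoNonzero Γ F χ x then χ x = 0 else x ∈ A ∧ x + e ∈ ω)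

lemma fin3_eq_neg : ∀ {a b : Fin 3}, a ≠ 0 → b ≠ 0 → a ≠ b → b = -a := by decide

lemma fin3_eq_zero_of_ne : ∀ {a b c : Fin 3}, a ≠ b → a ≠ c → b ≠ 1 → b ≠ 0 → c ≠ 2 → c ≠ 0 →
    a = 0 := by decide

variable {Γ E A G F S : Finset V} {χ : V → Fin 3} {ψ : ℕ} {e : V}

lemma ZeroFree.color_eq (hz : ZeroFree Γ A G χ) (hp : CayleyProper Γ χ) {u f : V}
    (hu : u ∈ G) (hf : f ∈ Γ) (h : u + f ∉ A) : χ (u + f) = -χ u :=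
  fin3_eq_neg (hz.inner u hu f hf h) (hz.outer u hu f hf h) (hp u f hf)

lemma BipCayley.sub_mem (hB : BipCayley Γ E) {x f : V} (hf : f ∈ Γ) (h : x ∈ A)
    (hc : ClosedPair Γ E A G) : x - f ∈ G := by
  rw [sub_eq_add_neg]; exact hc.nb x h _ (hB.neg_mem f hf)

/-- On `A`, being monochromatic on `F` propagates to the whole neighbourhood. -/
lemma ApproxPair.mono_nbhd (hc : ClosedPair Γ E A G)
    (hz : ZeroFree Γ A G χ) (hp : CayleyProper Γ χ) (ha : ApproxPair Γ A G F S ψ)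
    (hψ : 2 * ψ < Γ.card) {x : V} (hx : x ∈ A) (hm : MonoNonzero Γ F χ x) :
    ∃ c : Fin 3, c ≠ 0 ∧ ∀ f ∈ Γ, χ (x + f) = c := by
  obtain ⟨c, hc0, hcF⟩ := hm
  refine ⟨c, hc0, fun g hg => ?_⟩
  by_cases hF : x + g ∈ F
  · exact hcF g hg hF
  have hu : x + g ∈ G := hc.nb x hx g hg
  have h1 := ha.deg_even x (ha.sub_even x hx)
  have h2 := ha.deg_odd _ hu hF
  obtain ⟨f, hf, hf1, hf2⟩ : ∃ f ∈ Γ, x + f ∈ F ∧ x + g + f ∉ S := by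
    by_contra! hcon
    have hsub : Γ ⊆ Γ.filter (fun f => x + f ∉ F) ∪ Γ.filter (fun f => x + g + f ∈ S) := by
      intro f hf
      by_cases h : x + f ∈ F
      · simp [hf, hcon f hf h]
      · simp [hf, h]
    have := (card_le_card hsub).trans (card_union_le _ _)
    omega
  have hy : x + g + f ∉ A := fun h => hf2 (ha.sub_even _ h)
  have e1 := hz.color_eq hp hu hf hy
  have hy' : x + f + g ∉ A := by rwa [add_right_comm]
  have e2 := hz.color_eq hp (ha.sub_odd _ hf1) hg hy'
  rw [add_right_comm, e1, hcF f hf hf1] at e2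
  exact neg_injective e2

section Recolor

variable (hB : BipCayley Γ E) (hc : ClosedPair Γ E A G) (hz : ZeroFree Γ A G χ)
  (hp : CayleyProper Γ χ) (he : e ∈ Γ)

include hB hc hz hp he

lemma shiftRecolor_add (ω : Finset V) {u : V} (hu : u ∈ G) :
    shiftRecolor Γ F A G e χ ω (u + e) = -χ u := by
  unfold shiftRecolor
  have h2 : u + e ∉ G := fun h => hc.odd _ h ((hB.parity u e he).2 (hc.odd u hu))
  by_cases h : u + e ∈ A
  · simp [h]
  · simp only [h, h2, if_false]
    exact hz.color_eq hp hu he h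

lemma shiftRecolor_not_mem (ω : Finset V) {v : V} (h1 : v ∉ A) (h2 : v ∉ G) :
    shiftRecolor Γ F A G e χ ω v = χ v := by
  simp [shiftRecolor, h1, h2]

lemma shiftRecolor_even (ω : Finset V) {v f : V}
    (h : v + f - e ∈ G) :
    shiftRecolor Γ F A G e χ ω (v + f) = -χ (v + f - e) := by
  have := shiftRecolor_add hB hc hz hp he (F := F) ω h
  rwa [sub_add_cancel] at this

/-- At a free odd vertex all neighbours receive the opposite colour. -/
lemma shiftRecolor_free (ha : ApproxPair Γ A G F S ψ) (hψ : 2 * ψ < Γ.card) (ω : Finset V)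
    {v : V} (hv : v ∈ G) (hfree : ¬ (v - e ∈ A ∧ ¬ MonoNonzero Γ F χ (v - e))) :
    χ v ≠ 0 ∧ ∀ f ∈ Γ, shiftRecolor Γ F A G e χ ω (v + f) = -χ v := by
  by_cases hA : v - e ∈ A
  · have hm : MonoNonzero Γ F χ (v - e) := by
      by_contra h; exact hfree ⟨hA, h⟩
    obtain ⟨c, hc0, hcc⟩ := ha.mono_nbhd hc hz hp hψ hA hm
    have hvc : χ v = c := by simpa using hcc e he
    refine ⟨hvc ▸ hc0, fun f hf => ?_⟩
    have hG : v + f - e ∈ G := by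
      have := hc.nb _ hA f hf
      rwa [sub_add_eq_add_sub] at this
    rw [shiftRecolor_even hB hc hz hp he ω hG, hvc, ← sub_add_eq_add_sub, hcc f hf]
  · have hA' : v + -e ∉ A := by rwa [← sub_eq_add_neg]
    have h0 := hz.inner v hv _ (hB.neg_mem e he) hA'
    refine ⟨h0, fun f hf => ?_⟩
    by_cases hy : v + f ∈ A
    · have hG : v + f - e ∈ G := hB.sub_mem he hy hc
      rw [shiftRecolor_even hB hc hz hp he ω hG]
      have e1 := hz.color_eq hp hv (hB.neg_mem e he) hA'
      have e2 := hz.color_eq hp hG (hB.neg_mem f hf) (by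
        have : v + f - e + -f = v - e := by abel
        rwa [this])
      have : v + f - e + -f = v + -e := by abel
      rw [this, e1] at e2
      exact e2.symm
    · have h2 : v + f ∉ G := fun h => hc.odd _ h ((hB.parity v f hf).2 (hc.odd v hv))
      rw [shiftRecolor_not_mem hB hc hz hp he ω hy h2]
      exact hz.color_eq hp hv hf hy

lemma shiftRecolor_proper (ha : ApproxPair Γ A G F S ψ) (hψ : 2 * ψ < Γ.card) (ω : Finset V) :
    CayleyProper Γ (shiftRecolor Γ F A G e χ ω) := by
  have key : ∀ v, v ∉ E → ∀ f ∈ Γ,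
      shiftRecolor Γ F A G e χ ω v ≠ shiftRecolor Γ F A G e χ ω (v + f) := by
    intro v hvE f hf
    have hvA : v ∉ A := fun h => hvE (hc.even v h)
    have hE : v + f ∈ E := (hB.parity v f hf).2 hvE
    have hyG : v + f ∉ G := fun h => hc.odd _ h hE
    by_cases hv : v ∈ G
    · by_cases hfree : v - e ∈ A ∧ ¬ MonoNonzero Γ F χ (v - e)
      · have hG : v + f - e ∈ G := by
          have := hc.nb _ hfree.1 f hf
          rwa [sub_add_eq_add_sub] at this
        rw [shiftRecolor_even hB hc hz hp he ω hG]
        have : shiftRecolor Γ F A G e χ ω v = -χ (v - e) := by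
          simp only [shiftRecolor, hvA, hv, hfree, if_false, if_true, not_false_eq_true,
            and_self]
        rw [this]
        intro h
        have := hp (v - e) f hf
        rw [sub_add_eq_add_sub] at this
        exact this (neg_injective h)
      · obtain ⟨h0, hall⟩ := shiftRecolor_free hB hc hz hp he ha hψ ω hv hfree
        rw [hall f hf]
        have : shiftRecolor Γ F A G e χ ω v = if v ∈ ω then 0 else χ v := by
          simp only [shiftRecolor, hvA, hv, if_false, if_true, if_neg hfree]
        rw [this]
        revert h0
        generalize χ v = a
        split_ifs <;> revert a <;> decide
    · have hyA : v + f ∉ A := by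
        intro h
        have := hB.sub_mem hf h hc
        rw [add_sub_cancel_right] at this
        exact hv this
      rw [shiftRecolor_not_mem hB hc hz hp he ω hvA hv,
        shiftRecolor_not_mem hB hc hz hp he ω hyA hyG]
      exact hp v f hf
  intro v f hf
  by_cases hv : v ∈ E
  · have h1 : v + f ∉ E := fun h => (hB.parity v f hf).1 h hv
    have := key (v + f) h1 (-f) (hB.neg_mem f hf)
    rw [add_neg_cancel_right] at this
    exact this.symm
  · exact key v hv f hf

end Recolor

lemma MonoNonzero.congr {χ₁ χ₂ : V → Fin 3} (h : ∀ u ∈ F, χ₁ u = χ₂ u) {x : V}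
    (hm : MonoNonzero Γ F χ₁ x) : MonoNonzero Γ F χ₂ x := by
  obtain ⟨c, h0, hc⟩ := hm
  exact ⟨c, h0, fun f hf hF => by rw [← h _ hF]; exact hc f hf hF⟩

lemma eq_zero_iff_of_not_mono (hp : CayleyProper Γ χ) {x : V} (hm : ¬ MonoNonzero Γ F χ x) :
    χ x = 0 ↔ ∀ f ∈ Γ, x + f ∈ F → χ (x + f) ≠ 0 := by
  constructor
  · intro h f hf _ h'
    exact hp x f hf (h.trans h'.symm)
  · intro h
    have h1 : ¬ ∀ f ∈ Γ, x + f ∈ F → χ (x + f) = 1 := fun h' => hm ⟨1, by decide, h'⟩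
    have h2 : ¬ ∀ f ∈ Γ, x + f ∈ F → χ (x + f) = 2 := fun h' => hm ⟨2, by decide, h'⟩
    push Not at h1 h2
    obtain ⟨f, hf, hfF, hf1⟩ := h1
    obtain ⟨g, hg, hgF, hg1⟩ := h2
    exact fin3_eq_zero_of_ne (hp x f hf) (hp x g hg) hf1 (h f hf hfF) hg1 (h g hg hgF)

/-- Half of the injectivity of the encoding: inclusion of the odd parts. -/
lemma odd_subset_of_zero_iff {A₁ G₁ A₂ G₂ : Finset V} {χ₁ χ₂ : V → Fin 3}
    (hB : BipCayley Γ E) (hψ : 2 * ψ < Γ.card)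
    (hz₁ : ZeroFree Γ A₁ G₁ χ₁) (ha₁ : ApproxPair Γ A₁ G₁ F S ψ)
    (hc₂ : ClosedPair Γ E A₂ G₂)
    (hz₂ : ZeroFree Γ A₂ G₂ χ₂) (ha₂ : ApproxPair Γ A₂ G₂ F S ψ)
    (h0 : ∀ x ∈ S, χ₁ x = 0 → χ₂ x = 0) : G₁ ⊆ G₂ := by
  intro u hu
  by_cases hF : u ∈ F
  · exact ha₂.sub_odd u hF
  obtain ⟨f, hf, hfS⟩ : ∃ f ∈ Γ, u + f ∉ S := by
    by_contra! hcon
    have := ha₁.deg_odd u hu hF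
    rw [filter_true_of_mem hcon] at this
    omega
  obtain ⟨g, hg, hgA, hg0⟩ := hz₁.touch u hu f hf (fun h => hfS (ha₁.sub_even _ h))
  have hgS := ha₁.sub_even _ hgA
  have hg2 := h0 _ hgS hg0
  have hzA : u + g ∈ A₂ := by
    by_contra hA
    obtain ⟨k, hk, hkF⟩ : ∃ k ∈ Γ, u + g + k ∈ F := by
      by_contra! hcon
      have := ha₁.deg_even _ hgS
      rw [filter_true_of_mem hcon] at this
      omega
    have := hz₂.outer _ (ha₂.sub_odd _ hkF) (-k) (hB.neg_mem k hk)
    rw [add_neg_cancel_right] at this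
    exact this hA hg2
  have := hB.sub_mem hg hzA hc₂
  rwa [add_sub_cancel_right] at this

open Classical in
theorem shift_encoding_injective {A₁ G₁ A₂ G₂ ω₁ ω₂ : Finset V} {χ₁ χ₂ : V → Fin 3}
    (hB : BipCayley Γ E) (he : e ∈ Γ) (hψ : 2 * ψ < Γ.card)
    (hc₁ : ClosedPair Γ E A₁ G₁) (hz₁ : ZeroFree Γ A₁ G₁ χ₁) (ha₁ : ApproxPair Γ A₁ G₁ F S ψ)
    (hp₁ : CayleyProper Γ χ₁) (hω₁ : ω₁ ⊆ G₁)
    (hc₂ : ClosedPair Γ E A₂ G₂) (hz₂ : ZeroFree Γ A₂ G₂ χ₂) (ha₂ : ApproxPair Γ A₂ G₂ F S ψ)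
    (hp₂ : CayleyProper Γ χ₂) (hω₂ : ω₂ ⊆ G₂)
    (hχ : shiftRecolor Γ F A₁ G₁ e χ₁ ω₁ = shiftRecolor Γ F A₂ G₂ e χ₂ ω₂)
    (hb : shiftBits Γ F A₁ S e χ₁ ω₁ = shiftBits Γ F A₂ S e χ₂ ω₂) :
    χ₁ = χ₂ ∧ G₁ = G₂ ∧ ω₁ = ω₂ := by
  have colG : ∀ u, u ∈ G₁ → u ∈ G₂ → χ₁ u = χ₂ u := by
    intro u h1 h2
    have e1 := shiftRecolor_add hB hc₁ hz₁ hp₁ he (F := F) ω₁ h1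
    have e2 := shiftRecolor_add hB hc₂ hz₂ hp₂ he (F := F) ω₂ h2
    rw [hχ, e2] at e1
    exact (neg_injective e1).symm
  have colF : ∀ u ∈ F, χ₁ u = χ₂ u := fun u hu => colG u (ha₁.sub_odd u hu) (ha₂.sub_odd u hu)
  have hmono : ∀ x, MonoNonzero Γ F χ₁ x ↔ MonoNonzero Γ F χ₂ x := fun x =>
    ⟨fun h => h.congr colF, fun h => h.congr fun u hu => (colF u hu).symm⟩
  have hbm : ∀ x ∈ S, (if MonoNonzero Γ F χ₁ x then χ₁ x = 0 else x ∈ A₁ ∧ x + e ∈ ω₁) ↔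
      (if MonoNonzero Γ F χ₂ x then χ₂ x = 0 else x ∈ A₂ ∧ x + e ∈ ω₂) := by
    intro x hx
    have := Finset.ext_iff.1 hb x
    simpa [shiftBits, hx] using this
  have hzero : ∀ x ∈ S, χ₁ x = 0 ↔ χ₂ x = 0 := by
    intro x hx
    by_cases hm : MonoNonzero Γ F χ₁ x
    · have := hbm x hx
      rwa [if_pos hm, if_pos ((hmono x).1 hm)] at this
    · rw [eq_zero_iff_of_not_mono hp₁ hm,
        eq_zero_iff_of_not_mono hp₂ (fun h => hm ((hmono x).2 h))]
      refine forall₂_congr fun f hf => forall_congr' fun hF => ?_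
      rw [colF _ hF]
  have hG : G₁ = G₂ := Subset.antisymm
    (odd_subset_of_zero_iff hB hψ hz₁ ha₁ hc₂ hz₂ ha₂ fun x hx => (hzero x hx).1)
    (odd_subset_of_zero_iff hB hψ hz₂ ha₂ hc₁ hz₁ ha₁ fun x hx => (hzero x hx).2)
  have hA : A₁ = A₂ := by
    ext x
    exact ⟨fun h => hc₂.closed x (hc₁.even x h) fun f hf => hG ▸ hc₁.nb x h f hf,
      fun h => hc₁.closed x (hc₂.even x h) fun f hf => hG ▸ hc₂.nb x h f hf⟩
  subst hG hA
  have hcol : χ₁ = χ₂ := by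
    funext x
    by_cases hx : x ∈ G₁
    · exact colG x hx hx
    by_cases hxA : x ∈ A₁
    · have hS := ha₁.sub_even x hxA
      by_cases hm : MonoNonzero Γ F χ₁ x
      · by_cases h0 : χ₁ x = 0
        · rw [h0, (hzero x hS).1 h0]
        · have h0' : χ₂ x ≠ 0 := fun h => h0 ((hzero x hS).2 h)
          obtain ⟨c, hc0, hcc⟩ := ha₁.mono_nbhd hc₁ hz₁ hp₁ hψ hxA hm
          have h1 := hp₁ x e he
          have h2 := hp₂ x e he
          have hg := hc₁.nb x hxA e he
          rw [← colG _ hg hg, hcc e he] at h2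
          rw [hcc e he] at h1
          rw [fin3_eq_neg hc0 h0 h1.symm, fin3_eq_neg hc0 h0' h2.symm]
      · have hm2 : ¬ MonoNonzero Γ F χ₂ x := fun h => hm ((hmono x).2 h)
        have hg := hc₁.nb x hxA e he
        have hgA : x + e ∉ A₁ := fun h => hc₁.odd _ hg (hc₁.even _ h)
        have := congrFun hχ (x + e)
        simp only [shiftRecolor, hgA, hg, if_false, if_true, add_sub_cancel_right, hxA, hm, hm2,
          not_false_eq_true, and_self] at this
        exact neg_injective this
    · have := congrFun hχ x
      rwa [shiftRecolor_not_mem hB hc₁ hz₁ hp₁ he ω₁ hxA hx,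
        shiftRecolor_not_mem hB hc₂ hz₂ hp₂ he ω₂ hxA hx] at this
  subst hcol
  refine ⟨rfl, rfl, ?_⟩
  ext v
  by_cases hv : v ∈ G₁
  · by_cases hfree : v - e ∈ A₁ ∧ ¬ MonoNonzero Γ F χ₁ (v - e)
    · have := hbm _ (ha₁.sub_even _ hfree.1)
      simpa [hfree.1, hfree.2] using this
    · have h0 := (shiftRecolor_free hB hc₁ hz₁ hp₁ he ha₁ hψ ω₁ hv hfree).1
      have hvA : v ∉ A₁ := fun h => hc₁.odd _ hv (hc₁.even _ h)
      have := congrFun hχ v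
      simp only [shiftRecolor, hvA, hv, if_false, if_true, if_neg hfree] at this
      by_cases h1 : v ∈ ω₁ <;> by_cases h2 : v ∈ ω₂
      · simp [h1, h2]
      · simp only [h1, h2, if_true, if_false] at this; exact absurd this.symm h0
      · simp only [h1, h2, if_true, if_false] at this; exact absurd this h0
      · simp [h1, h2]
  · exact ⟨fun h => absurd (hω₁ h) hv, fun h => absurd (hω₂ h) hv⟩

open Classical in
/-- For a family of colourings whose regions share an approximating pair `(F, S)`, the weighted
count is at most `2 ^ |S|` times the number of all proper colourings. -/
theorem sum_two_pow_le_of_approx [Fintype V] (hB : BipCayley Γ E) (hψ : 2 * ψ < Γ.card)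
    (C : Finset (V → Fin 3)) (A G : (V → Fin 3) → Finset V)
    (hp : ∀ χ ∈ C, CayleyProper Γ χ) (hc : ∀ χ ∈ C, ClosedPair Γ E (A χ) (G χ))
    (hz : ∀ χ ∈ C, ZeroFree Γ (A χ) (G χ) χ) (ha : ∀ χ ∈ C, ApproxPair Γ (A χ) (G χ) F S ψ) :
    ∑ χ ∈ C, 2 ^ (G χ).card ≤
      (univ.filter (fun χ : V → Fin 3 => CayleyProper Γ χ)).card * 2 ^ S.card := by
  obtain ⟨e, he⟩ : Γ.Nonempty := card_pos.1 (by omega)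
  have h1 : ∑ χ ∈ C, 2 ^ (G χ).card = (C.sigma fun χ => (G χ).powerset).card := by
    rw [card_sigma]; simp
  rw [h1, ← card_powerset, ← card_product]
  refine card_le_card_of_injOn (fun p => (shiftRecolor Γ F (A p.1) (G p.1) e p.1 p.2,
    shiftBits Γ F (A p.1) S e p.1 p.2)) ?_ ?_
  · rintro ⟨χ, ω⟩ h
    simp only [mem_coe, mem_sigma, mem_powerset, mem_product, mem_filter, mem_univ,
      true_and] at h ⊢
    exact ⟨shiftRecolor_proper hB (hc χ h.1) (hz χ h.1) (hp χ h.1) he (ha χ h.1) hψ ω,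
      filter_subset _ _⟩
  · rintro ⟨χ₁, ω₁⟩ h₁ ⟨χ₂, ω₂⟩ h₂ heq
    simp only [mem_coe, mem_sigma, mem_powerset] at h₁ h₂
    simp only [Prod.mk.injEq] at heq
    obtain ⟨h, -, h'⟩ := shift_encoding_injective hB he hψ (hc _ h₁.1) (hz _ h₁.1) (ha _ h₁.1)
      (hp _ h₁.1) h₁.2 (hc _ h₂.1) (hz _ h₂.1) (ha _ h₂.1) (hp _ h₂.1) h₂.2 heq.1 heq.2
    subst h h'
    rfl

open Classical in
/-- A uniform gap between `|G|` and `|S|` makes the family exponentially small. -/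
theorem card_mul_two_pow_le_of_approx [Fintype V] (hB : BipCayley Γ E) (hψ : 2 * ψ < Γ.card)
    (C : Finset (V → Fin 3)) (A G : (V → Fin 3) → Finset V) (n : ℕ)
    (hp : ∀ χ ∈ C, CayleyProper Γ χ) (hc : ∀ χ ∈ C, ClosedPair Γ E (A χ) (G χ))
    (hz : ∀ χ ∈ C, ZeroFree Γ (A χ) (G χ) χ) (ha : ∀ χ ∈ C, ApproxPair Γ (A χ) (G χ) F S ψ)
    (hn : ∀ χ ∈ C, S.card + n ≤ (G χ).card) :
    C.card * 2 ^ n ≤ (univ.filter (fun χ : V → Fin 3 => CayleyProper Γ χ)).card := by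
  have h := sum_two_pow_le_of_approx hB hψ C A G hp hc hz ha
  have h2 : C.card * 2 ^ (S.card + n) ≤ ∑ χ ∈ C, 2 ^ (G χ).card := by
    rw [← smul_eq_mul]
    exact card_nsmul_le_sum _ _ _ fun χ hχ => Nat.pow_le_pow_right (by norm_num) (hn χ hχ)
  have h3 := h2.trans h
  rw [pow_add, mul_left_comm, mul_comm (2 ^ S.card)] at h3
  exact Nat.le_of_mul_le_mul_right h3 (by positivity)

end Encoding

section Approximation

open scoped Pointwise

variable {V : Type*} [AddCommGroup V] [DecidableEq V] {Γ E A G : Finset V}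

/-- Double counting of the edges between two vertex sets. -/
lemma BipCayley.sum_degree_comm (hB : BipCayley Γ E) (X H : Finset V) :
    ∑ x ∈ X, (Γ.filter fun f => x + f ∈ H).card = ∑ u ∈ H, (Γ.filter fun f => u + f ∈ X).card := by
  simp_rw [← card_sigma]
  refine card_nbij' (fun p => ⟨p.1 + p.2, -p.2⟩) (fun p => ⟨p.1 + p.2, -p.2⟩) ?_ ?_ ?_ ?_
  · rintro ⟨x, f⟩ h
    simp only [mem_coe, mem_sigma, mem_filter] at h ⊢
    exact ⟨h.2.2, hB.neg_mem f h.2.1, by rw [add_neg_cancel_right]; exact h.1⟩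
  · rintro ⟨x, f⟩ h
    simp only [mem_coe, mem_sigma, mem_filter] at h ⊢
    exact ⟨h.2.2, hB.neg_mem f h.2.1, by rw [add_neg_cancel_right]; exact h.1⟩
  · rintro ⟨x, f⟩ -; simp
  · rintro ⟨x, f⟩ -; simp

lemma exists_greedy_cover (C : Finset V) (ψ : ℕ) (Y : Finset V) :
    ∃ M ⊆ C, M.card * ψ ≤ Y.card ∧
      (∀ w ∈ C, (Γ.filter fun f => w + f ∈ Y ∧ w + f ∉ M + Γ).card ≤ ψ) ∧
      ∀ w ∈ M, ∃ f ∈ Γ, w + f ∈ Y := by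
  induction hn : Y.card using Nat.strong_induction_on generalizing Y with
  | _ n ih =>
  subst hn
  by_cases h : ∀ w ∈ C, (Γ.filter fun f => w + f ∈ Y).card ≤ ψ
  · refine ⟨∅, by simp, by simp, fun w hw => ?_, by simp⟩
    exact (card_le_card (fun f hf => by simp at hf ⊢; exact hf)).trans (h w hw)
  push Not at h
  obtain ⟨w, hw, hψ⟩ := h
  have hsub : (Γ.filter fun f => w + f ∈ Y).image (w + ·) ⊆ Y := by
    intro y hy
    simp only [mem_image, mem_filter] at hy
    obtain ⟨f, hf, rfl⟩ := hy
    exact hf.2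
  have hc : ((Γ.filter fun f => w + f ∈ Y).image (w + ·)).card =
      (Γ.filter fun f => w + f ∈ Y).card := card_image_of_injective _ (add_right_injective w)
  set I := (Γ.filter fun f => w + f ∈ Y).image (w + ·) with hI
  have hcard : (Y \ I).card + I.card = Y.card := card_sdiff_add_card_eq_card hsub
  obtain ⟨M, hMC, hM1, hM2, hM3⟩ := ih (Y \ I).card (by omega) (Y \ I) rfl
  refine ⟨insert w M, insert_subset hw hMC, ?_, fun v hv => ?_, fun v hv => ?_⟩
  · calc (insert w M).card * ψ ≤ (M.card + 1) * ψ := Nat.mul_le_mul_right _ (card_insert_le _ _)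
      _ ≤ Y.card := by rw [add_mul, one_mul]; omega
  · refine (card_le_card fun f hf => ?_).trans (hM2 v hv)
    simp only [mem_filter, mem_sdiff] at hf ⊢
    refine ⟨hf.1, ⟨hf.2.1, fun hmem => hf.2.2 ?_⟩, fun hmem => hf.2.2 ?_⟩
    · simp only [hI, mem_image, mem_filter] at hmem
      obtain ⟨g, hg, hge⟩ := hmem
      exact mem_add.2 ⟨w, mem_insert_self _ _, g, hg.1, hge⟩
    · exact add_subset_add_right (subset_insert _ _) hmem
  · rcases mem_insert.1 hv with rfl | hv
    · obtain ⟨f, hf⟩ := card_pos.1 (lt_of_le_of_lt (Nat.zero_le _) hψ)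
      exact ⟨f, (mem_filter.1 hf).1, (mem_filter.1 hf).2⟩
    · obtain ⟨f, hf, hfY⟩ := hM3 v hv
      exact ⟨f, hf, (mem_sdiff.1 hfY).1⟩

/-- The vertices of `G` with a neighbour outside `A`. -/
def innerBdry (Γ A G : Finset V) : Finset V := G.filter fun u => ∃ f ∈ Γ, u + f ∉ A

lemma mem_innerBdry {u : V} : u ∈ innerBdry Γ A G ↔ u ∈ G ∧ ∃ f ∈ Γ, u + f ∉ A := by
  simp [innerBdry]

lemma ClosedPair.card_mul_le (hB : BipCayley Γ E) {X H : Finset V} {ψ : ℕ}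
    (hX : ∀ x ∈ X, ∀ f ∈ Γ, x + f ∈ G) (hH : H ⊆ G)
    (hd : ∀ w ∈ H, (Γ.filter fun f => w + f ∈ X).card + ψ ≤ Γ.card) :
    Γ.card * X.card + H.card * ψ ≤ Γ.card * G.card := by
  have h1 : ∑ x ∈ X, (Γ.filter fun f => x + f ∈ G).card = X.card * Γ.card := by
    rw [sum_congr rfl fun x hx => by rw [filter_true_of_mem (hX x hx)]]
    simp
  rw [hB.sum_degree_comm] at h1
  have h2 : ∑ u ∈ H, ((Γ.filter fun f => u + f ∈ X).card + ψ) +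
      ∑ u ∈ G \ H, (Γ.filter fun f => u + f ∈ X).card ≤ H.card * Γ.card + (G \ H).card * Γ.card :=
    add_le_add (sum_le_card_nsmul _ _ _ hd)
      (sum_le_card_nsmul (G \ H) (fun u => (Γ.filter fun f => u + f ∈ X).card)
        Γ.card (fun u _ => card_filter_le _ _))
  rw [sum_add_distrib, sum_const, smul_eq_mul, ← add_mul] at h2
  have h3 := card_sdiff_add_card_eq_card hH
  have h4 := sum_sdiff (f := fun u => (Γ.filter fun f => u + f ∈ X).card) hH
  rw [add_comm H.card, h3] at h2
  rw [mul_comm Γ.card, mul_comm Γ.card, ← h1, ← h4]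
  omega

lemma ClosedPair.card_le_of_degree (hB : BipCayley Γ E) (hc : ClosedPair Γ E A G)
    {Y : Finset V} {ψ : ℕ} (hY : Disjoint A Y)
    (hd : ∀ y ∈ Y, ψ ≤ (Γ.filter fun f => y + f ∈ G).card) :
    Γ.card * A.card + Y.card * ψ ≤ Γ.card * G.card := by
  have h1 : ∑ x ∈ A, (Γ.filter fun f => x + f ∈ G).card = A.card * Γ.card := by
    rw [sum_congr rfl fun x hx => by rw [filter_true_of_mem (hc.nb x hx)]]
    simp
  have h2 : Y.card * ψ ≤ ∑ x ∈ Y, (Γ.filter fun f => x + f ∈ G).card := by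
    simpa using card_nsmul_le_sum _ _ _ hd
  have h3 : ∑ x ∈ A ∪ Y, (Γ.filter fun f => x + f ∈ G).card ≤ G.card * Γ.card := by
    rw [hB.sum_degree_comm]
    simpa using sum_le_card_nsmul G (fun u => (Γ.filter fun f => u + f ∈ A ∪ Y).card)
      Γ.card (fun u _ => card_filter_le _ _)
  rw [sum_union hY, h1] at h3
  linarith [mul_comm Γ.card A.card, mul_comm Γ.card G.card]

variable [Fintype V]

/-- Odd vertices with more than `ψ` neighbours in `S`. -/
def oddHeavy (Γ E S : Finset V) (ψ : ℕ) : Finset V :=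
  univ.filter fun u => u ∉ E ∧ ψ < (Γ.filter fun f => u + f ∈ S).card

/-- Even vertices all but at most `ψ` of whose neighbours lie in `F`. -/
def evenFull (Γ E F : Finset V) (ψ : ℕ) : Finset V :=
  univ.filter fun x => x ∈ E ∧ (Γ.filter fun f => x + f ∉ F).card ≤ ψ

/-- One refinement step for the odd part. -/
def refineOdd (Γ E S M M' : Finset V) (ψ : ℕ) : Finset V :=
  oddHeavy Γ E (S \ (M + Γ)) ψ ∪ (M' + Γ)

/-- One round of refinement of an approximation `S` of `A`. -/
lemma ClosedPair.exists_refine (hB : BipCayley Γ E) (hc : ClosedPair Γ E A G) {t e ψ : ℕ}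
    (ht : G.card = A.card + t) (hψ : 2 * ψ < Γ.card) (S : Finset V)
    (he : (A \ S).card ≤ e) :
    ∃ M M' : Finset V, M.card * ψ ≤ (S \ A).card ∧ M'.card * ψ ≤ 2 * (t + e) ∧
      (∀ w ∈ M, ∃ f ∈ Γ, w + f ∈ S \ A) ∧
      (∀ w ∈ M', ∃ f ∈ Γ, w + f ∈ innerBdry Γ A G ∨ ∃ g ∈ Γ, w + f + g ∈ A \ S) ∧
      Disjoint A (M + Γ) ∧
      refineOdd Γ E S M M' ψ ⊆ G ∧
      (∀ u ∈ G, u ∉ refineOdd Γ E S M M' ψ →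
        (Γ.filter fun f => u + f ∈ S \ (M + Γ)).card ≤ ψ) ∧
      (G \ refineOdd Γ E S M M' ψ).card ≤ 2 * (t + e) ∧
      A ⊆ evenFull Γ E (refineOdd Γ E S M M' ψ) ψ ∧
      (evenFull Γ E (refineOdd Γ E S M M' ψ) ψ \ A).card ≤ 2 * t := by
  obtain ⟨M, hMC, hM1, hM2, hM3⟩ :=
    exists_greedy_cover (Γ := Γ) (univ.filter fun u => u ∉ E ∧ u ∉ G) ψ (S \ A)
  have hMA : Disjoint A (M + Γ) := by
    rw [disjoint_left]
    intro x hx hxM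
    obtain ⟨w, hw, f, hf, rfl⟩ := mem_add.1 hxM
    have := hB.sub_mem hf hx hc
    rw [add_sub_cancel_right] at this
    exact (mem_filter.1 (hMC hw)).2.2 this
  set F₁ := oddHeavy Γ E (S \ (M + Γ)) ψ with hF₁
  have hF₁G : F₁ ⊆ G := by
    intro w hw
    simp only [hF₁, oddHeavy, mem_filter, mem_univ, true_and] at hw
    by_contra hwG
    have h := hM2 w (by simp [hw.1, hwG])
    have : (Γ.filter fun f => w + f ∈ S \ (M + Γ)) ⊆
        (Γ.filter fun f => w + f ∈ S \ A ∧ w + f ∉ M + Γ) := by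
      intro f hf
      simp only [mem_filter, mem_sdiff] at hf ⊢
      refine ⟨hf.1, ⟨hf.2.1, fun hA => hwG ?_⟩, hf.2.2⟩
      have := hB.sub_mem hf.1 hA hc
      rwa [add_sub_cancel_right] at this
    have := card_le_card this
    omega
  have hlow : ∀ u ∈ G, u ∉ F₁ → (Γ.filter fun f => u + f ∈ S \ (M + Γ)).card ≤ ψ := by
    intro u hu hF
    by_contra h
    exact hF (by simp only [hF₁, oddHeavy, mem_filter, mem_univ, true_and]
                 exact ⟨hc.odd u hu, by omega⟩)
  have hGF : (G \ F₁).card ≤ 2 * (t + e) := by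
    have h1 := ClosedPair.card_mul_le hB (X := A ∩ S) (H := G \ F₁) (ψ := Γ.card - ψ) (G := G)
      (fun x hx f hf => hc.nb x (mem_inter.1 hx).1 f hf) sdiff_subset (by
        intro w hw
        have h1 := hlow w (mem_sdiff.1 hw).1 (mem_sdiff.1 hw).2
        have h2 : (Γ.filter fun f => w + f ∈ A ∩ S).card ≤
            (Γ.filter fun f => w + f ∈ S \ (M + Γ)).card := card_le_card (by
          intro f hf
          simp only [mem_filter, mem_sdiff, mem_inter] at hf ⊢
          exact ⟨hf.1, hf.2.2, disjoint_left.1 hMA hf.2.1⟩)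
        omega)
    have h2 := card_inter_add_card_sdiff A S
    have h3 : Γ.card * A.card ≤ Γ.card * (A ∩ S).card + Γ.card * e := by
      rw [← mul_add]; exact Nat.mul_le_mul_left _ (by omega)
    have h4 : (G \ F₁).card * Γ.card ≤ 2 * ((G \ F₁).card * (Γ.card - ψ)) := by
      rw [mul_left_comm]; exact Nat.mul_le_mul_left _ (by omega)
    rw [ht, mul_add] at h1
    have h5 : (G \ F₁).card * Γ.card ≤ 2 * (t + e) * Γ.card := by nlinarith
    exact Nat.le_of_mul_le_mul_right h5 (by omega)
  obtain ⟨M', hMC', hM1', hM2', hM3'⟩ := exists_greedy_cover (Γ := Γ) A ψ (G \ F₁)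
  have hF₂ : refineOdd Γ E S M M' ψ ⊆ G := by
    refine union_subset hF₁G fun y hy => ?_
    obtain ⟨w, hw, f, hf, rfl⟩ := mem_add.1 hy
    exact hc.nb w (hMC' hw) f hf
  refine ⟨M, M', hM1, hM1'.trans hGF, hM3, ?_, hMA, hF₂, ?_, ?_, ?_, ?_⟩
  · intro w hw
    obtain ⟨f, hf, hfG⟩ := hM3' w hw
    refine ⟨f, hf, ?_⟩
    rw [mem_sdiff] at hfG
    have h1 := hlow _ hfG.1 hfG.2
    obtain ⟨g, hg, hgS⟩ : ∃ g ∈ Γ, w + f + g ∉ S \ (M + Γ) := by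
      by_contra! hcon
      rw [filter_true_of_mem hcon] at h1
      omega
    by_cases hA : w + f + g ∈ A
    · refine Or.inr ⟨g, hg, mem_sdiff.2 ⟨hA, fun hS => hgS ?_⟩⟩
      exact mem_sdiff.2 ⟨hS, disjoint_left.1 hMA hA⟩
    · exact Or.inl (mem_innerBdry.2 ⟨hfG.1, g, hg, hA⟩)
  · intro u hu hF
    exact hlow u hu fun h => hF (mem_union_left _ h)
  · exact (card_le_card (sdiff_subset_sdiff subset_rfl subset_union_left)).trans hGF
  · intro x hx
    simp only [evenFull, mem_filter, mem_univ, true_and]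
    refine ⟨hc.even x hx, (card_le_card fun f hf => ?_).trans (hM2' x hx)⟩
    simp only [mem_filter, refineOdd, mem_union, mem_sdiff, not_or] at hf ⊢
    exact ⟨hf.1, ⟨hc.nb x hx f hf.1, hf.2.1⟩, hf.2.2⟩
  · have h1 := hc.card_le_of_degree hB
      (Y := evenFull Γ E (refineOdd Γ E S M M' ψ) ψ \ A) (ψ := Γ.card - ψ)
      disjoint_sdiff (by
        intro y hy
        simp only [evenFull, mem_filter, mem_univ, true_and, mem_sdiff] at hy
        have h2 := card_filter_add_card_filter_not (s := Γ)
          (fun f => y + f ∈ refineOdd Γ E S M M' ψ)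
        have h3 : (Γ.filter fun f => y + f ∈ refineOdd Γ E S M M' ψ).card ≤
            (Γ.filter fun f => y + f ∈ G).card := card_le_card fun f hf => by
          simp only [mem_filter] at hf ⊢; exact ⟨hf.1, hF₂ hf.2⟩
        omega)
    rw [ht, mul_add] at h1
    set c := (evenFull Γ E (refineOdd Γ E S M M' ψ) ψ \ A).card
    have h4 : c * Γ.card ≤ 2 * (c * (Γ.card - ψ)) := by
      rw [mul_left_comm]; exact Nat.mul_le_mul_left _ (by omega)
    have h5 : c * Γ.card ≤ 2 * t * Γ.card := by nlinarith
    exact Nat.le_of_mul_le_mul_right h5 (by omega)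

/-- The odd set of the approximating pair determined by a rough guess `S` and four
small sets of centres. -/
def approxOdd (Γ E S M₁ M₂ M₃ M₄ : Finset V) (ψ : ℕ) : Finset V :=
  refineOdd Γ E (evenFull Γ E (refineOdd Γ E S M₁ M₂ ψ) ψ) M₃ M₄ ψ

/-- The even set of the approximating pair determined by a rough guess `S` and four
small sets of centres. -/
def approxEven (Γ E S M₁ M₂ M₃ M₄ : Finset V) (ψ : ℕ) : Finset V :=
  (evenFull Γ E (refineOdd Γ E S M₁ M₂ ψ) ψ \ (M₃ + Γ)) ∩
    evenFull Γ E (approxOdd Γ E S M₁ M₂ M₃ M₄ ψ) ψ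

/-- Approximating pairs from a rough guess `S` with at most `e` errors of each kind. -/
theorem ClosedPair.exists_approx (hB : BipCayley Γ E) (hc : ClosedPair Γ E A G) {t e ψ : ℕ}
    (ht : G.card = A.card + t) (hψ : 2 * ψ < Γ.card) (S : Finset V)
    (he : (A \ S).card ≤ e) (he' : (S \ A).card ≤ e) :
    ∃ M₁ M₂ M₃ M₄ : Finset V,
      M₁.card * ψ ≤ e ∧ M₂.card * ψ ≤ 2 * (t + e) ∧ M₃.card * ψ ≤ 2 * t ∧ M₄.card * ψ ≤ 2 * t ∧
      (∀ w ∈ M₁, ∃ f ∈ Γ, w + f ∈ S \ A) ∧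
      (∀ w ∈ M₂, ∃ f ∈ Γ, w + f ∈ innerBdry Γ A G ∨ ∃ g ∈ Γ, w + f + g ∈ A \ S) ∧
      (∀ w ∈ M₃, ∃ f ∈ Γ, ∃ g ∈ Γ, w + f + g ∈ innerBdry Γ A G) ∧
      (∀ w ∈ M₄, ∃ f ∈ Γ, w + f ∈ innerBdry Γ A G) ∧
      ApproxPair Γ A G (approxOdd Γ E S M₁ M₂ M₃ M₄ ψ) (approxEven Γ E S M₁ M₂ M₃ M₄ ψ) ψ ∧
      G \ approxOdd Γ E S M₁ M₂ M₃ M₄ ψ ⊆ innerBdry Γ A G ∧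
      Γ.card * (approxEven Γ E S M₁ M₂ M₃ M₄ ψ).card ≤
        Γ.card * (approxOdd Γ E S M₁ M₂ M₃ M₄ ψ).card + 4 * ψ * t := by
  obtain ⟨M₁, M₂, a1, a2, a3, a4, -, a6, -, -, a9, a10⟩ := hc.exists_refine hB ht hψ S he
  set F₂ := refineOdd Γ E S M₁ M₂ ψ with hF₂
  set S₂ := evenFull Γ E F₂ ψ with hS₂
  obtain ⟨M₃, M₄, b1, b2, b3, b4, b5, b6, b7, b8, b9, b10⟩ :=
    hc.exists_refine hB ht hψ S₂ (e := 0) (by rw [sdiff_eq_empty_iff_subset.2 a9]; simp)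
  have hbd : ∀ x ∈ S₂ \ A, ∃ g ∈ Γ, x + g ∈ innerBdry Γ A G := by
    intro x hx
    rw [mem_sdiff] at hx
    have h1 := (mem_filter.1 hx.1).2.2
    obtain ⟨g, hg, hgF⟩ : ∃ g ∈ Γ, x + g ∈ F₂ := by
      by_contra! hcon
      rw [filter_true_of_mem hcon] at h1
      omega
    refine ⟨g, hg, mem_innerBdry.2 ⟨a6 hgF, -g, hB.neg_mem g hg, ?_⟩⟩
    rw [add_neg_cancel_right]; exact hx.2
  have hGb : G \ refineOdd Γ E S₂ M₃ M₄ ψ ⊆ innerBdry Γ A G := by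
    intro u hu
    rw [mem_sdiff] at hu
    have h1 := b7 u hu.1 hu.2
    obtain ⟨g, hg, hgS⟩ : ∃ g ∈ Γ, u + g ∉ S₂ \ (M₃ + Γ) := by
      by_contra! hcon
      rw [filter_true_of_mem hcon] at h1
      omega
    exact mem_innerBdry.2 ⟨hu.1, g, hg, fun hA => hgS
      (mem_sdiff.2 ⟨a9 hA, disjoint_left.1 b5 hA⟩)⟩
  have hF : approxOdd Γ E S M₁ M₂ M₃ M₄ ψ = refineOdd Γ E S₂ M₃ M₄ ψ := rfl
  have hS : approxEven Γ E S M₁ M₂ M₃ M₄ ψ =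
    (S₂ \ (M₃ + Γ)) ∩ evenFull Γ E (refineOdd Γ E S₂ M₃ M₄ ψ) ψ := rfl
  refine ⟨M₁, M₂, M₃, M₄, a1.trans he', a2, b1.trans a10, by simpa using b2, a3, a4, ?_⟩
  rw [hF, hS]
  set F := refineOdd Γ E S₂ M₃ M₄ ψ with hFdef
  set S₄ := (S₂ \ (M₃ + Γ)) ∩ evenFull Γ E F ψ with hS₄
  have hap : ApproxPair Γ A G F S₄ ψ := by
    refine ⟨fun u hu => b6 hu, fun x hx => mem_inter.2 ⟨mem_sdiff.2 ⟨a9 hx,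
      disjoint_left.1 b5 hx⟩, b9 hx⟩, fun x hx => (mem_filter.1 (mem_inter.1 hx).2).2.2,
      fun u hu hF => (card_le_card fun f hf => ?_).trans (b7 u hu hF)⟩
    rw [mem_filter] at hf ⊢
    exact ⟨hf.1, (mem_inter.1 hf.2).1⟩
  refine ⟨?_, ?_, hap, hGb, ?_⟩
  · intro w hw
    obtain ⟨f, hf, hx⟩ := b3 w hw
    obtain ⟨g, hg, h⟩ := hbd _ hx
    exact ⟨f, hf, g, hg, h⟩
  · intro w hw
    obtain ⟨f, hf, h | ⟨g, hg, h⟩⟩ := b4 w hw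
    · exact ⟨f, hf, h⟩
    · rw [mem_sdiff] at h
      exact absurd (a9 h.1) h.2
  · have hSA : S₄ \ A ⊆ S₂ \ A := by
      intro x hx
      rw [mem_sdiff] at hx ⊢
      exact ⟨(mem_sdiff.1 (mem_inter.1 hx.1).1).1, hx.2⟩
    have c1 : ∑ x ∈ S₄, (Γ.filter fun f => x + f ∈ F).card +
        ∑ x ∈ S₄, (Γ.filter fun f => x + f ∉ F).card = Γ.card * S₄.card := by
      rw [← sum_add_distrib]
      simp_rw [card_filter_add_card_filter_not]
      simp [mul_comm]
    have c2 : ∑ x ∈ S₄, (Γ.filter fun f => x + f ∈ F).card ≤ Γ.card * F.card := by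
      rw [hB.sum_degree_comm, mul_comm]
      simpa using sum_le_card_nsmul F (fun u => (Γ.filter fun f => u + f ∈ S₄).card)
        Γ.card (fun u _ => card_filter_le _ _)
    have c3 : ∑ x ∈ S₄ \ A, (Γ.filter fun f => x + f ∉ F).card ≤ 2 * t * ψ := by
      refine (sum_le_card_nsmul _ _ ψ fun x hx => hap.deg_even x (mem_sdiff.1 hx).1).trans ?_
      rw [smul_eq_mul]
      exact Nat.mul_le_mul_right _ ((card_le_card hSA).trans a10)
    have c4 : ∑ x ∈ A, (Γ.filter fun f => x + f ∉ F).card ≤ 2 * t * ψ := by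
      have : ∑ x ∈ A, (Γ.filter fun f => x + f ∉ F).card =
          ∑ x ∈ A, (Γ.filter fun f => x + f ∈ G \ F).card := by
        refine sum_congr rfl fun x hx => congrArg card (filter_congr fun f hf => ?_)
        simp [hc.nb x hx f hf]
      rw [this, hB.sum_degree_comm]
      refine (sum_le_card_nsmul _ _ ψ fun u hu => ?_).trans ?_
      · rw [mem_sdiff] at hu
        refine (card_le_card fun f hf => ?_).trans (hap.deg_odd u hu.1 hu.2)
        rw [mem_filter] at hf ⊢
        exact ⟨hf.1, hap.sub_even _ hf.2⟩
      · rw [smul_eq_mul]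
        exact Nat.mul_le_mul_right _ (by simpa using b8)
    have c5 : ∑ x ∈ S₄, (Γ.filter fun f => x + f ∉ F).card =
        ∑ x ∈ S₄ \ A, (Γ.filter fun f => x + f ∉ F).card +
        ∑ x ∈ A, (Γ.filter fun f => x + f ∉ F).card :=
      (sum_sdiff fun x hx => hap.sub_even x hx).symm
    nlinarith
end Approximation

section Net

open scoped Pointwise

variable {V : Type*} [AddCommGroup V] [DecidableEq V] {Γ E A G : Finset V}

/-- The ball of radius `n` around `0` for the word metric of `Γ`. -/
def cayleyBall (Γ : Finset V) (n : ℕ) : Finset V := n • insert 0 Γ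

lemma add_mem_cayleyBall {m n : ℕ} {a b : V} (ha : a ∈ cayleyBall Γ m) (hb : b ∈ cayleyBall Γ n) :
    a + b ∈ cayleyBall Γ (m + n) := by
  unfold cayleyBall at *
  rw [add_nsmul]
  exact add_mem_add ha hb

lemma cayleyBall_mono {m n : ℕ} (h : m ≤ n) : cayleyBall Γ m ⊆ cayleyBall Γ n :=
  Finset.nsmul_right_monotone (mem_insert_self 0 Γ) h

lemma mem_cayleyBall_one {f : V} (hf : f ∈ Γ) : f ∈ cayleyBall Γ 1 := by
  simp [cayleyBall, hf]

lemma zero_mem_cayleyBall (n : ℕ) : (0 : V) ∈ cayleyBall Γ n :=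
  cayleyBall_mono (Nat.zero_le n) (by simp [cayleyBall])

lemma card_cayleyBall_le (n : ℕ) : (cayleyBall Γ n).card ≤ (Γ.card + 1) ^ n :=
  (card_nsmul_le (s := insert 0 Γ)).trans (Nat.pow_le_pow_left (card_insert_le _ _) n)

lemma BipCayley.neg_mem_cayleyBall (hB : BipCayley Γ E) {n : ℕ} {a : V}
    (ha : a ∈ cayleyBall Γ n) : -a ∈ cayleyBall Γ n := by
  induction n generalizing a with
  | zero => simpa [cayleyBall] using ha
  | succ n ih =>
    unfold cayleyBall at *
    rw [succ_nsmul] at *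
    obtain ⟨b, hb, c, hc, rfl⟩ := mem_add.1 ha
    rw [neg_add]
    refine add_mem_add (ih hb) ?_
    rcases mem_insert.1 hc with rfl | hc
    · simp
    · exact mem_insert_of_mem (hB.neg_mem c hc)

lemma mem_cayleyBall_zero {a : V} : a ∈ cayleyBall Γ 0 ↔ a = 0 := by simp [cayleyBall]

lemma mem_cayleyBall_succ {a : V} {n : ℕ} : a ∈ cayleyBall Γ (n + 1) ↔
    ∃ b ∈ cayleyBall Γ n, ∃ c ∈ insert 0 Γ, b + c = a := by
  unfold cayleyBall
  rw [succ_nsmul, mem_add]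

attribute [irreducible] cayleyBall

/-- The number of neighbours of `u` outside `A`. -/
def outDegree (Γ A : Finset V) (u : V) : ℕ := (Γ.filter fun f => u + f ∉ A).card

lemma ClosedPair.sum_outDegree (hB : BipCayley Γ E) (hc : ClosedPair Γ E A G) {t : ℕ}
    (ht : G.card = A.card + t) : ∑ u ∈ G, outDegree Γ A u = Γ.card * t := by
  have h1 : ∑ u ∈ G, (Γ.filter fun f => u + f ∈ A).card + ∑ u ∈ G, outDegree Γ A u =
      Γ.card * G.card := by
    rw [← sum_add_distrib]
    simp_rw [outDegree, card_filter_add_card_filter_not]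
    simp [mul_comm]
  have h2 : ∑ x ∈ A, (Γ.filter fun f => x + f ∈ G).card = A.card * Γ.card := by
    rw [sum_congr rfl fun x hx => by rw [filter_true_of_mem (hc.nb x hx)]]
    simp
  rw [← hB.sum_degree_comm, h2, ht] at h1
  linarith [mul_add Γ.card A.card t, mul_comm Γ.card A.card]

/-- Many parallel boundary edges force many boundary edges nearby. -/
lemma ClosedPair.card_sq_le_of_parallel (hB : BipCayley Γ E) (hc : ClosedPair Γ E A G)
    {Fs U : Finset V} {p q : V} (hpq : q - p ∈ Γ) (hcard : Γ.card ≤ 2 * Fs.card)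
    (hw : ∀ f ∈ Fs, p + f ∈ G) (hy : ∀ f ∈ Fs, q + f ∉ A)
    (hU : ∀ f ∈ Fs, p + f ∈ U) (hU' : ∀ f ∈ Fs, ∀ g ∈ Γ, q + f + g ∈ U) :
    Γ.card ^ 2 ≤ 4 * ∑ u ∈ G ∩ U, outDegree Γ A u := by
  have hT1 : ∑ f ∈ Fs, outDegree Γ A (p + f) ≤ ∑ u ∈ G ∩ U, outDegree Γ A u := by
    rw [← sum_image (f := outDegree Γ A) (g := fun f => p + f)
      (fun a _ b _ h => add_right_injective p h)]
    refine sum_le_sum_of_subset fun w hw' => ?_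
    obtain ⟨f, hf, rfl⟩ := mem_image.1 hw'
    exact mem_inter.2 ⟨hw f hf, hU f hf⟩
  have hT2 : ∑ f ∈ Fs, (Γ.filter fun g => q + f + g ∈ G).card ≤
      ∑ u ∈ G ∩ U, outDegree Γ A u := by
    have e1 : ∑ f ∈ Fs, (Γ.filter fun g => q + f + g ∈ G).card =
        ∑ y ∈ Fs.image (q + ·), (Γ.filter fun g => y + g ∈ G ∩ U).card := by
      rw [sum_image (fun a _ b _ h => add_right_injective q h)]
      refine sum_congr rfl fun f hf => congrArg card (filter_congr fun g hg => ?_)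
      simp [hU' f hf g hg]
    rw [e1, hB.sum_degree_comm]
    refine sum_le_sum fun u _ => card_le_card fun g hg => ?_
    rw [mem_filter] at hg ⊢
    refine ⟨hg.1, ?_⟩
    obtain ⟨f, hf, h⟩ := mem_image.1 hg.2
    rw [← h]; exact hy f hf
  have hT3 : Fs.card * Γ.card ≤
      ∑ f ∈ Fs, (outDegree Γ A (p + f) + (Γ.filter fun g => q + f + g ∈ G).card) := by
    rw [← smul_eq_mul]
    refine card_nsmul_le_sum _ _ _ fun f hf => ?_
    have h1 := card_filter_add_card_filter_not (s := Γ) (fun g => p + f + g ∈ A)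
    have h2 : (Γ.filter fun g => p + f + g ∈ A).card ≤
        (Γ.filter fun g => q + f + g ∈ G).card := card_le_card fun g hg => by
      rw [mem_filter] at hg ⊢
      refine ⟨hg.1, ?_⟩
      have := hc.nb _ hg.2 _ hpq
      have e : p + f + g + (q - p) = q + f + g := by abel
      rwa [e] at this
    unfold outDegree
    omega
  rw [sum_add_distrib] at hT3
  nlinarith

/-- Around each inner boundary vertex there are at least `|Γ|² / 4` boundary edges. -/
lemma ClosedPair.card_sq_le (hB : BipCayley Γ E) (hc : ClosedPair Γ E A G)
    (htouch : ∀ u ∈ innerBdry Γ A G, ∃ f ∈ Γ, u + f ∈ A) {u : V} (hu : u ∈ innerBdry Γ A G) :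
    Γ.card ^ 2 ≤ 4 * ∑ w ∈ G ∩ (cayleyBall Γ 4).image (u + ·), outDegree Γ A w := by
  obtain ⟨huG, f₀, hf₀, hy⟩ := mem_innerBdry.1 hu
  have hU : ∀ a ∈ cayleyBall Γ 4, u + a ∈ (cayleyBall Γ 4).image (u + ·) := fun a ha =>
    mem_image_of_mem _ ha
  have hb := fun {f : V} (hf : f ∈ Γ) => mem_cayleyBall_one hf
  by_cases hheavy : Γ.card ≤ 2 * (Γ.filter fun f => u + f ∉ A).card
  · obtain ⟨h, hh, hz⟩ := htouch u hu
    refine hc.card_sq_le_of_parallel hB (p := u + h) (q := u) ?_ hheavy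
      ?_ ?_ ?_ ?_
    · simpa using hB.neg_mem h hh
    · intro f hf; exact hc.nb _ hz f (mem_filter.1 hf).1
    · intro f hf; exact (mem_filter.1 hf).2
    · intro f hf
      rw [add_assoc]
      exact hU _ (cayleyBall_mono (by norm_num)
        (add_mem_cayleyBall (hb hh) (hb (mem_filter.1 hf).1)))
    · intro f hf g hg
      rw [add_assoc]
      exact hU _ (cayleyBall_mono (by norm_num)
        (add_mem_cayleyBall (hb (mem_filter.1 hf).1) (hb hg)))
  · have hyE : u + f₀ ∈ E := (hB.parity u f₀ hf₀).2 (hc.odd u huG)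
    obtain ⟨h, hh, hv⟩ : ∃ h ∈ Γ, u + f₀ + h ∉ G := by
      by_contra! hcon
      exact hy (hc.closed _ hyE hcon)
    have h1 := card_filter_add_card_filter_not (s := Γ) (fun g => u + g ∈ A)
    have h2 : (Γ.filter fun g => u + g ∈ A).card ≤
        (Γ.filter fun g => u + f₀ + g ∈ G).card := card_le_card fun g hg => by
      rw [mem_filter] at hg ⊢
      refine ⟨hg.1, ?_⟩
      have := hc.nb _ hg.2 _ hf₀
      rwa [add_right_comm] at this
    refine hc.card_sq_le_of_parallel hB (p := u + f₀) (q := u + f₀ + h)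
      (Fs := Γ.filter fun g => u + f₀ + g ∈ G) ?_ (by omega)
      ?_ ?_ ?_ ?_
    · simpa using hh
    · intro f hf; exact (mem_filter.1 hf).2
    · intro f hf hA
      have := hB.sub_mem (mem_filter.1 hf).1 hA hc
      rw [add_sub_cancel_right] at this
      exact hv this
    · intro f hf
      rw [add_assoc]
      exact hU _ (cayleyBall_mono (by norm_num)
        (add_mem_cayleyBall (hb hf₀) (hb (mem_filter.1 hf).1)))
    · intro f hf g hg
      rw [add_assoc, add_assoc, add_assoc]
      exact hU _ (add_mem_cayleyBall (hb hf₀) (add_mem_cayleyBall (hb hh)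
        (add_mem_cayleyBall (hb (mem_filter.1 hf).1) (hb hg))))

lemma exists_maximal_separated {α : Type*} [DecidableEq α] (s : Finset α) (r : α → α → Prop)
    (hr : ∀ a, r a a) (hs : ∀ a b, r a b → r b a) :
    ∃ Q ⊆ s, (∀ a ∈ Q, ∀ b ∈ Q, r a b → a = b) ∧ ∀ u ∈ s, ∃ q ∈ Q, r q u := by
  induction s using Finset.induction_on with
  | empty => exact ⟨∅, by simp⟩
  | insert a s ha ih =>
    obtain ⟨Q, hQ, h1, h2⟩ := ih
    by_cases h : ∃ q ∈ Q, r q a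
    · refine ⟨Q, hQ.trans (subset_insert _ _), h1, fun u hu => ?_⟩
      rcases mem_insert.1 hu with rfl | hu
      · exact h
      · exact h2 u hu
    · push Not at h
      refine ⟨insert a Q, insert_subset_insert a hQ, ?_, fun u hu => ?_⟩
      · intro x hx y hy hxy
        rcases mem_insert.1 hx with hxa | hx <;> rcases mem_insert.1 hy with hya | hy
        · rw [hxa, hya]
        · exact absurd (hs _ _ (hxa ▸ hxy)) (h y hy)
        · exact absurd (hya ▸ hxy) (h x hx)
        · exact h1 x hx y hy hxy
      · rcases mem_insert.1 hu with rfl | hu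
        · exact ⟨u, mem_insert_self _ _, hr u⟩
        · obtain ⟨q, hq, hqu⟩ := h2 u hu
          exact ⟨q, mem_insert_of_mem hq, hqu⟩

/-- A sparse net in the inner boundary. -/
theorem ClosedPair.exists_net (hB : BipCayley Γ E) (hc : ClosedPair Γ E A G)
    (htouch : ∀ u ∈ innerBdry Γ A G, ∃ f ∈ Γ, u + f ∈ A) {t : ℕ}
    (ht : G.card = A.card + t) (hΓ : Γ.Nonempty) :
    ∃ Q ⊆ innerBdry Γ A G, Q.card * Γ.card ≤ 4 * t ∧
      ∀ u ∈ innerBdry Γ A G, ∃ q ∈ Q, u - q ∈ cayleyBall Γ 8 := by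
  obtain ⟨Q, hQ, h1, h2⟩ := exists_maximal_separated (innerBdry Γ A G)
    (fun q u => u - q ∈ cayleyBall Γ 8) (fun a => by simpa using zero_mem_cayleyBall 8)
    (fun a b h => by simpa using hB.neg_mem_cayleyBall h)
  refine ⟨Q, hQ, ?_, h2⟩
  have hdisj : (Q : Set V).PairwiseDisjoint
      fun u => G ∩ (cayleyBall Γ 4).image (u + ·) := by
    intro a ha b hb hab
    rw [Function.onFun, disjoint_left]
    intro w hwa hwb
    obtain ⟨x, hx, hxa⟩ := mem_image.1 (mem_inter.1 hwa).2
    obtain ⟨y, hy, hyb⟩ := mem_image.1 (mem_inter.1 hwb).2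
    refine hab (h1 a ha b hb ?_)
    have : b - a = x + -y := by
      have : a + x = b + y := hxa.trans hyb.symm
      rw [← sub_eq_add_neg, sub_eq_sub_iff_add_eq_add, add_comm x a, this]
    rw [this]
    exact add_mem_cayleyBall hx (hB.neg_mem_cayleyBall hy)
  have h3 : Q.card * Γ.card ^ 2 ≤
      4 * ∑ u ∈ Q, ∑ w ∈ G ∩ (cayleyBall Γ 4).image (u + ·), outDegree Γ A w := by
    rw [mul_sum, ← smul_eq_mul]
    exact card_nsmul_le_sum _ _ _ fun u hu => hc.card_sq_le hB htouch (hQ hu)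
  rw [← sum_biUnion hdisj] at h3
  have h4 : ∑ w ∈ Q.biUnion (fun u => G ∩ (cayleyBall Γ 4).image (u + ·)), outDegree Γ A w ≤
      ∑ w ∈ G, outDegree Γ A w :=
    sum_le_sum_of_subset (biUnion_subset.2 fun u _ => inter_subset_left)
  rw [hc.sum_outDegree hB ht] at h4
  have h5 : Q.card * Γ.card * Γ.card ≤ 4 * t * Γ.card := by nlinarith
  exact Nat.le_of_mul_le_mul_right h5 (card_pos.2 hΓ)

/-- `Q` can be explored from `R` by steps `v ⟶ u` with `u ∈ N v` staying in `R ∪ Q`. -/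
def LinkedFrom {α : Type*} [DecidableEq α] (N : α → Finset α) (R Q : Finset α) : Prop :=
  ∀ U ⊆ Q, U.Nonempty → ∃ u ∈ U, ∃ v ∈ R ∪ (Q \ U), u ∈ N v

/-- If every cluster of the inner boundary carries at least `m` boundary edges, the net can be
explored from a set of few roots. -/
theorem ClosedPair.exists_roots (hB : BipCayley Γ E) (hc : ClosedPair Γ E A G) {t m : ℕ}
    (ht : G.card = A.card + t) {Q : Finset V} (hQ : Q ⊆ innerBdry Γ A G)
    (hnet : ∀ u ∈ innerBdry Γ A G, ∃ q ∈ Q, u - q ∈ cayleyBall Γ 8)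
    (hclump : ∀ κ ⊆ innerBdry Γ A G, κ.Nonempty →
      (∀ u ∈ κ, ∀ w ∈ innerBdry Γ A G, w - u ∈ cayleyBall Γ 2 → w ∈ κ) →
      m ≤ ∑ u ∈ κ, outDegree Γ A u) :
    ∃ R ⊆ Q, R.card * m ≤ Γ.card * t ∧
      LinkedFrom (fun v => (cayleyBall Γ 18).image (v + ·)) R (Q \ R) := by
  classical
  set step : V → V → Prop := fun a b => a ∈ Q ∧ b ∈ Q ∧ b - a ∈ cayleyBall Γ 18 with hstep
  have hsymm : ∀ a b, Relation.ReflTransGen step a b → Relation.ReflTransGen step b a := by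
    intro a b h
    have : Std.Symm step := ⟨fun a b h =>
      ⟨h.2.1, h.1, by simpa using hB.neg_mem_cayleyBall h.2.2⟩⟩
    exact symm h
  obtain ⟨R, hR, h1, h2⟩ := exists_maximal_separated Q (Relation.ReflTransGen step)
    (fun _ => Relation.ReflTransGen.refl) hsymm
  refine ⟨R, hR, ?_, ?_⟩
  · set κ : V → Finset V := fun r => (innerBdry Γ A G).filter
      (fun u => ∃ q ∈ Q, Relation.ReflTransGen step r q ∧ u - q ∈ cayleyBall Γ 8) with hκ
    have hdisj : (R : Set V).PairwiseDisjoint κ := by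
      intro a ha b hb hab
      rw [Function.onFun, disjoint_left]
      intro w hwa hwb
      obtain ⟨q, hq, hq1, hq2⟩ := (mem_filter.1 hwa).2
      obtain ⟨q', hq', hq1', hq2'⟩ := (mem_filter.1 hwb).2
      refine hab (h1 a ha b hb ((hq1.tail ⟨hq, hq', ?_⟩).trans (hsymm _ _ hq1')))
      have : q' - q = (w - q) + -(w - q') := by abel
      rw [this]
      exact cayleyBall_mono (by norm_num)
        (add_mem_cayleyBall hq2 (hB.neg_mem_cayleyBall hq2'))
    have h3 : R.card * m ≤ ∑ r ∈ R, ∑ u ∈ κ r, outDegree Γ A u := by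
      rw [← smul_eq_mul]
      refine card_nsmul_le_sum _ _ _ fun r hr => hclump _ (filter_subset _ _) ?_ ?_
      · exact ⟨r, mem_filter.2 ⟨hQ (hR hr), r, hR hr, Relation.ReflTransGen.refl, by
          simpa using zero_mem_cayleyBall 8⟩⟩
      · intro u hu w hw hwu
        obtain ⟨q, hq, hq1, hq2⟩ := (mem_filter.1 hu).2
        obtain ⟨q', hq', hq2'⟩ := hnet w hw
        refine mem_filter.2 ⟨hw, q', hq', hq1.tail ⟨hq, hq', ?_⟩, hq2'⟩
        have : q' - q = (u - q) + (w - u) + -(w - q') := by abel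
        rw [this]
        exact add_mem_cayleyBall (add_mem_cayleyBall hq2 hwu) (hB.neg_mem_cayleyBall hq2')
    rw [← sum_biUnion hdisj] at h3
    refine h3.trans ((sum_le_sum_of_subset ?_).trans (hc.sum_outDegree hB ht).le)
    refine biUnion_subset.2 fun r _ => (filter_subset _ _).trans ?_
    exact filter_subset _ _
  · rintro U hU ⟨q, hq⟩
    obtain ⟨r, hr, hrq⟩ := h2 q (mem_sdiff.1 (hU hq)).1
    by_contra! hcon
    have hall : ∀ b, Relation.ReflTransGen step r b → b ∉ U := by
      intro b hb
      induction hb with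
      | refl => exact fun h => (mem_sdiff.1 (hU h)).2 hr
      | @tail b c _ hbc ih =>
        intro hcU
        refine hcon c hcU b ?_ (mem_image.2 ⟨c - b, hbc.2.2, by abel⟩)
        by_cases hbR : b ∈ R
        · exact mem_union_left _ hbR
        · exact mem_union_right _ (mem_sdiff.2 ⟨mem_sdiff.2 ⟨hbc.1, hbR⟩, ih⟩)
    exact hall q hrq hq
end Net

section Counting

variable {α : Type*} [DecidableEq α]

lemma sum_powerset_pow_card (X : Finset α) (x : ℝ) :
    ∑ M ∈ X.powerset, x ^ M.card = (x + 1) ^ X.card := by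
  rw [← sum_pow_mul_eq_add_pow]
  simp

/-- The number of subsets of `X` of size at most `b`. -/
lemma card_powerset_filter_le (X : Finset α) {x : ℝ} (hx : 0 < x) (hx1 : x ≤ 1) (b : ℕ) :
    ((X.powerset.filter fun M => M.card ≤ b).card : ℝ) ≤ Real.exp (x * X.card) * (x⁻¹) ^ b := by
  have h1 : ((X.powerset.filter fun M => M.card ≤ b).card : ℝ) * x ^ b ≤
      ∑ M ∈ X.powerset, x ^ M.card := by
    rw [← nsmul_eq_mul]
    refine (card_nsmul_le_sum _ (fun M => x ^ M.card) _ fun M hM => ?_).trans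
      (sum_le_sum_of_subset_of_nonneg (filter_subset _ _) fun _ _ _ => by positivity)
    exact pow_le_pow_of_le_one hx.le hx1 (mem_filter.1 hM).2
  rw [sum_powerset_pow_card] at h1
  have h2 : (x + 1) ^ X.card ≤ Real.exp (x * X.card) := by
    rw [mul_comm, Real.exp_nat_mul]
    exact pow_le_pow_left₀ (by positivity) (Real.add_one_le_exp x) _
  rw [inv_pow, ← div_eq_mul_inv, le_div_iff₀ (by positivity)]
  exact h1.trans h2

variable [Fintype α]

open Classical in
lemma sum_pow_card_linkedFrom_aux (N : α → Finset α) {Δ : ℕ} (hN : ∀ v, (N v).card ≤ Δ) {x : ℝ}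
    (hx0 : 0 ≤ x) (hx : (1 + 2 * x) ^ Δ ≤ 2) (k : ℕ) (R : Finset α) :
    ∑ Q ∈ univ.filter (fun Q => Q.card + R.card ≤ k ∧ Disjoint Q R ∧ LinkedFrom N R Q),
      x ^ Q.card ≤ 2 ^ R.card := by
  induction k generalizing R with
  | zero =>
    refine (sum_le_sum_of_subset_of_nonneg (t := {∅}) (fun Q hQ => ?_)
      (fun _ _ _ => by positivity)).trans ?_
    · simp only [mem_filter, mem_univ, true_and] at hQ
      have : Q.card = 0 := by omega
      simpa using this
    · simpa using one_le_pow₀ (by norm_num : (1 : ℝ) ≤ 2)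
  | succ k ih =>
    rcases R.eq_empty_or_nonempty with rfl | ⟨r, hr⟩
    · refine (sum_le_sum_of_subset_of_nonneg (t := {∅}) (fun Q hQ => ?_)
        (fun _ _ _ => by positivity)).trans (by simp)
      simp only [mem_filter, mem_univ, true_and] at hQ
      by_contra hne
      obtain ⟨u, hu, v, hv, -⟩ := hQ.2.2 Q subset_rfl (nonempty_iff_ne_empty.2 (by simpa using hne))
      simp at hv
    set S := univ.filter (fun Q => Q.card + R.card ≤ k + 1 ∧ Disjoint Q R ∧ LinkedFrom N R Q)
    set R' : Finset α → Finset α := fun T => R.erase r ∪ T with hR'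
    set S' : Finset α → Finset (Finset α) := fun T => univ.filter
      (fun Q => Q.card + (R' T).card ≤ k ∧ Disjoint Q (R' T) ∧ LinkedFrom N (R' T) Q) with hS'
    have hRpos := card_pos.2 ⟨r, hr⟩
    have hmap : ∀ Q ∈ S, ((⟨Q ∩ N r, Q \ N r⟩ : (_ : Finset α) × Finset α)) ∈
        (((N r).powerset.filter (fun T => Disjoint T R)).sigma S') := by
      intro Q hQ
      simp only [S, mem_filter, mem_univ, true_and] at hQ
      obtain ⟨h1, h2, h3⟩ := hQ
      have hTR : Disjoint (Q ∩ N r) R := h2.mono_left inter_subset_left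
      have hcT := card_inter_add_card_sdiff Q (N r)
      have hcR : (R' (Q ∩ N r)).card = R.card - 1 + (Q ∩ N r).card := by
        rw [hR']
        simp only
        rw [card_union_of_disjoint (hTR.symm.mono_left (erase_subset _ _)), card_erase_of_mem hr]
      simp only [mem_sigma, mem_filter, mem_powerset, hS', mem_univ, true_and]
      refine ⟨⟨inter_subset_right, hTR⟩, by omega, ?_, ?_⟩
      · rw [disjoint_union_right]
        exact ⟨(h2.mono_left sdiff_subset).mono_right (erase_subset _ _),
          disjoint_left.2 fun a ha hb => (mem_sdiff.1 ha).2 (mem_inter.1 hb).2⟩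
      · intro U hU hne
        obtain ⟨u, hu, v, hv, huv⟩ := h3 U (hU.trans sdiff_subset) hne
        refine ⟨u, hu, v, ?_, huv⟩
        have hvr : v ≠ r := by
          rintro rfl
          exact (mem_sdiff.1 (hU hu)).2 huv
        simp only [mem_union, mem_sdiff, mem_erase, mem_inter, hR'] at hv ⊢
        rcases hv with hv | hv
        · exact Or.inl (Or.inl ⟨hvr, hv⟩)
        · by_cases hvN : v ∈ N r
          · exact Or.inl (Or.inr ⟨hv.1, hvN⟩)
          · exact Or.inr ⟨⟨hv.1, hvN⟩, hv.2⟩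
    calc ∑ Q ∈ S, x ^ Q.card
        = ∑ Q ∈ S, x ^ (Q ∩ N r).card * x ^ (Q \ N r).card := by
          refine sum_congr rfl fun Q _ => ?_
          rw [← pow_add, card_inter_add_card_sdiff]
      _ = ∑ p ∈ S.image (fun Q => (⟨Q ∩ N r, Q \ N r⟩ : (_ : Finset α) × Finset α)),
            x ^ p.1.card * x ^ p.2.card := by
          rw [sum_image]
          intro Q₁ _ Q₂ _ h
          simp only [Sigma.mk.injEq, heq_eq_eq] at h
          rw [← sdiff_union_inter Q₁ (N r), ← sdiff_union_inter Q₂ (N r), h.1, h.2]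
      _ ≤ ∑ p ∈ ((N r).powerset.filter (fun T => Disjoint T R)).sigma S',
            x ^ p.1.card * x ^ p.2.card :=
          sum_le_sum_of_subset_of_nonneg (image_subset_iff.2 hmap) fun _ _ _ => by positivity
      _ = ∑ T ∈ (N r).powerset.filter (fun T => Disjoint T R),
            x ^ T.card * ∑ Q ∈ S' T, x ^ Q.card := by
          rw [sum_sigma]; simp_rw [mul_sum]
      _ ≤ ∑ T ∈ (N r).powerset.filter (fun T => Disjoint T R),
            x ^ T.card * 2 ^ (R.card - 1 + T.card) := by
          refine sum_le_sum fun T hT => mul_le_mul_of_nonneg_left ((ih (R' T)).trans ?_)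
            (by positivity)
          refine pow_le_pow_right₀ (by norm_num) ?_
          rw [← card_erase_of_mem hr]
          exact card_union_le _ _
      _ ≤ ∑ T ∈ (N r).powerset, x ^ T.card * 2 ^ (R.card - 1 + T.card) :=
          sum_le_sum_of_subset_of_nonneg (filter_subset _ _) fun _ _ _ => by positivity
      _ = 2 ^ (R.card - 1) * (2 * x + 1) ^ (N r).card := by
          rw [← sum_powerset_pow_card, mul_sum]
          refine sum_congr rfl fun T _ => ?_
          rw [pow_add, mul_pow]; ring
      _ ≤ 2 ^ (R.card - 1) * 2 := by
          refine mul_le_mul_of_nonneg_left (le_trans ?_ hx) (by positivity)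
          rw [add_comm]
          exact pow_le_pow_right₀ (by linarith) (hN r)
      _ = 2 ^ R.card := by
          rw [← pow_succ, Nat.sub_add_cancel hRpos]

open Classical in
/-- The number of sets of size at most `n` explored from a given set of roots. -/
theorem card_linkedFrom_le (N : α → Finset α) {Δ : ℕ} (hN : ∀ v, (N v).card ≤ Δ) (hΔ : 0 < Δ)
    (R : Finset α) (n : ℕ) :
    ((univ.filter (fun Q : Finset α => Q.card ≤ n ∧ Disjoint Q R ∧ LinkedFrom N R Q)).card : ℝ) ≤
      2 ^ R.card * (4 * (Δ : ℝ)) ^ n := by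
  have hΔ' : (1 : ℝ) ≤ Δ := by exact_mod_cast hΔ
  set x : ℝ := (4 * (Δ : ℝ))⁻¹ with hxdef
  have hx0 : 0 < x := by positivity
  have hx1 : x ≤ 1 := inv_le_one_of_one_le₀ (by linarith)
  have hx : (1 + 2 * x) ^ Δ ≤ 2 := by
    calc (1 + 2 * x) ^ Δ ≤ Real.exp (2 * x) ^ Δ := by
          refine pow_le_pow_left₀ (by positivity) ?_ _
          linarith [Real.add_one_le_exp (2 * x)]
      _ = Real.exp (1 / 2) := by
          rw [← Real.exp_nat_mul]; congr 1; rw [hxdef]; field_simp; norm_num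
      _ ≤ 2 := by
          have h := Real.exp_one_lt_d9
          have h2 : Real.exp (1 / 2) ^ 2 = Real.exp 1 := by
            rw [← Real.exp_nat_mul]; norm_num
          nlinarith [Real.exp_pos (1 / 2)]
  have h1 := sum_pow_card_linkedFrom_aux N hN hx0.le hx (n + R.card) R
  have h2 : ((univ.filter (fun Q : Finset α => Q.card ≤ n ∧ Disjoint Q R ∧ LinkedFrom N R Q)).card : ℝ) *
      x ^ n ≤ 2 ^ R.card := by
    refine le_trans ?_ h1
    rw [← nsmul_eq_mul]
    have hEq : (univ.filter (fun Q : Finset α => Q.card ≤ n ∧ Disjoint Q R ∧ LinkedFrom N R Q)) =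
        univ.filter (fun Q : Finset α => Q.card + R.card ≤ n + R.card ∧ Disjoint Q R ∧ LinkedFrom N R Q) := by
      refine filter_congr fun Q _ => ?_
      simp
    rw [← hEq]
    refine card_nsmul_le_sum _ (fun Q : Finset α => x ^ Q.card) _ fun Q hQ => ?_
    exact pow_le_pow_of_le_one hx0.le hx1 (mem_filter.1 hQ).2.1
  have h3 : (4 * (Δ : ℝ)) ^ n = (x ^ n)⁻¹ := by rw [hxdef, inv_pow, inv_inv]
  rw [h3, ← div_eq_mul_inv, le_div_iff₀ (by positivity)]
  exact h2

end Counting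

section ShiftDiff

variable {V : Type*} [AddCommGroup V] [DecidableEq V] [Fintype V]

/-- The number of vertices whose membership in `W` changes under translation by `a`. -/
def shiftDiff (W : Finset V) (a : V) : ℕ := (univ.filter fun x => ¬ (x ∈ W ↔ x + a ∈ W)).card

lemma shiftDiff_zero (W : Finset V) : shiftDiff W 0 = 0 := by simp [shiftDiff]

lemma card_filter_comp_add (P : V → Prop) [DecidablePred P] (a : V) :
    (univ.filter fun x => P (x + a)).card = (univ.filter P).card := by
  refine card_bij (fun x _ => x + a) (by simp) (fun x _ y _ h => by simpa using h) ?_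
  intro y hy
  exact ⟨y - a, by simpa using hy, by simp⟩

lemma shiftDiff_neg (W : Finset V) (a : V) : shiftDiff W (-a) = shiftDiff W a := by
  unfold shiftDiff
  rw [← card_filter_comp_add _ a]
  congr 1
  ext x
  simp only [mem_filter, mem_univ, true_and, add_neg_cancel_right]
  tauto

lemma shiftDiff_add_le (W : Finset V) (a b : V) :
    shiftDiff W (a + b) ≤ shiftDiff W a + shiftDiff W b := by
  have h : shiftDiff W b = (univ.filter fun x => ¬ (x + a ∈ W ↔ x + a + b ∈ W)).card :=
    (card_filter_comp_add (fun x => ¬ (x ∈ W ↔ x + b ∈ W)) a).symm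
  rw [h]
  unfold shiftDiff
  refine le_trans (card_le_card fun x hx => ?_) (card_union_le _ _)
  simp only [mem_filter, mem_univ, true_and, mem_union, ← add_assoc] at hx ⊢
  tauto

lemma shiftDiff_nsmul_le (W : Finset V) (a : V) (n : ℕ) :
    shiftDiff W (n • a) ≤ n * shiftDiff W a := by
  induction n with
  | zero => simp [shiftDiff_zero]
  | succ n ih =>
    rw [succ_nsmul, add_mul, one_mul]
    exact (shiftDiff_add_le W _ _).trans (by omega)

lemma shiftDiff_sum_le {ι : Type*} (W : Finset V) (s : Finset ι) (a : ι → V) :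
    shiftDiff W (∑ i ∈ s, a i) ≤ ∑ i ∈ s, shiftDiff W (a i) := by
  classical
  induction s using Finset.induction_on with
  | empty => simp [shiftDiff_zero]
  | insert i s hi ih =>
    rw [sum_insert hi, sum_insert hi]
    exact (shiftDiff_add_le W _ _).trans (by omega)

lemma two_mul_card_mul_card_compl_le (W : Finset V) :
    2 * (W.card * Wᶜ.card) ≤ ∑ a : V, shiftDiff W a := by
  have h : ∑ a : V, shiftDiff W a =
      ((univ : Finset (V × V)).filter fun p => ¬ (p.1 ∈ W ↔ p.2 ∈ W)).card := by
    unfold shiftDiff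
    rw [← card_sigma]
    refine card_bij (fun p _ => (p.2, p.2 + p.1)) ?_ ?_ ?_
    · rintro ⟨a, x⟩ h
      simpa using h
    · rintro ⟨a, x⟩ _ ⟨b, y⟩ _ h
      simp only [Prod.mk.injEq] at h
      obtain ⟨rfl, h⟩ := h
      simp at h
      simp [h]
    · rintro ⟨x, y⟩ h
      exact ⟨⟨y - x, x⟩, by simpa using h, by simp⟩
  rw [h]
  have h2 : W ×ˢ Wᶜ ∪ Wᶜ ×ˢ W ⊆
      (univ : Finset (V × V)).filter fun p => ¬ (p.1 ∈ W ↔ p.2 ∈ W) := by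
    rintro ⟨x, y⟩ h
    simp only [mem_union, mem_product, mem_compl, mem_filter, mem_univ, true_and] at h ⊢
    tauto
  refine le_trans (le_of_eq ?_) (card_le_card h2)
  rw [card_union_of_disjoint, card_product, card_product]
  · ring
  · rw [disjoint_left]
    rintro ⟨x, y⟩ h h'
    simp only [mem_product, mem_compl] at h h'
    exact h'.1 h.1

variable {Γ E A G : Finset V}

lemma ClosedPair.mem_of_disagree (hB : BipCayley Γ E) (hc : ClosedPair Γ E A G) {x f : V}
    (hf : f ∈ Γ) (h : ¬ (x ∈ A ∪ G ↔ x + f ∈ A ∪ G)) :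
    (x ∈ G ∧ x + f ∉ A) ∨ (x + f ∈ G ∧ x ∉ A) := by
  have h1 : x ∈ A → x + f ∈ G := fun hx => hc.nb x hx f hf
  have h2 : x + f ∈ A → x ∈ G := fun hx => by
    have := hB.sub_mem hf hx hc
    rwa [add_sub_cancel_right] at this
  simp only [mem_union] at h
  tauto

lemma ClosedPair.disagree_iff (hB : BipCayley Γ E) (hc : ClosedPair Γ E A G) {x f : V}
    (hf : f ∈ Γ) : (¬ (x ∈ A ∪ G ↔ x + f ∈ A ∪ G)) ↔
      ((x ∈ G ∧ x + f ∉ A) ∨ (x + f ∈ G ∧ x ∉ A)) := by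
  refine ⟨hc.mem_of_disagree hB hf, fun h => ?_⟩
  rcases h with h | h
  · have h1 : x + f ∉ G := fun hG => hc.odd _ hG ((hB.parity x f hf).2 (hc.odd x h.1))
    simp [h.1, h.2, h1]
  · have h1 : x ∉ G := fun hG => hc.odd _ h.1 ((hB.parity x f hf).2 (hc.odd x hG))
    simp [h.1, h.2, h1]

/-- Membership in the region changes only near its inner boundary. -/
lemma ClosedPair.exists_innerBdry_of_disagree (hB : BipCayley Γ E) (hc : ClosedPair Γ E A G)
    {n : ℕ} {x a : V} (ha : a ∈ cayleyBall Γ n) (h : ¬ (x ∈ A ∪ G ↔ x + a ∈ A ∪ G)) :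
    ∃ b ∈ cayleyBall Γ n, x + b ∈ innerBdry Γ A G := by
  induction n generalizing a with
  | zero =>
    have : a = 0 := mem_cayleyBall_zero.1 ha
    simp [this] at h
  | succ n ih =>
    have ha' := ha
    obtain ⟨a', ha1, f, hf, rfl⟩ := mem_cayleyBall_succ.1 ha
    by_cases h1 : (x ∈ A ∪ G ↔ x + a' ∈ A ∪ G)
    · rcases mem_insert.1 hf with rfl | hf
      · rw [add_zero] at h; exact absurd h1 h
      rw [h1, ← add_assoc] at h
      rcases hc.mem_of_disagree hB hf h with h2 | h2
      · exact ⟨a', cayleyBall_mono (Nat.le_succ n) ha1, mem_innerBdry.2 ⟨h2.1, f, hf, h2.2⟩⟩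
      · refine ⟨a' + f, ha', mem_innerBdry.2 ⟨by rw [← add_assoc]; exact h2.1, -f,
          hB.neg_mem f hf, ?_⟩⟩
        rw [← add_assoc, add_neg_cancel_right]; exact h2.2
    · obtain ⟨b, hb, hb'⟩ := ih ha1 h1
      exact ⟨b, cayleyBall_mono (Nat.le_succ n) hb, hb'⟩

lemma ClosedPair.sum_shiftDiff (hB : BipCayley Γ E) (hc : ClosedPair Γ E A G) {t : ℕ}
    (ht : G.card = A.card + t) : ∑ f ∈ Γ, shiftDiff (A ∪ G) f = 2 * (Γ.card * t) := by
  have h1 : ∀ f ∈ Γ, shiftDiff (A ∪ G) f = (G.filter fun u => u + f ∉ A).card +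
      (G.filter fun u => u + -f ∉ A).card := by
    intro f hf
    have e : (G.filter fun u => u + -f ∉ A).card =
        (univ.filter fun x => x + f ∈ G ∧ x ∉ A).card := by
      rw [← card_filter_comp_add (fun x => x + f ∈ G ∧ x ∉ A) (-f)]
      congr 1; ext x; simp
    rw [e, shiftDiff, ← card_union_of_disjoint]
    · congr 1
      ext x
      simp only [mem_filter, mem_univ, true_and, mem_union (s := G.filter _)]
      exact hc.disagree_iff hB hf
    · rw [disjoint_left]
      intro x hx hx'
      simp only [mem_filter, mem_univ, true_and] at hx hx'
      exact hc.odd _ hx'.1 ((hB.parity x f hf).2 (hc.odd x hx.1))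
  rw [sum_congr rfl h1, sum_add_distrib]
  have h2 : ∑ f ∈ Γ, (G.filter fun u => u + f ∉ A).card = Γ.card * t := by
    rw [← hc.sum_outDegree hB ht]
    simp_rw [outDegree, card_filter]
    exact sum_comm
  have h3 : ∑ f ∈ Γ, (G.filter fun u => u + -f ∉ A).card =
      ∑ f ∈ Γ, (G.filter fun u => u + f ∉ A).card :=
    sum_nbij' (fun f => -f) (fun f => -f) hB.neg_mem hB.neg_mem (by simp) (by simp) (by simp)
  rw [h3, h2]; ring

end ShiftDiff

section TorusGroup

variable {L d : ℕ} [NeZero L]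

/-- The unit vector in direction `k`. -/
def torusDir (k : Fin d) : TV L d := Pi.single k 1

/-- The generators of the torus, one pair for each direction. -/
def torusGen (L d : ℕ) [NeZero L] : Finset (TV L d) :=
  univ.image torusDir ∪ univ.image fun k => -torusDir k

/-- The set of even vertices. -/
def evenVerts (L d : ℕ) : Finset (TV L d) := univ.filter IsEvenVtx

lemma mem_torusGen {f : TV L d} : f ∈ torusGen L d ↔ ∃ k, f = torusDir k ∨ f = -torusDir k := by
  simp only [torusGen, mem_union, mem_image, mem_univ, true_and]
  constructor
  · rintro (⟨k, rfl⟩ | ⟨k, rfl⟩)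
    · exact ⟨k, Or.inl rfl⟩
    · exact ⟨k, Or.inr rfl⟩
  · rintro ⟨k, rfl | rfl⟩
    · exact Or.inl ⟨k, rfl⟩
    · exact Or.inr ⟨k, rfl⟩

lemma torusDir_mem (k : Fin d) : torusDir k ∈ torusGen L d := mem_torusGen.2 ⟨k, Or.inl rfl⟩

lemma neg_torusDir_mem (k : Fin d) : -torusDir k ∈ torusGen L d :=
  mem_torusGen.2 ⟨k, Or.inr rfl⟩

lemma add_torusDir_same (x : TV L d) (k : Fin d) : (x + torusDir k : TV L d) k = x k + 1 := by
  simp [torusDir]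

lemma add_torusDir_of_ne (x : TV L d) {k j : Fin d} (h : j ≠ k) :
    (x + torusDir k : TV L d) j = x j := by
  simp [torusDir, h]

lemma add_torusDir (x : TV L d) (k : Fin d) :
    x + torusDir k = Function.update x k (x k + 1) := by
  funext j
  by_cases h : j = k
  · subst h; rw [add_torusDir_same, Function.update_self]
  · simp [h, add_torusDir_of_ne x h]

lemma val_add_one_fin (a : Fin L) : ((a + 1 : Fin L) : ℕ) = (a + 1) % L := by
  rw [Fin.val_add, Fin.val_one']
  simp

lemma isEvenVtx_add_torusDir (hL : Even L) (x : TV L d) (k : Fin d) :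
    IsEvenVtx (x + torusDir k) ↔ ¬ IsEvenVtx x := by
  unfold IsEvenVtx
  rw [← add_sum_erase _ _ (mem_univ k), ← add_sum_erase univ (fun i => (x i : ℕ)) (mem_univ k),
    add_torusDir_same, val_add_one_fin,
    sum_congr rfl fun j hj => congrArg Fin.val (add_torusDir_of_ne x (ne_of_mem_erase hj))]
  obtain ⟨r, hr⟩ := hL
  have h1 := Nat.mod_add_div ((x k : ℕ) + 1) L
  set q := ((x k : ℕ) + 1) / L
  have h2 : L * q = 2 * (r * q) := by rw [hr]; ring
  omega

lemma torus_bipCayley (hL : Even L) : BipCayley (torusGen L d) (evenVerts L d) := by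
  refine ⟨fun f hf => ?_, fun x f hf => ?_⟩
  · obtain ⟨k, rfl | rfl⟩ := mem_torusGen.1 hf
    · exact neg_torusDir_mem k
    · rw [neg_neg]; exact torusDir_mem k
  · obtain ⟨k, rfl | rfl⟩ := mem_torusGen.1 hf
    · simpa [evenVerts] using isEvenVtx_add_torusDir hL x k
    · have := isEvenVtx_add_torusDir hL (x + -torusDir k) k
      rw [neg_add_cancel_right] at this
      simp only [evenVerts, mem_filter, mem_univ, true_and]
      tauto

lemma torusAdj_iff (hL : 2 ≤ L) (x y : TV L d) :
    TorusAdj x y ↔ ∃ f ∈ torusGen L d, y = x + f := by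
  have hval : ∀ a b : Fin L, (b : ℕ) = ((a : ℕ) + 1) % L ↔ b = a + 1 := fun a b => by
    rw [← val_add_one_fin, Fin.ext_iff]
  have hne : ∀ a : Fin L, a ≠ a + 1 := by
    intro a h
    rw [Fin.ext_iff, val_add_one_fin] at h
    have := a.2
    rcases Nat.lt_or_ge ((a : ℕ) + 1) L with h1 | h1
    · rw [Nat.mod_eq_of_lt h1] at h; omega
    · have : (a : ℕ) + 1 = L := by omega
      rw [this, Nat.mod_self] at h; omega
  unfold TorusAdj
  simp_rw [hval]
  constructor
  · rintro ⟨i, -, h | h, hj⟩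
    · refine ⟨_, torusDir_mem i, ?_⟩
      rw [add_torusDir]
      ext j
      by_cases hji : j = i
      · subst hji; simp [h]
      · simp [hji, hj j hji]
    · refine ⟨_, neg_torusDir_mem i, ?_⟩
      rw [eq_add_neg_iff_add_eq, add_torusDir]
      ext j
      by_cases hji : j = i
      · subst hji; simp [h]
      · simp [hji, hj j hji]
  · rintro ⟨f, hf, rfl⟩
    obtain ⟨k, rfl | rfl⟩ := mem_torusGen.1 hf
    · refine ⟨k, ?_, Or.inl (add_torusDir_same x k), fun j hj => (add_torusDir_of_ne x hj).symm⟩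
      rw [add_torusDir_same]; exact hne _
    · have h1 := add_torusDir_same (x + -torusDir k) k
      rw [neg_add_cancel_right] at h1
      refine ⟨k, ?_, Or.inr h1, fun j hj => ?_⟩
      · rw [h1]; exact (hne _).symm
      · have h2 := add_torusDir_of_ne (x + -torusDir k) hj
        rwa [neg_add_cancel_right] at h2

lemma torusDir_injective (hL : 2 ≤ L) : Function.Injective (torusDir (L := L) (d := d)) := by
  intro a b h
  by_contra hne
  have := congrFun h a
  simp only [torusDir, Pi.single_eq_same, Pi.single_eq_of_ne hne] at this
  rw [Fin.ext_iff, Fin.val_one', Nat.mod_eq_of_lt (by omega)] at this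
  simp at this

lemma neg_torusDir_injective (hL : 2 ≤ L) :
    Function.Injective fun k : Fin d => -(torusDir k : TV L d) :=
  fun _ _ h => torusDir_injective hL (neg_injective h)

lemma card_torusGen (hL : 3 ≤ L) : (torusGen L d).card = 2 * d := by
  rw [torusGen, card_union_of_disjoint, card_image_of_injective _ (torusDir_injective (L := L) (d := d) (by omega)),
    card_image_of_injective _ (neg_torusDir_injective (by omega))]
  · simp; ring
  · rw [disjoint_left]
    intro f hf hf'
    simp only [mem_image, mem_univ, true_and] at hf hf'
    obtain ⟨a, rfl⟩ := hf
    obtain ⟨b, hb⟩ := hf'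
    have h := congrFun hb a
    have h2 : (1 : Fin L) + 1 ≠ 0 := by
      intro h
      rw [Fin.ext_iff, Fin.val_add, Fin.val_one', Nat.mod_eq_of_lt (by omega : 1 < L),
        Nat.mod_eq_of_lt (by omega)] at h
      simp at h
    by_cases hab : a = b
    · subst hab
      simp only [torusDir, Pi.neg_apply, Pi.single_eq_same] at h
      apply h2
      nth_rewrite 1 [← h]
      exact neg_add_cancel _
    · simp only [torusDir, Pi.neg_apply, Pi.single_eq_same, Pi.single_eq_of_ne hab, neg_zero] at h
      apply h2
      rw [← h]; simp

lemma nsmul_one_fin (n : ℕ) : ((n • (1 : Fin L) : Fin L) : ℕ) = n % L := by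
  induction n with
  | zero => simp
  | succ n ih => rw [succ_nsmul, val_add_one_fin, ih, Nat.mod_add_mod]

lemma nsmul_torusDir (k : Fin d) (s : Fin L) : (s : ℕ) • torusDir k = (Pi.single k s : TV L d) := by
  funext j
  by_cases h : j = k
  · subst h
    simp only [torusDir, Pi.smul_apply, Pi.single_eq_same]
    ext
    rw [nsmul_one_fin, Nat.mod_eq_of_lt s.2]
  · simp [torusDir, h]

lemma update_eq_add_nsmul (v : TV L d) (k : Fin d) (s : Fin L) :
    Function.update v k s = v + ((s - v k : Fin L) : ℕ) • torusDir k := by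
  rw [nsmul_torusDir]
  ext j
  by_cases h : j = k
  · subst h; simp
  · simp [h]

lemma eq_sum_nsmul (v : TV L d) : v = ∑ k, (v k : ℕ) • torusDir k := by
  simp_rw [nsmul_torusDir]
  exact (Finset.univ_sum_single v).symm

lemma eq_add_nsmul_of_step {β : Type*} {f : TV L d → β} {k : Fin d} {P : TV L d → Prop}
    (hP : ∀ v, P v → P (v + torusDir k)) (h : ∀ v, P v → f (v + torusDir k) = f v) (v : TV L d)
    (hv : P v) (n : ℕ) : f (v + n • torusDir k) = f v ∧ P (v + n • torusDir k) := by
  induction n with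
  | zero => simpa using hv
  | succ n ih =>
    rw [succ_nsmul, ← add_assoc]
    exact ⟨(h _ ih.2).trans ih.1, hP _ ih.2⟩

/-- A function invariant under all unit steps is constant. -/
lemma torus_const {β : Type*} {f : TV L d → β} (h : ∀ v k, f (v + torusDir k) = f v)
    (v w : TV L d) : f v = f w := by
  have key : ∀ s : Finset (Fin d), ∀ u : TV L d, f (u + ∑ k ∈ s, (w k - v k : Fin L).val •
      torusDir k) = f u := by
    intro s
    induction s using Finset.induction_on with
    | empty => simp
    | insert i s hi ih =>
      intro u
      rw [sum_insert hi, ← add_assoc, ih]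
      exact (eq_add_nsmul_of_step (P := fun _ => True) (fun _ _ => trivial)
        (fun v _ => h v i) u trivial _).1
  have h1 := key univ v
  have h2 := eq_sum_nsmul (w - v)
  simp only [Pi.sub_apply] at h2
  rw [← h2, add_sub_cancel] at h1
  exact h1.symm

lemma sum_torusGen (hL : 3 ≤ L) (g : TV L d → ℕ) :
    ∑ f ∈ torusGen L d, g f = ∑ k, (g (torusDir k) + g (-torusDir k)) := by
  have hc := card_torusGen (L := L) (d := d) hL
  have hd : Disjoint (univ.image (torusDir (L := L) (d := d)))
      (univ.image fun k => -torusDir k) := by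
    rw [← card_union_eq_card_add_card]
    rw [torusGen] at hc
    rw [hc, card_image_of_injective _ (torusDir_injective (L := L) (d := d) (by omega)),
      card_image_of_injective _ (neg_torusDir_injective (by omega))]
    simp; ring
  rw [torusGen, sum_union hd, sum_image fun a _ b _ h => torusDir_injective (L := L) (by omega) h,
    sum_image fun a _ b _ h => neg_torusDir_injective (by omega) h, sum_add_distrib]

/-- The total of the directional boundaries of a region. -/
lemma ClosedPair.sum_shiftDiff_torusDir (hE : Even L) (hL : 3 ≤ L) {A G : Finset (TV L d)}
    (hc : ClosedPair (torusGen L d) (evenVerts L d) A G) {t : ℕ} (ht : G.card = A.card + t) :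
    ∑ k, shiftDiff (A ∪ G) (torusDir k) = 2 * d * t := by
  have h := hc.sum_shiftDiff (torus_bipCayley hE) ht
  rw [sum_torusGen hL, card_torusGen hL] at h
  simp_rw [shiftDiff_neg] at h
  rw [sum_add_distrib] at h
  linarith

/-- A Poincaré-type inequality: boundary versus volume. -/
lemma card_mul_card_compl_le (W : Finset (TV L d)) :
    2 * (W.card * Wᶜ.card) ≤ L ^ d * (L * ∑ k, shiftDiff W (torusDir k)) := by
  refine (two_mul_card_mul_card_compl_le W).trans ?_
  have : ∀ a : TV L d, shiftDiff W a ≤ L * ∑ k, shiftDiff W (torusDir k) := by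
    intro a
    rw [mul_sum]
    nth_rewrite 1 [eq_sum_nsmul a]
    refine (shiftDiff_sum_le W _ _).trans (sum_le_sum fun k _ => ?_)
    exact (shiftDiff_nsmul_le W _ _).trans (Nat.mul_le_mul_right _ (a k).2.le)
  refine (sum_le_card_nsmul univ _ _ fun a _ => this a).trans (le_of_eq ?_)
  simp

end TorusGroup

section Cochain

variable {L d : ℕ} [NeZero L]

lemma card_nsmul_torusDir (k : Fin d) : (L : ℕ) • (torusDir k : TV L d) = 0 := by
  funext j
  by_cases h : j = k
  · subst h
    simp only [torusDir, Pi.smul_apply, Pi.single_eq_same]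
    ext
    rw [nsmul_one_fin]
    simp
  · simp [torusDir, h]

lemma add_nsmul_torusDir_of_ne (x : TV L d) {k j : Fin d} (h : j ≠ k) (n : ℕ) :
    (x + n • torusDir k : TV L d) j = x j := by
  simp [torusDir, h]

lemma update_zero_add_nsmul (v : TV L d) (k : Fin d) :
    Function.update v k 0 + (v k : ℕ) • torusDir k = v := by
  rw [nsmul_torusDir]
  funext j
  by_cases h : j = k
  · subst h; simp
  · simp [h]

lemma update_add_torusDir_same (v : TV L d) (k : Fin d) (a : Fin L) :
    Function.update (v + torusDir k) k a = Function.update v k a := by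
  rw [add_torusDir, Function.update_idem]

lemma update_add_torusDir_of_ne (v : TV L d) {k j : Fin d} (h : j ≠ k) (a : Fin L) :
    Function.update (v + torusDir j) k a = Function.update v k a + torusDir j := by
  rw [add_torusDir, add_torusDir, Function.update_of_ne h, Function.update_comm h]

variable {M : Type*} [AddCommGroup M] {c : TV L d → Fin d → M}

/-- Closed cochains on the torus without holonomy are exact. -/
lemma exists_potential
    (hsq : ∀ v k l, c v k + c (v + torusDir k) l = c v l + c (v + torusDir l) k)
    (hhol : ∀ v k, ∑ s ∈ range L, c (v + s • torusDir k) k = 0) :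
    ∃ f : TV L d → M, ∀ v k, f (v + torusDir k) - f v = c v k := by
  suffices h : ∀ S : Finset (Fin d), ∃ f : TV L d → M, ∀ k ∈ S, ∀ v,
      f (v + torusDir k) - f v = c v k by
    obtain ⟨f, hf⟩ := h univ
    exact ⟨f, fun v k => hf k (mem_univ k) v⟩
  intro S
  induction S using Finset.induction_on with
  | empty => exact ⟨0, by simp⟩
  | insert n S hn ih =>
    obtain ⟨f, hf⟩ := ih
    set c' : TV L d → Fin d → M := fun v k => c v k - (f (v + torusDir k) - f v) with hc'
    have hz : ∀ k ∈ S, ∀ v, c' v k = 0 := fun k hk v => by simp [hc', hf k hk v]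
    have hinv : ∀ k ∈ S, ∀ v, c' (v + torusDir k) n = c' v n := by
      intro k hk v
      have h1 := hsq v k n
      have h2 := hf k hk v
      have h3 := hf k hk (v + torusDir n)
      simp only [hc']
      rw [add_right_comm v (torusDir n) (torusDir k)] at h3
      rw [← h2, ← h3] at h1
      have h4 : c (v + torusDir k) n = c v n + (f (v + torusDir k + torusDir n) -
          f (v + torusDir n)) - (f (v + torusDir k) - f v) := by
        rw [← h1]; abel
      rw [h4]; abel
    have hhol' : ∀ v, ∑ s ∈ range L, c' (v + s • torusDir n) n = 0 := by
      intro v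
      simp only [hc', sum_sub_distrib, hhol v n, zero_sub]
      rw [← sum_sub_distrib, neg_eq_zero]
      have := sum_range_sub (fun s => f (v + s • torusDir n)) L
      simp only [card_nsmul_torusDir, zero_nsmul, sub_self] at this
      rw [← this]
      refine sum_congr rfl fun s _ => ?_
      rw [succ_nsmul, ← add_assoc]
    refine ⟨fun v => f v + ∑ s ∈ range (v n), c' (Function.update v n 0 + s • torusDir n) n, ?_⟩
    intro k hk v
    rcases eq_or_ne k n with rfl | hkn
    · have h1 := update_zero_add_nsmul v k
      beta_reduce
      rw [update_add_torusDir_same, add_torusDir_same, val_add_one_fin]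
      have key : ∑ s ∈ range (((v k : ℕ) + 1) % L), c' (Function.update v k 0 + s • torusDir k) k
          = ∑ s ∈ range ((v k : ℕ) + 1), c' (Function.update v k 0 + s • torusDir k) k := by
        rcases Nat.lt_or_ge ((v k : ℕ) + 1) L with h | h
        · rw [Nat.mod_eq_of_lt h]
        · have : (v k : ℕ) + 1 = L := by have := (v k).2; omega
          rw [this, Nat.mod_self, hhol']; simp
      rw [key, sum_range_succ, h1]
      simp only [hc']
      abel
    · have hkS : k ∈ S := (mem_insert.1 hk).resolve_left hkn
      beta_reduce
      rw [update_add_torusDir_of_ne v hkn, add_torusDir_of_ne v hkn.symm]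
      have : ∀ s : ℕ, c' (Function.update v n 0 + torusDir k + s • torusDir n) n =
          c' (Function.update v n 0 + s • torusDir n) n := fun s => by
        rw [add_right_comm, hinv k hkS]
      simp_rw [this]
      rw [← hf k hkS v]
      abel

lemma holonomy_const
    (hsq : ∀ v k l, c v k + c (v + torusDir k) l = c v l + c (v + torusDir l) k) (k : Fin d)
    (v w : TV L d) : ∑ s ∈ range L, c (v + s • torusDir k) k =
      ∑ s ∈ range L, c (w + s • torusDir k) k := by
  refine torus_const (f := fun v => ∑ s ∈ range L, c (v + s • torusDir k) k) ?_ v w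
  intro v l
  rw [← sub_eq_zero, ← sum_sub_distrib]
  have := sum_range_sub (fun s => c (v + s • torusDir k) l) L
  simp only [card_nsmul_torusDir, zero_nsmul, sub_self] at this
  rw [← this]
  refine sum_congr rfl fun s _ => ?_
  have h := hsq (v + s • torusDir k) k l
  rw [succ_nsmul, ← add_assoc, add_right_comm v (torusDir l)]
  rw [sub_eq_sub_iff_add_eq_add, add_comm, ← h, add_comm]

lemma slice_const {β : Type*} {f : TV L d → β} {i : Fin d} {a : Fin L}
    (h : ∀ v : TV L d, v i = a → ∀ k ≠ i, f (v + torusDir k) = f v) {v w : TV L d} (hv : v i = a)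
    (hw : w i = a) : f v = f w := by
  have := torus_const (f := fun v => f (Function.update v i a)) ?_ v w
  · have e : ∀ u : TV L d, u i = a → Function.update u i a = u := fun u hu => by
      rw [← hu, Function.update_eq_self]
    simpa only [e v hv, e w hw] using this
  · intro v k
    by_cases hk : k = i
    · subst hk
      simp only [update_add_torusDir_same]
    · simp only [update_add_torusDir_of_ne v hk]
      exact h _ (by simp) k hk

lemma line_const {β : Type*} {f : TV L d → β} {i : Fin d} {x : TV L d}
    (h : ∀ v : TV L d, (∀ j ≠ i, v j = x j) → f (v + torusDir i) = f v) (a : Fin L) :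
    f (Function.update x i a) = f x := by
  rw [update_eq_add_nsmul]
  exact (eq_add_nsmul_of_step (P := fun v : TV L d => ∀ j ≠ i, v j = x j)
    (fun v hv j hj => by rw [add_torusDir_of_ne v hj, hv j hj]) h x (fun _ _ => rfl) _).1

/-- A closed mod-2 cochain supported on few vertices bounds a small set. -/
lemma exists_bounded_set (hd : 2 ≤ d) {c : TV L d → Fin d → ZMod 2} {κ : Finset (TV L d)}
    (hκ : κ.card < L)
    (hsq : ∀ v k l, c v k + c (v + torusDir k) l = c v l + c (v + torusDir l) k)
    (hsupp : ∀ v k, c v k ≠ 0 → v ∈ κ ∨ v + torusDir k ∈ κ) :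
    ∃ X : Finset (TV L d), X.card ≤ κ.card ^ 2 ∧
      ∀ v k, (v ∈ X ↔ v + torusDir k ∈ X) ↔ c v k = 0 := by
  have hslice : ∀ j : Fin d, ∃ a : Fin L, ∀ x ∈ κ, x j ≠ a := by
    intro j
    by_contra! hcon
    have : (univ : Finset (Fin L)) ⊆ κ.image fun x => x j := by
      intro a _
      obtain ⟨x, hx, hxa⟩ := hcon a
      exact mem_image.2 ⟨x, hx, hxa⟩
    have := (card_le_card this).trans card_image_le
    simp at this
    omega
  have hz : ∀ v k, v ∉ κ → v + torusDir k ∉ κ → c v k = 0 := fun v k h1 h2 => by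
    by_contra h
    exact (hsupp v k h).elim h1 h2
  have hhol : ∀ v k, ∑ s ∈ range L, c (v + s • torusDir k) k = 0 := by
    intro v k
    obtain ⟨j, hjk⟩ : ∃ j : Fin d, j ≠ k := by
      have : Nontrivial (Fin d) := Fin.nontrivial_iff_two_le.2 hd
      exact exists_ne k
    obtain ⟨a, ha⟩ := hslice j
    rw [holonomy_const hsq k v (Function.update v j a)]
    refine sum_eq_zero fun s _ => hz _ _ (fun h => ha _ h ?_) (fun h => ha _ h ?_)
    · rw [add_nsmul_torusDir_of_ne _ hjk]; simp
    · rw [add_torusDir_of_ne _ hjk, add_nsmul_torusDir_of_ne _ hjk]; simp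
  obtain ⟨f, hf⟩ := exists_potential hsq hhol
  have hstep : ∀ v k, v ∉ κ → v + torusDir k ∉ κ → f (v + torusDir k) = f v := fun v k h1 h2 => by
    rw [← sub_eq_zero, hf, hz v k h1 h2]
  let i0 : Fin d := ⟨0, by omega⟩
  let i1 : Fin d := ⟨1, by omega⟩
  have h01 : i1 ≠ i0 := by simp [i0, i1]
  obtain ⟨a, ha⟩ := hslice i0
  have hsl : ∀ b : Fin L, (∀ x ∈ κ, x i0 ≠ b) → ∀ {v w : TV L d}, v i0 = b → w i0 = b →
      f v = f w := fun b hb => slice_const fun v hv k hk => hstep v k (fun h => hb _ h hv)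
        fun h => hb _ h (by rw [add_torusDir_of_ne v hk.symm, hv])
  set z : TV L d := Function.update 0 i0 a with hzdef
  have hza : z i0 = a := by simp [hzdef]
  have hline : ∀ x, f x ≠ f z → ∃ p ∈ κ, ∀ j ≠ i0, p j = x j := by
    intro x hx
    by_contra! hcon
    apply hx
    rw [← line_const (f := f) (i := i0) (x := x) ?_ a]
    · exact hsl a ha (by simp) hza
    · intro v hv
      refine hstep v i0 (fun h => ?_) (fun h => ?_)
      · obtain ⟨j, hj, hne⟩ := hcon _ h
        exact hne (hv j hj)
      · obtain ⟨j, hj, hne⟩ := hcon _ h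
        exact hne (by rw [add_torusDir_of_ne v hj, hv j hj])
  have hcross : ∀ x, f x ≠ f z → ∃ p ∈ κ, p i0 = x i0 := by
    intro x hx
    by_contra! hcon
    obtain ⟨b, hb⟩ := hslice i1
    have h1 : f (Function.update x i1 b) = f x :=
      hsl (x i0) hcon (by rw [Function.update_of_ne h01.symm]) rfl
    obtain ⟨p, hp, hpx⟩ := hline (Function.update x i1 b) (h1 ▸ hx)
    exact hb p hp (by rw [hpx i1 h01]; simp)
  refine ⟨univ.filter fun x => f x ≠ f z, ?_, ?_⟩
  · have hsub : (univ.filter fun x => f x ≠ f z) ⊆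
        (κ ×ˢ κ).image fun p => Function.update p.2 i0 (p.1 i0) := by
      intro x hx
      have hx := (mem_filter.1 hx).2
      obtain ⟨p, hp, hp'⟩ := hcross x hx
      obtain ⟨q, hq, hq'⟩ := hline x hx
      refine mem_image.2 ⟨(p, q), mem_product.2 ⟨hp, hq⟩, ?_⟩
      funext j
      by_cases hj : j = i0
      · subst hj; simp [hp']
      · simp [hj, hq' j hj]
    refine ((card_le_card hsub).trans card_image_le).trans (le_of_eq ?_)
    rw [card_product, sq]
  · intro v k
    simp only [mem_filter, mem_univ, true_and]
    rw [← hf v k]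
    generalize f (v + torusDir k) = p
    generalize f v = q
    generalize f z = r
    revert p q r
    decide

end Cochain

section CutEdges

variable {V : Type*} [AddCommGroup V] [DecidableEq V] {Γ E A G A' G' : Finset V}

/-- The boundary edges of the region `A ∪ G`, directed outwards. -/
def cutEdges (Γ A G : Finset V) : Finset (V × V) := (G ×ˢ Γ).filter fun p => p.1 + p.2 ∉ A

lemma mem_cutEdges {p : V × V} : p ∈ cutEdges Γ A G ↔ p.1 ∈ G ∧ p.2 ∈ Γ ∧ p.1 + p.2 ∉ A := by
  simp [cutEdges, and_assoc]

lemma card_cutEdges : (cutEdges Γ A G).card = ∑ u ∈ G, outDegree Γ A u := by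
  simp_rw [cutEdges, outDegree, card_filter]
  rw [sum_product]

lemma card_cutEdges_filter {κ : Finset V} (hκ : κ ⊆ G) :
    ((cutEdges Γ A G).filter fun p => p.1 ∈ κ).card = ∑ u ∈ κ, outDegree Γ A u := by
  rw [← card_cutEdges]
  congr 1
  ext p
  simp only [mem_filter, mem_cutEdges]
  constructor
  · rintro ⟨h1, h2⟩
    exact ⟨h2, h1.2⟩
  · rintro ⟨h1, h2⟩
    exact ⟨⟨hκ h1, h2⟩, h1⟩

/-- Every boundary edge of `A' ∪ G'` is a boundary edge of `A ∪ G`, with the same direction. -/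
def BdrySub (Γ A' G' A G : Finset V) : Prop := cutEdges Γ A' G' ⊆ cutEdges Γ A G

lemma BdrySub.zeroFree {χ : V → Fin 3} (h : BdrySub Γ A' G' A G) (hz : ZeroFree Γ A G χ) :
    ZeroFree Γ A' G' χ := by
  have key : ∀ u ∈ G', ∀ f ∈ Γ, u + f ∉ A' → u ∈ G ∧ u + f ∉ A := fun u hu f hf hA => by
    have := mem_cutEdges.1 (h ((mem_cutEdges (p := (u, f))).2 ⟨hu, hf, hA⟩))
    exact ⟨this.1, this.2.2⟩
  refine ⟨fun u hu f hf hA => ?_, fun u hu f hf hA => ?_, fun u hu f hf hA => ?_⟩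
  · exact hz.inner u (key u hu f hf hA).1 f hf (key u hu f hf hA).2
  · exact hz.outer u (key u hu f hf hA).1 f hf (key u hu f hf hA).2
  · obtain ⟨g, hg, hgA, hg0⟩ := hz.touch u (key u hu f hf hA).1 f hf (key u hu f hf hA).2
    refine ⟨g, hg, ?_, hg0⟩
    by_contra hgA'
    exact (key u hu g hg hgA').2 hgA

/-- A region whose boundary is a directed sub-boundary of a closed pair yields a closed pair. -/
lemma ClosedPair.of_bdry (hB : BipCayley Γ E) (hc : ClosedPair Γ E A G) (hΓ : Γ.Nonempty)
    {W : Finset V}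
    (hW : ∀ x ∈ W, ∀ f ∈ Γ, x + f ∉ W → x ∈ A ∪ G ∧ x + f ∉ A ∪ G) :
    ClosedPair Γ E (W.filter (· ∈ E)) (W.filter (· ∉ E)) ∧
      BdrySub Γ (W.filter (· ∈ E)) (W.filter (· ∉ E)) A G := by
  have hsub : BdrySub Γ (W.filter (· ∈ E)) (W.filter (· ∉ E)) A G := by
    intro p hp
    rw [mem_cutEdges, mem_filter, mem_filter] at hp
    obtain ⟨⟨h1, h2⟩, h3, h4⟩ := hp
    have h5 := (hB.parity p.1 p.2 h3).2 h2
    have h6 := hW _ h1 _ h3 (fun h => h4 ⟨h, h5⟩)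
    rw [mem_union, mem_union] at h6
    rw [mem_cutEdges]
    exact ⟨h6.1.resolve_left fun h => h2 (hc.even _ h), h3, fun h => h6.2 (Or.inl h)⟩
  refine ⟨⟨fun x hx => (mem_filter.1 hx).2, fun x hx => (mem_filter.1 hx).2, ?_, ?_⟩, hsub⟩
  · intro x hx f hf
    rw [mem_filter] at hx ⊢
    refine ⟨?_, fun h => (hB.parity x f hf).1 h hx.2⟩
    by_contra hcon
    have h := hW x hx.1 f hf hcon
    rw [mem_union, mem_union] at h
    have hA : x ∈ A := h.1.resolve_right fun h' => hc.odd _ h' hx.2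
    exact h.2 (Or.inr (hc.nb x hA f hf))
  · intro x hx hn
    by_contra hcon
    have key : ∀ f ∈ Γ, x + f ∈ G ∧ x ∉ A := by
      intro f hf
      have := mem_cutEdges.1 (hsub ((mem_cutEdges (p := (x + f, -f))).2
        ⟨hn f hf, hB.neg_mem f hf, by rwa [add_neg_cancel_right]⟩))
      exact ⟨this.1, by simpa only [add_neg_cancel_right] using this.2.2⟩
    obtain ⟨f, hf⟩ := hΓ
    exact (key f hf).2 (hc.closed x hx fun f hf => (key f hf).1)

/-- Each link-closed set of inner boundary vertices is incident to at least `m` boundary edges. -/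
def NoSmallClump (Γ A G : Finset V) (m : ℕ) : Prop :=
  ∀ κ ⊆ innerBdry Γ A G, κ.Nonempty →
    (∀ u ∈ κ, ∀ w ∈ innerBdry Γ A G, w - u ∈ cayleyBall Γ 2 → w ∈ κ) →
    m ≤ ∑ u ∈ κ, outDegree Γ A u

lemma card_le_sum_outDegree {κ : Finset V} (hκ : κ ⊆ innerBdry Γ A G) :
    κ.card ≤ ∑ u ∈ κ, outDegree Γ A u := by
  rw [card_eq_sum_ones]
  refine sum_le_sum fun u hu => ?_
  obtain ⟨-, f, hf, hA⟩ := mem_innerBdry.1 (hκ hu)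
  exact card_pos.2 ⟨f, mem_filter.2 ⟨hf, hA⟩⟩

lemma ite_add_ite_zmod_two {p q a b : Prop} [Decidable (p ∧ ¬ a)] [Decidable (p ∧ ¬ b)]
    [Decidable (q ∧ ¬ a)] [Decidable (q ∧ ¬ b)] (h1 : p → ¬ q → (a ↔ b))
    (h2 : q → ¬ p → (a ↔ b)) :
    (if p ∧ ¬ a then 1 else 0 : ZMod 2) + (if p ∧ ¬ b then 1 else 0) =
      (if q ∧ ¬ a then 1 else 0) + (if q ∧ ¬ b then 1 else 0) := by
  have hz2 : (1 : ZMod 2) + 1 = 0 := by decide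
  by_cases hp : p <;> by_cases hq : q <;> by_cases ha : a <;> by_cases hb : b <;>
    simp_all

lemma ite_add_ite_zmod_two' {p q a b : Prop} [Decidable (p ∧ ¬ a)] [Decidable (p ∧ ¬ b)]
    [Decidable (q ∧ ¬ a)] [Decidable (q ∧ ¬ b)] (h1 : p → ¬ q → (a ↔ b))
    (h2 : q → ¬ p → (a ↔ b)) :
    (if p ∧ ¬ a then 1 else 0 : ZMod 2) + (if q ∧ ¬ a then 1 else 0) =
      (if p ∧ ¬ b then 1 else 0) + (if q ∧ ¬ b then 1 else 0) := by
  have hz2 : (1 : ZMod 2) + 1 = 0 := by decide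
  by_cases hp : p <;> by_cases hq : q <;> by_cases ha : a <;> by_cases hb : b <;>
    simp_all

end CutEdges

section Flip

variable {L d : ℕ} [NeZero L] {A G : Finset (TV L d)}

/-- A small link-closed set of inner boundary vertices is cut out by a small set. -/
lemma ClosedPair.exists_clump_region (hE : Even L) (hd : 2 ≤ d)
    (hc : ClosedPair (torusGen L d) (evenVerts L d) A G) {κ : Finset (TV L d)}
    (hκ : κ ⊆ innerBdry (torusGen L d) A G) (hcard : κ.card < L)
    (hlink : ∀ u ∈ κ, ∀ w ∈ innerBdry (torusGen L d) A G, w - u ∈ cayleyBall (torusGen L d) 2 →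
      w ∈ κ) :
    ∃ X : Finset (TV L d), X.card ≤ κ.card ^ 2 ∧ ∀ x, ∀ f ∈ torusGen L d,
      (¬ (x ∈ X ↔ x + f ∈ X)) ↔ ((x ∈ κ ∧ x + f ∉ A) ∨ (x + f ∈ κ ∧ x ∉ A)) := by
  classical
  have hB := torus_bipCayley (d := d) hE
  have hodd : ∀ u ∈ κ, u ∉ evenVerts L d := fun u hu => hc.odd u (mem_innerBdry.1 (hκ hu)).1
  have hpar : ∀ x k, x + torusDir k ∈ evenVerts L d ↔ x ∉ evenVerts L d := fun x k =>
    hB.parity x _ (torusDir_mem k)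
  have key : ∀ u u' f g h i : TV L d, f ∈ torusGen L d → g ∈ torusGen L d → h ∈ torusGen L d →
      i ∈ torusGen L d → u + f = u' + h → u + g = u' + i →
      u ∈ κ → u' ∉ κ → (u + f ∈ A ↔ u + g ∈ A) := by
    intro u u' f g h i hf hg hh hi e1 e2 hu hu'
    have hball : u' - u ∈ cayleyBall (torusGen L d) 2 := by
      have : u' - u = f + -h := by rw [eq_add_neg_iff_add_eq, sub_add_eq_add_sub, ← e1]; abel
      rw [this]
      exact add_mem_cayleyBall (mem_cayleyBall_one hf) (mem_cayleyBall_one (hB.neg_mem h hh))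
    have hnb : u' ∉ innerBdry (torusGen L d) A G := fun h => hu' (hlink u hu u' h hball)
    rw [e1, e2]
    by_cases hG : u' ∈ G
    · have : ∀ f ∈ torusGen L d, u' + f ∈ A := fun f hf => by
        by_contra hA
        exact hnb (mem_innerBdry.2 ⟨hG, f, hf, hA⟩)
      simp [this h hh, this i hi]
    · have : ∀ f ∈ torusGen L d, u' + f ∉ A := fun f hf hA => by
        have := hB.sub_mem hf hA hc
        rw [add_sub_cancel_right] at this
        exact hG this
      simp [this h hh, this i hi]
  let P : TV L d → TV L d → Prop := fun x y => (x ∈ κ ∧ y ∉ A) ∨ (y ∈ κ ∧ x ∉ A)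
  let c : TV L d → Fin d → ZMod 2 := fun v k => if P v (v + torusDir k) then 1 else 0
  have hsq : ∀ v k l, c v k + c (v + torusDir k) l = c v l + c (v + torusDir l) k := by
    intro v k l
    have e1 : v + torusDir k + torusDir l = v + torusDir l + torusDir k := add_right_comm _ _ _
    have hk := hpar v k
    have hl := hpar v l
    have hkl := hpar (v + torusDir k) l
    simp only [c]
    by_cases hv : v ∈ evenVerts L d
    · have hv' : v ∉ κ := fun h => hodd v h hv
      have hv2 : v + torusDir k + torusDir l ∉ κ := fun h => hodd _ h (by tauto)
      have k1 := key (v + torusDir k) (v + torusDir l) (-torusDir k) (torusDir l) (-torusDir l)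
        (torusDir k) (neg_torusDir_mem k) (torusDir_mem l) (neg_torusDir_mem l) (torusDir_mem k)
        (by abel) (by abel)
      have k2 := key (v + torusDir l) (v + torusDir k) (-torusDir l) (torusDir k) (-torusDir k)
        (torusDir l) (neg_torusDir_mem l) (torusDir_mem k) (neg_torusDir_mem k) (torusDir_mem l)
        (by abel) (by abel)
      rw [add_neg_cancel_right] at k1 k2
      rw [← e1] at k2 ⊢
      simp only [P, hv', hv2, false_and, or_false, false_or]
      exact ite_add_ite_zmod_two k1 k2
    · have hv1 : v + torusDir k ∉ κ := fun h => hodd _ h (by tauto)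
      have hv2 : v + torusDir l ∉ κ := fun h => hodd _ h (by tauto)
      have k1 := key v (v + torusDir k + torusDir l) (torusDir k) (torusDir l) (-torusDir l)
        (-torusDir k) (torusDir_mem k) (torusDir_mem l) (neg_torusDir_mem l) (neg_torusDir_mem k)
        (by abel) (by abel)
      have k2 := key (v + torusDir k + torusDir l) v (-torusDir l) (-torusDir k) (torusDir k)
        (torusDir l) (neg_torusDir_mem l) (neg_torusDir_mem k) (torusDir_mem k) (torusDir_mem l)
        (by abel) (by abel)
      have e2 : v + torusDir k + torusDir l + -torusDir l = v + torusDir k := by abel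
      have e3 : v + torusDir k + torusDir l + -torusDir k = v + torusDir l := by abel
      rw [e2, e3] at k2
      rw [← e1]
      simp only [P, hv1, hv2, false_and, or_false, false_or]
      exact ite_add_ite_zmod_two' k1 k2
  have hsupp : ∀ v k, c v k ≠ 0 → v ∈ κ ∨ v + torusDir k ∈ κ := by
    intro v k h
    by_contra hcon
    push Not at hcon
    simp [c, P, hcon.1, hcon.2] at h
  obtain ⟨X, hX1, hX2⟩ := exists_bounded_set hd hcard hsq hsupp
  refine ⟨X, hX1, ?_⟩
  have h1 : ∀ v k, (¬ (v ∈ X ↔ v + torusDir k ∈ X)) ↔ P v (v + torusDir k) := by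
    intro v k
    rw [hX2 v k]
    by_cases h : P v (v + torusDir k) <;> simp [c, h]
  intro x f hf
  obtain ⟨k, rfl | rfl⟩ := mem_torusGen.1 hf
  · exact h1 x k
  · have := h1 (x + -torusDir k) k
    rw [neg_add_cancel_right] at this
    rw [iff_comm (a := x ∈ X), this]
    exact or_comm

end Flip

open scoped symmDiff

section FlipIteration

variable {L d : ℕ} [NeZero L] {A G : Finset (TV L d)}

/-- Removing a small clump of the boundary changes few vertices. -/
lemma ClosedPair.exists_flip (hE : Even L) (hd : 2 ≤ d)
    (hc : ClosedPair (torusGen L d) (evenVerts L d) A G) {m : ℕ} (hm : m ≤ L)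
    (hclump : ¬ NoSmallClump (torusGen L d) A G m) :
    ∃ A' G', ClosedPair (torusGen L d) (evenVerts L d) A' G' ∧ BdrySub (torusGen L d) A' G' A G ∧
      (cutEdges (torusGen L d) A' G').card < (cutEdges (torusGen L d) A G).card ∧
      ((A ∪ G) ∆ (A' ∪ G')).card + 2 * m * (cutEdges (torusGen L d) A' G').card ≤
        2 * m * (cutEdges (torusGen L d) A G).card := by
  classical
  have hB := torus_bipCayley (d := d) hE
  have hΓ : (torusGen L d).Nonempty := ⟨_, torusDir_mem ⟨0, by omega⟩⟩
  unfold NoSmallClump at hclump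
  push Not at hclump
  obtain ⟨κ, hκ, hne, hlink, hσ⟩ := hclump
  set σ := ∑ u ∈ κ, outDegree (torusGen L d) A u with hσdef
  have hκσ : κ.card ≤ σ := card_le_sum_outDegree hκ
  have hκpos : 0 < κ.card := hne.card_pos
  have hκG : κ ⊆ G := fun u hu => (mem_innerBdry.1 (hκ hu)).1
  obtain ⟨X, hX, hXκ⟩ := hc.exists_clump_region hE hd hκ (by omega) hlink
  set C := cutEdges (torusGen L d) A G with hC
  have hXle : X.card ≤ m * σ := hX.trans (by nlinarith)
  have hXW : ∀ x, ∀ f ∈ torusGen L d, (x ∈ A ∪ G ↔ x + f ∈ A ∪ G) → (x ∈ X ↔ x + f ∈ X) := by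
    intro x f hf h
    by_contra hcon
    refine (hc.disagree_iff hB hf).2 ?_ h
    rcases (hXκ x f hf).1 hcon with h' | h'
    · exact Or.inl ⟨hκG h'.1, h'.2⟩
    · exact Or.inr ⟨hκG h'.1, h'.2⟩
  have hunion : ∀ W : Finset (TV L d),
      W.filter (· ∈ evenVerts L d) ∪ W.filter (· ∉ evenVerts L d) = W := fun W =>
    filter_union_filter_not_eq _ _
  set Ka := C.filter (fun p => p.1 ∈ κ ∧ p.1 ∈ X) with hKa
  set Kb := C.filter (fun p => p.1 ∈ κ ∧ p.1 + p.2 ∈ X) with hKb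
  have hK : σ ≤ Ka.card + Kb.card := by
    rw [hσdef, ← card_cutEdges_filter hκG]
    refine (card_le_card fun p hp => ?_).trans (card_union_le _ _)
    rw [mem_filter] at hp
    have h1 := mem_cutEdges.1 hp.1
    have h2 := (hXκ p.1 p.2 h1.2.1).2 (Or.inl ⟨hp.2, h1.2.2⟩)
    rw [mem_union, mem_filter, mem_filter]
    by_cases h3 : p.1 ∈ X
    · exact Or.inl ⟨hp.1, hp.2, h3⟩
    · refine Or.inr ⟨hp.1, hp.2, ?_⟩
      tauto
  have hfin : ∀ (W : Finset (TV L d)) (K : Finset (TV L d × TV L d)), K ⊆ C → σ ≤ 2 * K.card →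
      (∀ x ∈ W, ∀ f ∈ torusGen L d, x + f ∉ W → x ∈ A ∪ G ∧ x + f ∉ A ∪ G) →
      (∀ p ∈ K, p.1 ∉ W ∨ p.1 + p.2 ∈ W) → (A ∪ G) ∆ W ⊆ X →
      ∃ A' G', ClosedPair (torusGen L d) (evenVerts L d) A' G' ∧
      BdrySub (torusGen L d) A' G' A G ∧
      (cutEdges (torusGen L d) A' G').card < C.card ∧
      ((A ∪ G) ∆ (A' ∪ G')).card + 2 * m * (cutEdges (torusGen L d) A' G').card ≤
        2 * m * C.card := by
    intro W K hKC hσK hW hKW hWX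
    obtain ⟨h1, h2⟩ := hc.of_bdry hB hΓ hW
    refine ⟨_, _, h1, h2, ?_⟩
    rw [hunion]
    have hdis : Disjoint (cutEdges (torusGen L d) (W.filter (· ∈ evenVerts L d))
        (W.filter (· ∉ evenVerts L d))) K := by
      rw [disjoint_left]
      intro p hp hpK
      rw [mem_cutEdges, mem_filter, mem_filter] at hp
      have h5 := (hB.parity p.1 p.2 hp.2.1).2 hp.1.2
      rcases hKW p hpK with h | h
      · exact h hp.1.1
      · exact hp.2.2 ⟨h, h5⟩
    have hle := card_le_card (union_subset h2 hKC)
    rw [card_union_of_disjoint hdis] at hle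
    change _ ≤ C.card at hle
    have hvol := card_le_card hWX
    refine ⟨by omega, ?_⟩
    nlinarith
  rcases le_total Kb.card Ka.card with hab | hab
  · refine hfin ((A ∪ G) \ X) Ka (filter_subset _ _) (by omega) ?_ ?_ ?_
    · intro x hx f hf hxf
      rw [mem_sdiff] at hx hxf
      refine ⟨hx.1, fun h => ?_⟩
      have h1 := hXW x f hf ⟨fun _ => h, fun _ => hx.1⟩
      tauto
    · intro p hp
      left
      rw [mem_sdiff]
      exact fun h => h.2 (mem_filter.1 hp).2.2
    · intro x hx
      rw [mem_symmDiff, mem_sdiff] at hx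
      tauto
  · refine hfin ((A ∪ G) ∪ X) Kb (filter_subset _ _) (by omega) ?_ ?_ ?_
    · intro x hx f hf hxf
      rw [mem_union (s := A ∪ G)] at hx hxf
      push Not at hxf
      refine ⟨?_, hxf.1⟩
      by_contra h
      have h1 := hXW x f hf ⟨fun h' => absurd h' h, fun h' => absurd h' hxf.1⟩
      tauto
    · intro p hp
      right
      exact mem_union_right _ (mem_filter.1 hp).2.2
    · intro x hx
      rw [mem_symmDiff, mem_union (s := A ∪ G)] at hx
      tauto

/-- All small clumps of the boundary can be removed, at a cost proportional to the boundary. -/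
lemma ClosedPair.exists_noSmallClump (hE : Even L) (hd : 2 ≤ d)
    (hc : ClosedPair (torusGen L d) (evenVerts L d) A G) {m : ℕ} (hm : m ≤ L) :
    ∃ A' G', ClosedPair (torusGen L d) (evenVerts L d) A' G' ∧ BdrySub (torusGen L d) A' G' A G ∧
      NoSmallClump (torusGen L d) A' G' m ∧
      ((A ∪ G) ∆ (A' ∪ G')).card ≤ 2 * m * (cutEdges (torusGen L d) A G).card := by
  suffices h : ∀ n, ∀ A G, ClosedPair (torusGen L d) (evenVerts L d) A G →
      (cutEdges (torusGen L d) A G).card ≤ n →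
      ∃ A' G', ClosedPair (torusGen L d) (evenVerts L d) A' G' ∧
        BdrySub (torusGen L d) A' G' A G ∧ NoSmallClump (torusGen L d) A' G' m ∧
        ((A ∪ G) ∆ (A' ∪ G')).card ≤ 2 * m * (cutEdges (torusGen L d) A G).card from
    h _ A G hc le_rfl
  intro n
  induction n with
  | zero =>
    intro A G hc hn
    by_cases hcl : NoSmallClump (torusGen L d) A G m
    · exact ⟨A, G, hc, Subset.refl _, hcl, by simp⟩
    · obtain ⟨A', G', -, -, h, -⟩ := hc.exists_flip hE hd hm hcl
      omega
  | succ n ih =>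
    intro A G hc hn
    by_cases hcl : NoSmallClump (torusGen L d) A G m
    · exact ⟨A, G, hc, Subset.refl _, hcl, by simp⟩
    · obtain ⟨A', G', hc', hsub, h1, h2⟩ := hc.exists_flip hE hd hm hcl
      obtain ⟨A'', G'', hc'', hsub', h3, h4⟩ := ih A' G' hc' (by omega)
      refine ⟨A'', G'', hc'', Subset.trans hsub' hsub, h3, ?_⟩
      have h5 : ((A ∪ G) ∆ (A'' ∪ G'')).card ≤ ((A ∪ G) ∆ (A' ∪ G')).card +
          ((A' ∪ G') ∆ (A'' ∪ G'')).card :=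
        (card_le_card (symmDiff_triangle _ _ _)).trans (card_union_le _ _)
      omega

end FlipIteration

section Scale

variable {L d : ℕ} [NeZero L] {A G : Finset (TV L d)}

lemma ClosedPair.exists_surplus (hd : 1 ≤ d)
    (hc : ClosedPair (torusGen L d) (evenVerts L d) A G) : ∃ t, G.card = A.card + t := by
  have h : A.card ≤ G.card := by
    refine card_le_card_of_injOn (· + torusDir ⟨0, by omega⟩)
      (fun x hx => hc.nb x hx _ (torusDir_mem _)) (fun x _ y _ h => add_left_injective _ h)
  exact ⟨G.card - A.card, by omega⟩

lemma ClosedPair.card_cutEdges (hE : Even L) (hL : 3 ≤ L)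
    (hc : ClosedPair (torusGen L d) (evenVerts L d) A G) {t : ℕ} (ht : G.card = A.card + t) :
    (cutEdges (torusGen L d) A G).card = 2 * d * t := by
  rw [_root_.card_cutEdges, hc.sum_outDegree (torus_bipCayley hE) ht, card_torusGen hL]

/-- A region of intermediate volume has a boundary of size at least `L^(d-1) / (80 d)`. -/
lemma ClosedPair.card_torus_le_cut (hE : Even L) (hL : 3 ≤ L) (hd : 1 ≤ d)
    (hc : ClosedPair (torusGen L d) (evenVerts L d) A G)
    (hlow : L ^ d ≤ 32 * d * (A ∪ G).card) (hhigh : 5 * (A ∪ G).card ≤ 4 * L ^ d) :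
    L ^ d ≤ 80 * d * L * (cutEdges (torusGen L d) A G).card := by
  obtain ⟨t, ht⟩ := hc.exists_surplus hd
  have h1 := card_mul_card_compl_le (A ∪ G)
  rw [hc.sum_shiftDiff_torusDir hE hL ht, ← hc.card_cutEdges hE hL ht, card_compl] at h1
  have hcard : Fintype.card (TV L d) = L ^ d := by simp
  rw [hcard] at h1
  set N := L ^ d
  have hN : 0 < N := Nat.pow_pos (by omega)
  set w := (A ∪ G).card
  obtain ⟨z, hz⟩ : ∃ z, N = w + z := ⟨N - w, by omega⟩
  have h2 : N - w = z := by omega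
  rw [h2] at h1
  have h3 : N ≤ 5 * z := by omega
  have h4 : N * N ≤ 32 * d * w * (5 * z) := Nat.mul_le_mul hlow h3
  have h5 : N * N ≤ N * (80 * d * L * (cutEdges (torusGen L d) A G).card) := by
    calc N * N ≤ 80 * d * (2 * (w * z)) := by linarith
      _ ≤ 80 * d * (N * (L * (cutEdges (torusGen L d) A G).card)) := Nat.mul_le_mul_left _ h1
      _ = _ := by ring
  exact Nat.le_of_mul_le_mul_left h5 hN

lemma volume_bounds {N w w' x : ℕ} {d : ℕ} (hd : 100 ≤ d) (hx : d ^ 2 * x ≤ N)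
    (h1 : w ≤ w' + x) (h2 : w' ≤ w + x) (hlow : N ≤ 16 * d * w) (hhigh : 4 * w ≤ 3 * N) :
    N ≤ 32 * d * w' ∧ 5 * w' ≤ 4 * N := by
  have h3 : 32 * d * x ≤ N := le_trans (Nat.mul_le_mul_right _ (by nlinarith)) hx
  have h4 : 20 * x ≤ N := le_trans (Nat.mul_le_mul_right _ (by nlinarith)) hx
  refine ⟨?_, by omega⟩
  have : 16 * d * w ≤ 16 * d * (w' + x) := Nat.mul_le_mul_left _ h1
  nlinarith

/-- One can pass to a sub-boundary of intermediate volume which either is large or has only large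
clumps, compared with its size. -/
theorem ClosedPair.exists_scale (hE : Even L) (hL : 4 ≤ L) (hd : 100 ≤ d)
    (hc : ClosedPair (torusGen L d) (evenVerts L d) A G)
    (hlow : L ^ d ≤ 16 * d * (A ∪ G).card) (hhigh : 4 * (A ∪ G).card ≤ 3 * L ^ d) :
    ∃ A' G', ClosedPair (torusGen L d) (evenVerts L d) A' G' ∧ BdrySub (torusGen L d) A' G' A G ∧
      L ^ d ≤ 80 * d * L * (cutEdges (torusGen L d) A' G').card ∧
      (L ^ d ≤ d ^ 20 * (cutEdges (torusGen L d) A' G').card ∨ ∃ m, d ^ 3 ≤ m ∧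
        NoSmallClump (torusGen L d) A' G' m ∧
        L ^ d ≤ m ^ 4 * (cutEdges (torusGen L d) A' G').card) := by
  classical
  have hcut0 := hc.card_torus_le_cut hE (by omega) (by omega) (by nlinarith) (by omega)
  by_cases hst : L ^ d ≤ d ^ 20 * (cutEdges (torusGen L d) A G).card
  · exact ⟨A, G, hc, Subset.refl _, hcut0, Or.inl hst⟩
  push Not at hst
  set N := L ^ d with hN
  have hNpos : 0 < N := Nat.pow_pos (by omega)
  have hLd : d ^ 3 ≤ L := by
    by_contra hcon
    push Not at hcon
    have h1 : 80 * d * L ≤ d ^ 20 := by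
      calc 80 * d * L ≤ d * d * d ^ 3 := by
            refine Nat.mul_le_mul ?_ hcon.le
            nlinarith
        _ = d ^ 5 := by ring
        _ ≤ d ^ 20 := Nat.pow_le_pow_right (by omega) (by norm_num)
    have := Nat.mul_le_mul_right (cutEdges (torusGen L d) A G).card h1
    omega
  have hdR : (100 : ℝ) ≤ d := by exact_mod_cast hd
  have hsymm : ∀ A' G' : Finset (TV L d),
      ((((A ∪ G) ∆ (A' ∪ G')).card : ℕ) : ℝ) ≤ N / (d : ℝ) ^ 2 →
      N ≤ 32 * d * (A' ∪ G').card ∧ 5 * (A' ∪ G').card ≤ 4 * N := by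
    intro A' G' h
    rw [le_div_iff₀ (by positivity)] at h
    have h' : d ^ 2 * ((A ∪ G) ∆ (A' ∪ G')).card ≤ N := by
      rw [mul_comm]; exact_mod_cast h
    have e1 : A ∪ G ⊆ (A' ∪ G') ∪ ((A ∪ G) ∆ (A' ∪ G')) := by
      intro x hx
      rw [mem_union (s := A' ∪ G'), mem_symmDiff]; tauto
    have e2 : A' ∪ G' ⊆ (A ∪ G) ∪ ((A ∪ G) ∆ (A' ∪ G')) := by
      intro x hx
      rw [mem_union (s := A ∪ G), mem_symmDiff]; tauto
    exact volume_bounds hd h' ((card_le_card e1).trans (card_union_le _ _))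
      ((card_le_card e2).trans (card_union_le _ _)) hlow hhigh
  by_contra hcon
  push Not at hcon
  have key : ∀ m, d ^ 3 ≤ m → m ≤ L → ∃ A' G',
      ClosedPair (torusGen L d) (evenVerts L d) A' G' ∧ BdrySub (torusGen L d) A' G' A G ∧
      NoSmallClump (torusGen L d) A' G' m ∧
      ((((A ∪ G) ∆ (A' ∪ G')).card : ℕ) : ℝ) ≤ N / (d : ℝ) ^ 2 - N / m := by
    intro m hm
    induction m, hm using Nat.le_induction with
    | base =>
      intro hm
      obtain ⟨A', G', h1, h2, h3, h4⟩ := hc.exists_noSmallClump hE (by omega) hm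
      refine ⟨A', G', h1, h2, h3, ?_⟩
      have h5 : (((A ∪ G) ∆ (A' ∪ G')).card : ℝ) ≤
          2 * (d : ℝ) ^ 3 * (cutEdges (torusGen L d) A G).card := by exact_mod_cast h4
      have h6 : (d : ℝ) ^ 20 * (cutEdges (torusGen L d) A G).card ≤ N := by exact_mod_cast hst.le
      have h7 : ((cutEdges (torusGen L d) A G).card : ℝ) ≤ N / (d : ℝ) ^ 20 := by
        rw [le_div_iff₀ (by positivity)]; linarith
      have h8 : 2 * (d : ℝ) ^ 3 * (N / (d : ℝ) ^ 20) ≤ N / (d : ℝ) ^ 2 - N / ((d ^ 3 : ℕ) : ℝ) := by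
        have e : N / (d : ℝ) ^ 2 - N / ((d ^ 3 : ℕ) : ℝ) - 2 * (d : ℝ) ^ 3 * (N / (d : ℝ) ^ 20) =
            N / (d : ℝ) ^ 17 * ((d : ℝ) ^ 15 - (d : ℝ) ^ 14 - 2) := by
          push_cast; field_simp
        have : 0 ≤ (d : ℝ) ^ 15 - (d : ℝ) ^ 14 - 2 := by
          have : (1 : ℝ) ≤ (d : ℝ) ^ 14 := one_le_pow₀ (by linarith)
          nlinarith
        have : 0 ≤ N / (d : ℝ) ^ 17 * ((d : ℝ) ^ 15 - (d : ℝ) ^ 14 - 2) := by positivity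
        linarith
      have h9 : 2 * (d : ℝ) ^ 3 * (cutEdges (torusGen L d) A G).card ≤
          2 * (d : ℝ) ^ 3 * (N / (d : ℝ) ^ 20) := by gcongr
      linarith
    | succ m hm ih =>
      intro hmL
      obtain ⟨A', G', h1, h2, h3, h4⟩ := ih (by omega)
      have hm3 : 100 ≤ m := le_trans (by nlinarith [Nat.pow_le_pow_left hd 3]) hm
      have hmR : (100 : ℝ) ≤ m := by exact_mod_cast hm3
      have hb := hsymm A' G' (h4.trans (sub_le_self _ (by positivity)))
      have hp := h1.card_torus_le_cut hE (by omega) (by omega) hb.1 hb.2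
      have hcut := (hcon A' G' h1 h2 hp).2 m hm h3
      obtain ⟨A'', G'', k1, k2, k3, k4⟩ := h1.exists_noSmallClump hE (by omega) hmL
      refine ⟨A'', G'', k1, Subset.trans k2 h2, k3, ?_⟩
      have h5 : ((A ∪ G) ∆ (A'' ∪ G'')).card ≤ ((A ∪ G) ∆ (A' ∪ G')).card +
          ((A' ∪ G') ∆ (A'' ∪ G'')).card :=
        (card_le_card (symmDiff_triangle _ _ _)).trans (card_union_le _ _)
      have h5' : (((A ∪ G) ∆ (A'' ∪ G'')).card : ℝ) ≤ ((A ∪ G) ∆ (A' ∪ G')).card +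
          ((A' ∪ G') ∆ (A'' ∪ G'')).card := by exact_mod_cast h5
      have k4' : (((A' ∪ G') ∆ (A'' ∪ G'')).card : ℝ) ≤
          2 * ((m : ℝ) + 1) * (cutEdges (torusGen L d) A' G').card := by exact_mod_cast k4
      have h6 : (m : ℝ) ^ 4 * (cutEdges (torusGen L d) A' G').card ≤ N := by
        exact_mod_cast hcut.le
      have h7 : ((cutEdges (torusGen L d) A' G').card : ℝ) ≤ N / (m : ℝ) ^ 4 := by
        rw [le_div_iff₀ (by positivity)]; linarith
      have h8 : 2 * ((m : ℝ) + 1) * (N / (m : ℝ) ^ 4) ≤ N / (m : ℝ) - N / ((m + 1 : ℕ) : ℝ) := by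
        have e : N / (m : ℝ) - N / ((m + 1 : ℕ) : ℝ) - 2 * ((m : ℝ) + 1) * (N / (m : ℝ) ^ 4) =
            N / ((m : ℝ) ^ 4 * (m + 1)) * ((m : ℝ) ^ 3 - 2 * (m + 1) ^ 2) := by
          push_cast; field_simp; ring
        have : 0 ≤ (m : ℝ) ^ 3 - 2 * (m + 1) ^ 2 := by nlinarith
        have : 0 ≤ N / ((m : ℝ) ^ 4 * (m + 1)) * ((m : ℝ) ^ 3 - 2 * (m + 1) ^ 2) := by positivity
        linarith
      have h9 : 2 * ((m : ℝ) + 1) * (cutEdges (torusGen L d) A' G').card ≤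
          2 * ((m : ℝ) + 1) * (N / (m : ℝ) ^ 4) := by gcongr
      linarith
  obtain ⟨A', G', h1, h2, h3, h4⟩ := key L hLd le_rfl
  have hb := hsymm A' G' (h4.trans (sub_le_self _ (by positivity)))
  have hp := h1.card_torus_le_cut hE (by omega) (by omega) hb.1 hb.2
  have hcut := (hcon A' G' h1 h2 hp).2 L hLd h3
  have h5 : 80 * d * L ≤ L ^ 4 := by
    have hdL : d ≤ L := le_trans (Nat.le_self_pow (by norm_num) d) hLd
    have : 80 ≤ L := by omega
    calc 80 * d * L ≤ L * L * L := by gcongr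
      _ = L ^ 3 := by ring
      _ ≤ L ^ 4 := Nat.pow_le_pow_right (by omega) (by norm_num)
  have := Nat.mul_le_mul_right (cutEdges (torusGen L d) A' G').card h5
  omega

end Scale

section Rounding

variable {L d : ℕ} [NeZero L]

lemma val_add_one_mod_two (hE : Even L) (a : Fin L) :
    ((a + 1 : Fin L) : ℕ) % 2 = ((a : ℕ) + 1) % 2 := by
  rw [val_add_one_fin]
  exact Nat.mod_mod_of_dvd _ hE.two_dvd

/-- Round the coordinates in `K` down to even values. -/
def roundDown (K : Finset (Fin d)) (y : TV L d) : TV L d :=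
  fun i => if i ∈ K ∧ (y i : ℕ) % 2 = 1 then y i - 1 else y i

/-- The vertices whose coordinates in `K` are even. -/
def coarseVerts (L : ℕ) {d : ℕ} (K : Finset (Fin d)) : Finset (TV L d) :=
  univ.filter fun v => ∀ i ∈ K, (v i : ℕ) % 2 = 0

/-- The steps of the coarsened torus. -/
def coarseDir (K : Finset (Fin d)) (j : Fin d) : TV L d := (if j ∈ K then 2 else 1) • torusDir j

variable {K : Finset (Fin d)}

lemma roundDown_add_sum (y : TV L d) :
    roundDown K y + ∑ i ∈ K.filter (fun i => (y i : ℕ) % 2 = 1), torusDir i = y := by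
  funext j
  rw [Pi.add_apply, Finset.sum_apply]
  have : ∀ i : Fin d, (torusDir i : TV L d) j = if j = i then 1 else 0 := fun i => by
    simp [torusDir, Pi.single_apply]
  simp_rw [this, sum_ite_eq, mem_filter, roundDown]
  by_cases h : j ∈ K ∧ (y j : ℕ) % 2 = 1
  · simp [h]
  · simp [h]

lemma roundDown_mem (hE : Even L) (y : TV L d) : roundDown K y ∈ coarseVerts L K := by
  simp only [coarseVerts, mem_filter, mem_univ, true_and]
  intro i hi
  by_cases h : (y i : ℕ) % 2 = 1
  · have h2 := val_add_one_mod_two hE (y i - 1)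
    rw [sub_add_cancel] at h2
    simp only [roundDown, hi, h, true_and, if_true]
    omega
  · simp only [roundDown, hi, h, true_and, if_false]
    omega

lemma roundDown_add_torusDir (hE : Even L) (x : TV L d) (k : Fin d) :
    roundDown K (x + torusDir k) = roundDown K x ∨
      roundDown K (x + torusDir k) = roundDown K x + coarseDir K k := by
  have hp := val_add_one_mod_two hE (x k)
  by_cases hk : k ∈ K
  · by_cases ho : (x k : ℕ) % 2 = 1
    · right
      funext j
      by_cases hj : j = k
      · subst hj
        rw [Pi.add_apply, coarseDir, if_pos hk, Pi.smul_apply]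
        have : ¬ ((x j + 1 : Fin L) : ℕ) % 2 = 1 := by omega
        simp only [roundDown, add_torusDir_same, hk, ho, this, true_and, if_true, if_false]
        simp only [torusDir, Pi.single_eq_same, two_nsmul]
        abel
      · rw [coarseDir, add_nsmul_torusDir_of_ne _ hj]
        simp only [roundDown, add_torusDir_of_ne x hj]
    · left
      funext j
      by_cases hj : j = k
      · subst hj
        have : ((x j + 1 : Fin L) : ℕ) % 2 = 1 := by omega
        simp only [roundDown, add_torusDir_same, hk, ho, this, true_and, if_true, if_false]
        abel
      · simp [roundDown, add_torusDir_of_ne x hj]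
  · right
    funext j
    by_cases hj : j = k
    · subst hj
      simp [roundDown, hk, coarseDir]
    · rw [coarseDir, add_nsmul_torusDir_of_ne _ hj]
      simp only [roundDown, add_torusDir_of_ne x hj]

lemma add_coarseDir_mem (hE : Even L) {v : TV L d} (hv : v ∈ coarseVerts L K) (j : Fin d) :
    v + coarseDir K j ∈ coarseVerts L K := by
  simp only [coarseVerts, mem_filter, mem_univ, true_and] at hv ⊢
  intro i hi
  by_cases hij : i = j
  · subst hij
    rw [coarseDir, if_pos hi, two_nsmul, ← add_assoc, add_torusDir_same, add_torusDir_same]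
    have h1 := val_add_one_mod_two hE (v i + 1)
    have h2 := val_add_one_mod_two hE (v i)
    have h3 := hv i hi
    omega
  · rw [coarseDir, add_nsmul_torusDir_of_ne _ hij]
    exact hv i hi

lemma card_fin_even (hE : Even L) : 2 * (univ.filter fun a : Fin L => (a : ℕ) % 2 = 0).card = L := by
  have h1 : (univ.filter fun a : Fin L => ¬ (a : ℕ) % 2 = 0).card =
      (univ.filter fun a : Fin L => (a : ℕ) % 2 = 0).card := by
    rw [← card_filter_comp_add (fun a : Fin L => ¬ (a : ℕ) % 2 = 0) 1]
    congr 1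
    ext a
    have := val_add_one_mod_two hE a
    simp only [mem_filter, mem_univ, true_and]
    omega
  have h2 := card_filter_add_card_filter_not (s := (univ : Finset (Fin L)))
    (fun a : Fin L => (a : ℕ) % 2 = 0)
  rw [h1, card_univ, Fintype.card_fin] at h2
  omega

lemma card_coarseVerts (hE : Even L) : 2 ^ K.card * (coarseVerts L K).card = L ^ d := by
  have h : coarseVerts L K = Fintype.piFinset fun i =>
      if i ∈ K then univ.filter (fun a : Fin L => (a : ℕ) % 2 = 0) else univ := by
    ext v
    simp only [coarseVerts, mem_filter, mem_univ, true_and, Fintype.mem_piFinset]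
    refine forall_congr' fun i => ?_
    by_cases hi : i ∈ K <;> simp [hi]
  rw [h, Fintype.card_piFinset]
  have h1 : (2 : ℕ) ^ K.card = ∏ i : Fin d, if i ∈ K then 2 else 1 := by
    rw [prod_ite_mem]; simp
  rw [h1, ← prod_mul_distrib]
  have h2 : ∀ i : Fin d, ((if i ∈ K then 2 else 1) * (if i ∈ K then
      univ.filter (fun a : Fin L => (a : ℕ) % 2 = 0) else univ).card) = L := by
    intro i
    by_cases hi : i ∈ K
    · simp only [hi, if_true, card_fin_even hE]
    · simp [hi]
  rw [prod_congr rfl fun i _ => h2 i]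
  simp

/-- The region `W` sampled on a translate of the coarse vertices. -/
def coarsen (K : Finset (Fin d)) (τ : TV L d) (W : Finset (TV L d)) : Finset (TV L d) :=
  univ.filter fun x => roundDown K (x + τ) - τ ∈ W

/-- The sample points with a neighbouring sample point of the other kind. -/
def coarseBdry (K : Finset (Fin d)) (τ : TV L d) (W : Finset (TV L d)) : Finset (TV L d) :=
  univ.filter fun c => c + τ ∈ coarseVerts L K ∧
    ∃ j, ¬ (c ∈ W ↔ c + coarseDir K j ∈ W) ∨ ¬ (c ∈ W ↔ c + -coarseDir K j ∈ W)

lemma iff_of_and_iff_of_and_not_iff {a b p : Prop} (h1 : a ↔ p ∧ b) (h2 : ¬ a ↔ p ∧ ¬ b) :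
    a ↔ b := by
  tauto

/-- The coarsening is determined by the boundary sample points and one value. -/
lemma coarsen_eq_of_coarseBdry (hE : Even L) {τ : TV L d} {W W' : Finset (TV L d)}
    (h0 : -τ ∈ W ↔ -τ ∈ W') (h1 : coarseBdry K τ W ∩ W = coarseBdry K τ W' ∩ W')
    (h2 : coarseBdry K τ W \ W = coarseBdry K τ W' \ W') : coarsen K τ W = coarsen K τ W' := by
  have key : ∀ W W' : Finset (TV L d), coarseBdry K τ W ∩ W = coarseBdry K τ W' ∩ W' →
      coarseBdry K τ W \ W = coarseBdry K τ W' \ W' →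
      ∀ v ∈ coarseVerts L K, ∀ j, ¬ (v - τ ∈ W ↔ v + coarseDir K j - τ ∈ W) →
        ((v - τ ∈ W ↔ v - τ ∈ W') ∧ (v + coarseDir K j - τ ∈ W ↔ v + coarseDir K j - τ ∈ W')) := by
    intro W W' h1 h2 v hv j hdis
    have e1 : v - τ + coarseDir K j = v + coarseDir K j - τ := sub_add_eq_add_sub _ _ _
    have e2 : v + coarseDir K j - τ + -coarseDir K j = v - τ := by abel
    have c1 : v - τ ∈ coarseBdry K τ W := by
      simp only [coarseBdry, mem_filter, mem_univ, true_and, sub_add_cancel]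
      exact ⟨hv, j, Or.inl (by rwa [e1])⟩
    have c2 : v + coarseDir K j - τ ∈ coarseBdry K τ W := by
      simp only [coarseBdry, mem_filter, mem_univ, true_and, sub_add_cancel]
      exact ⟨add_coarseDir_mem hE hv j, j, Or.inr (by rwa [e2, iff_comm])⟩
    have a1 := Finset.ext_iff.1 h1 (v - τ)
    have a2 := Finset.ext_iff.1 h2 (v - τ)
    have a3 := Finset.ext_iff.1 h1 (v + coarseDir K j - τ)
    have a4 := Finset.ext_iff.1 h2 (v + coarseDir K j - τ)
    simp only [mem_inter, mem_sdiff, c1, c2, true_and] at a1 a2 a3 a4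
    exact ⟨iff_of_and_iff_of_and_not_iff a1 a2, iff_of_and_iff_of_and_not_iff a3 a4⟩
  have hstep : ∀ v ∈ coarseVerts L K, ∀ j, ((v - τ ∈ W ↔ v - τ ∈ W') ↔
      (v + coarseDir K j - τ ∈ W ↔ v + coarseDir K j - τ ∈ W')) := by
    intro v hv j
    have k1 := key W W' h1 h2 v hv j
    have k2 := key W' W h1.symm h2.symm v hv j
    clear key h0 h1 h2
    by_cases q1 : v - τ ∈ W ↔ v + coarseDir K j - τ ∈ W
    · by_cases q2 : v - τ ∈ W' ↔ v + coarseDir K j - τ ∈ W'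
      · rw [q1, q2]
      · obtain ⟨r1, r2⟩ := k2 q2
        exact iff_of_true r1.symm r2.symm
    · obtain ⟨r1, r2⟩ := k1 q1
      exact iff_of_true r1 r2
  have hconst := torus_const (f := fun x : TV L d =>
      (roundDown K x - τ ∈ W ↔ roundDown K x - τ ∈ W')) (fun v k => by
    rcases roundDown_add_torusDir (K := K) hE v k with h | h
    · simp only [h]
    · simp only [h]
      exact propext (hstep _ (roundDown_mem hE v) k).symm)
  have hz : roundDown K (0 : TV L d) = 0 := by
    funext i; simp [roundDown]
  ext x
  simp only [coarsen, mem_filter, mem_univ, true_and]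
  have := hconst 0 (x + τ)
  simp only [hz, zero_sub] at this
  exact this.mp h0

lemma shiftDiff_coarseDir_le (W : Finset (TV L d)) (j : Fin d) :
    shiftDiff W (coarseDir K j) ≤ 2 * shiftDiff W (torusDir j) := by
  refine (shiftDiff_nsmul_le W _ _).trans (Nat.mul_le_mul_right _ ?_)
  split_ifs <;> omega

lemma sum_card_coarsen_le (W : Finset (TV L d)) :
    ∑ τ, (univ.filter fun x => ¬ (x ∈ W ↔ x ∈ coarsen K τ W)).card ≤
      L ^ d * ∑ i ∈ K, shiftDiff W (torusDir i) := by
  have h1 : ∀ τ, (univ.filter fun x => ¬ (x ∈ W ↔ x ∈ coarsen K τ W)).card =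
      (univ.filter fun y => ¬ (y - τ ∈ W ↔ roundDown K y - τ ∈ W)).card := by
    intro τ
    rw [← card_filter_comp_add (fun y => ¬ (y - τ ∈ W ↔ roundDown K y - τ ∈ W)) τ]
    congr 1
    ext x
    simp [coarsen]
  simp_rw [h1, card_filter]
  rw [sum_comm]
  have h2 : ∀ y : TV L d, (∑ τ, if ¬ (y - τ ∈ W ↔ roundDown K y - τ ∈ W) then 1 else 0) ≤
      ∑ i ∈ K, shiftDiff W (torusDir i) := by
    intro y
    have e : (∑ τ, if ¬ (y - τ ∈ W ↔ roundDown K y - τ ∈ W) then 1 else 0) =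
        shiftDiff W (roundDown K y - y) := by
      rw [shiftDiff, card_filter]
      refine Fintype.sum_equiv (Equiv.subLeft y) _ _ fun τ => ?_
      have : y - τ + (roundDown K y - y) = roundDown K y - τ := by abel
      simp [this]
    rw [e, ← shiftDiff_neg]
    have e2 : -(roundDown K y - y) = ∑ i ∈ K.filter (fun i => (y i : ℕ) % 2 = 1), torusDir i := by
      nth_rewrite 2 [← roundDown_add_sum (K := K) y]
      abel
    rw [e2]
    exact (shiftDiff_sum_le _ _ _).trans (sum_le_sum_of_subset (filter_subset _ _))
  refine (sum_le_card_nsmul _ _ _ fun y _ => h2 y).trans (le_of_eq ?_)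
  simp

lemma sum_card_coarseBdry_le (W : Finset (TV L d)) :
    ∑ τ, (coarseBdry K τ W).card ≤
      (coarseVerts L K).card * (4 * ∑ j, shiftDiff W (torusDir j)) := by
  have h1 : ∀ τ, (coarseBdry K τ W).card ≤ ∑ j, ∑ a ∈ ({coarseDir K j, -coarseDir K j} : Finset _),
      (univ.filter fun c => c + τ ∈ coarseVerts L K ∧ ¬ (c ∈ W ↔ c + a ∈ W)).card := by
    intro τ
    refine (card_le_card ?_).trans (card_biUnion_le.trans (sum_le_sum fun j _ => card_biUnion_le))
    intro c hc
    simp only [coarseBdry, mem_filter, mem_univ, true_and] at hc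
    obtain ⟨hc1, j, hj⟩ := hc
    simp only [mem_biUnion, mem_univ, true_and, mem_filter, mem_insert, mem_singleton]
    rcases hj with hj | hj
    · exact ⟨j, _, Or.inl rfl, hc1, hj⟩
    · exact ⟨j, _, Or.inr rfl, hc1, hj⟩
  have h2 : ∀ a : TV L d,
      ∑ τ, (univ.filter fun c => c + τ ∈ coarseVerts L K ∧ ¬ (c ∈ W ↔ c + a ∈ W)).card =
        (coarseVerts L K).card * shiftDiff W a := by
    intro a
    simp_rw [card_filter, ite_and]
    rw [sum_comm]
    have : ∀ c : TV L d, (∑ τ, if c + τ ∈ coarseVerts L K then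
        if ¬ (c ∈ W ↔ c + a ∈ W) then 1 else 0 else 0) =
        (coarseVerts L K).card * if ¬ (c ∈ W ↔ c + a ∈ W) then 1 else 0 := by
      intro c
      have e := card_filter_comp_add (fun τ => τ ∈ coarseVerts L K) c
      rw [filter_univ_mem] at e
      rw [← e, ← sum_filter, sum_const, smul_eq_mul]
      congr 2
      ext τ
      simp [add_comm]
    rw [sum_congr rfl fun c _ => this c, ← mul_sum, shiftDiff, card_filter]
  calc ∑ τ, (coarseBdry K τ W).card
      ≤ ∑ τ, ∑ j, ∑ a ∈ ({coarseDir K j, -coarseDir K j} : Finset (TV L d)),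
        (univ.filter fun c => c + τ ∈ coarseVerts L K ∧ ¬ (c ∈ W ↔ c + a ∈ W)).card :=
        sum_le_sum fun τ _ => h1 τ
    _ = ∑ j, ∑ a ∈ ({coarseDir K j, -coarseDir K j} : Finset (TV L d)),
        (coarseVerts L K).card * shiftDiff W a := by
        rw [sum_comm]
        refine sum_congr rfl fun j _ => ?_
        rw [sum_comm]
        exact sum_congr rfl fun a _ => h2 a
    _ ≤ ∑ j, (coarseVerts L K).card * (4 * shiftDiff W (torusDir j)) := by
        refine sum_le_sum fun j _ => ?_
        rw [← mul_sum]
        refine Nat.mul_le_mul_left _ ?_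
        have h3 := shiftDiff_coarseDir_le (K := K) W j
        refine (sum_le_card_nsmul _ _ (2 * shiftDiff W (torusDir j)) ?_).trans ?_
        · intro a ha
          rcases mem_insert.1 ha with rfl | ha
          · exact h3
          · rw [mem_singleton.1 ha, shiftDiff_neg]; exact h3
        · rw [smul_eq_mul]
          have := card_le_two (a := (coarseDir K j : TV L d)) (b := -coarseDir K j)
          nlinarith
    _ = _ := by rw [mul_sum, mul_sum]

/-- Some translate of the coarse lattice approximates the region well and cuts it rarely. -/
lemma exists_translate (hE : Even L) {W : Finset (TV L d)} {t : ℕ} (ht : 0 < t) (hd : 0 < d)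
    (hK0 : 0 < K.card) (hK : ∑ i ∈ K, shiftDiff W (torusDir i) ≤ 4 * K.card * t)
    (hW : ∑ j, shiftDiff W (torusDir j) = 2 * d * t) :
    ∃ τ, (univ.filter fun x => ¬ (x ∈ W ↔ x ∈ coarsen K τ W)).card ≤ 8 * K.card * t ∧
      2 ^ K.card * (coarseBdry K τ W).card ≤ 16 * d * t := by
  set k := K.card
  set m := fun τ => (univ.filter fun x => ¬ (x ∈ W ↔ x ∈ coarsen K τ W)).card
  set b := fun τ => (coarseBdry K τ W).card
  have h1 : ∑ τ, m τ ≤ L ^ d * (4 * k * t) :=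
    (sum_card_coarsen_le W).trans (Nat.mul_le_mul_left _ hK)
  have h2 : 2 ^ k * ∑ τ, b τ ≤ L ^ d * (8 * d * t) := by
    refine (Nat.mul_le_mul_left _ (sum_card_coarseBdry_le (K := K) W)).trans (le_of_eq ?_)
    rw [hW, ← mul_assoc, card_coarseVerts hE]
    ring
  have h3 : ∑ τ, (m τ * (8 * d * t) + 2 ^ k * b τ * (4 * k * t)) ≤
      ∑ _τ : TV L d, 2 * ((4 * k * t) * (8 * d * t)) := by
    rw [sum_add_distrib, ← sum_mul, ← sum_mul, ← mul_sum, sum_const, card_univ]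
    have h4 := Nat.mul_le_mul_right (8 * d * t) h1
    have h5 := Nat.mul_le_mul_right (4 * k * t) h2
    have hcard : Fintype.card (TV L d) = L ^ d := by simp
    rw [hcard, smul_eq_mul]
    linarith
  obtain ⟨τ, -, hτ⟩ := exists_le_of_sum_le (univ_nonempty (α := TV L d)) h3
  have p1 : 0 < 8 * d * t := by positivity
  have p2 : 0 < 4 * k * t := by positivity
  refine ⟨τ, ?_, ?_⟩
  · have : m τ * (8 * d * t) ≤ (8 * k * t) * (8 * d * t) := by
      refine le_trans (Nat.le_add_right _ _) (hτ.trans (le_of_eq (by ring)))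
    exact Nat.le_of_mul_le_mul_right this p1
  · have : 2 ^ k * b τ * (4 * k * t) ≤ (16 * d * t) * (4 * k * t) := by
      refine le_trans (Nat.le_add_left _ _) (hτ.trans (le_of_eq (by ring)))
    exact Nat.le_of_mul_le_mul_right this p2

lemma exists_quiet_directions {W : Finset (TV L d)} {t k : ℕ} (hk : 2 * k ≤ d) (ht : 0 < t)
    (hW : ∑ j, shiftDiff W (torusDir j) = 2 * d * t) :
    ∃ K : Finset (Fin d), K.card = k ∧ ∑ i ∈ K, shiftDiff W (torusDir i) ≤ 4 * K.card * t := by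
  have h1 : k ≤ (univ.filter fun j => shiftDiff W (torusDir j) ≤ 4 * t).card := by
    have h2 := card_filter_add_card_filter_not (s := (univ : Finset (Fin d)))
      (fun j => shiftDiff W (torusDir j) ≤ 4 * t)
    rw [card_univ, Fintype.card_fin] at h2
    have h3 : (univ.filter fun j => ¬ shiftDiff W (torusDir j) ≤ 4 * t).card * (4 * t) ≤
        2 * d * t := by
      rw [← hW, ← smul_eq_mul]
      refine (card_nsmul_le_sum _ _ _ fun j hj => ?_).trans
        (sum_le_sum_of_subset (filter_subset _ _))
      exact (not_le.1 (mem_filter.1 hj).2).le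
    have h4 : (univ.filter fun j => ¬ shiftDiff W (torusDir j) ≤ 4 * t).card * 2 ≤ d := by
      refine Nat.le_of_mul_le_mul_right (c := 2 * t) ?_ (by positivity)
      linarith
    omega
  obtain ⟨K, hK, hKc⟩ := exists_subset_card_eq h1
  refine ⟨K, hKc, ?_⟩
  refine (sum_le_card_nsmul _ _ (4 * t) fun i hi => (mem_filter.1 (hK hi)).2).trans (le_of_eq ?_)
  rw [smul_eq_mul]; ring

end Rounding

/-- Items of size at most `3 M` and total size at most `4 M` split into three groups of size at
most `3 M`, one of which has at least a third of the weight `z`. -/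
lemma exists_third_weight {ι : Type*} [Fintype ι] [DecidableEq ι] (g z : ι → ℕ) {M : ℕ}
    (hg : ∑ i, g i ≤ 4 * M) (hi : ∀ i, g i ≤ 3 * M) :
    ∃ I : Finset ι, ∑ i ∈ I, g i ≤ 3 * M ∧ ∑ i, z i ≤ 3 * ∑ i ∈ I, z i := by
  obtain ⟨I, hI, hmax⟩ := exists_max_image (univ.filter fun I : Finset ι => ∑ i ∈ I, g i ≤ 2 * M)
    card ⟨∅, by simp⟩
  rw [mem_filter] at hI
  by_cases hU : I = univ
  · subst hU
    exact ⟨univ, by omega, by omega⟩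
  obtain ⟨j, hj⟩ : ∃ j, j ∉ I := by
    by_contra! h
    exact hU (eq_univ_of_forall h)
  have hJ : 2 * M < ∑ i ∈ insert j I, g i := by
    by_contra! h
    have := hmax _ (mem_filter.2 ⟨mem_univ _, h⟩)
    rw [card_insert_of_notMem hj] at this
    omega
  have e1 := sum_add_sum_compl (insert j I) g
  have e2 := sum_add_sum_compl (insert j I) z
  have e3 := sum_insert (f := z) hj
  by_cases h1 : ∑ i, z i ≤ 3 * ∑ i ∈ I, z i
  · exact ⟨I, by omega, h1⟩
  by_cases h2 : ∑ i, z i ≤ 3 * z j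
  · exact ⟨{j}, by simpa using hi j, by simpa using h2⟩
  · exact ⟨(insert j I)ᶜ, by omega, by omega⟩

section InitialRegion

variable {L d : ℕ} [NeZero L]

lemma two_mul_card_evenVerts (hE : Even L) (hd : 1 ≤ d) : 2 * (evenVerts L d).card = L ^ d := by
  have h1 := card_filter_comp_add (fun v : TV L d => v ∈ evenVerts L d) (torusDir ⟨0, hd⟩)
  rw [filter_univ_mem] at h1
  have h2 := card_filter_add_card_filter_not (s := (univ : Finset (TV L d)))
    (fun v => v ∈ evenVerts L d)
  have h3 : (univ.filter fun v : TV L d => ¬ v ∈ evenVerts L d).card = (evenVerts L d).card := by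
    rw [← h1]
    congr 1
    ext v
    simp [(torus_bipCayley hE).parity v _ (torusDir_mem _)]
  rw [h3, filter_univ_mem] at h2
  have hcard : Fintype.card (TV L d) = L ^ d := by simp
  rw [card_univ, hcard] at h2
  omega

lemma two_mul_card_odd (hE : Even L) (hd : 1 ≤ d) : 2 * ((evenVerts L d)ᶜ).card = L ^ d := by
  have h1 := two_mul_card_evenVerts hE hd
  have hcard : Fintype.card (TV L d) = L ^ d := by simp
  rw [card_compl, hcard]
  omega

lemma mem_evenVerts {v : TV L d} : v ∈ evenVerts L d ↔ IsEvenVtx v := by simp [evenVerts]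

open Classical in
lemma StandardEvenCutset.closedPair (hL : 2 ≤ L) {χ : TV L d → Fin 3}
    {W : Set (TV L d)} (h : StandardEvenCutset L d χ W) :
    ClosedPair (torusGen L d) (evenVerts L d) (univ.filter (· ∈ evenPart W))
      (univ.filter (· ∈ oddPart W)) := by
  obtain ⟨-, -, -, h4, h5, -⟩ := h
  refine ⟨fun x hx => ?_, fun u hu => ?_, fun x hx f hf => ?_, fun x hx hf => ?_⟩
  · exact mem_evenVerts.2 (mem_filter.1 hx).2.2
  · rw [mem_evenVerts]; exact (mem_filter.1 hu).2.2
  · have hx := (mem_filter.1 hx).2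
    rw [h5] at hx
    exact mem_filter.2 ⟨mem_univ _, hx.2 _ ((torusAdj_iff hL _ _).2 ⟨f, hf, rfl⟩)⟩
  · refine mem_filter.2 ⟨mem_univ _, ?_⟩
    rw [h5]
    refine ⟨mem_evenVerts.1 hx, fun z hz => ?_⟩
    obtain ⟨f, hfm, rfl⟩ := (torusAdj_iff hL _ _).1 hz
    exact (mem_filter.1 (hf f hfm)).2

open Classical in
lemma card_cutEdges_le_cutsetCard (hE : Even L) (hL : 2 ≤ L) (W : Set (TV L d)) :
    (cutEdges (torusGen L d) (univ.filter (· ∈ evenPart W)) (univ.filter (· ∈ oddPart W))).card ≤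
      cutsetCard L d W := by
  rw [cutsetCard, Nat.card_eq_fintype_card, Fintype.card_subtype]
  refine card_le_card_of_injOn (fun p => (p.1, p.1 + p.2)) (fun p hp => ?_) ?_
  · obtain ⟨h1, h2, h3⟩ := mem_cutEdges.1 (mem_coe.1 hp)
    simp only [mem_filter, mem_univ, true_and] at h1 h3
    refine mem_coe.2 (mem_filter.2 ⟨mem_univ _, h1.1, fun hW => h3 ⟨hW, ?_⟩,
      (torusAdj_iff hL _ _).2 ⟨_, h2, rfl⟩⟩)
    exact mem_evenVerts.1 (((torus_bipCayley hE).parity p.1 p.2 h2).2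
      (fun he => h1.2 (mem_evenVerts.1 he)))
  · rintro ⟨a, b⟩ - ⟨a', b'⟩ - hab
    simp only [Prod.mk.injEq] at hab
    obtain ⟨rfl, h⟩ := hab
    rw [add_left_cancel h]

open Classical in
lemma StandardEvenCutset.card_oddPart_le (hE : Even L) (hL : 4 ≤ L) (hd : 1 ≤ d)
    {χ : TV L d → Fin 3} {W : Set (TV L d)} (h : StandardEvenCutset L d χ W)
    (hW : 2 * Nat.card ↥W ≤ L ^ d) (hcut : cutsetCard L d W < L ^ (d - 1)) :
    8 * (univ.filter (· ∈ oddPart W)).card ≤ 3 * L ^ d := by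
  have hc := h.closedPair (by omega)
  obtain ⟨t, ht⟩ := hc.exists_surplus hd
  have h1 := hc.card_cutEdges hE (by omega) ht
  have h2 := card_cutEdges_le_cutsetCard hE (by omega) W
  have h3 : (univ.filter (· ∈ evenPart W)).card + (univ.filter (· ∈ oddPart W)).card ≤
      Nat.card ↥W := by
    have e : Nat.card ↥W = (univ.filter (· ∈ W)).card := by
      rw [Nat.card_eq_fintype_card, Fintype.card_subtype]
    rw [e, ← card_union_of_disjoint]
    · refine card_le_card fun v hv => ?_
      rcases mem_union.1 hv with hv | hv
      · exact mem_filter.2 ⟨mem_univ _, (mem_filter.1 hv).2.1⟩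
      · exact mem_filter.2 ⟨mem_univ _, (mem_filter.1 hv).2.1⟩
    · rw [disjoint_left]
      intro v hv hv'
      exact (mem_filter.1 hv').2.2 (mem_filter.1 hv).2.2
  obtain ⟨n, rfl⟩ : ∃ n, d = n + 1 := ⟨d - 1, by omega⟩
  rw [add_tsub_cancel_right] at hcut
  have h4 : 4 * L ^ n ≤ L ^ (n + 1) := by
    rw [pow_succ, mul_comm]; exact Nat.mul_le_mul_left _ hL
  have h5 : t ≤ 2 * (n + 1) * t := by nlinarith
  have h6 : 2 * t ≤ L ^ n := by nlinarith
  omega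

/-- The zero-coloured even vertices inside a suitable subfamily of the cutsets span a region of
intermediate volume whose boundary is free of zeros. -/
lemma exists_initial_region (hE : Even L) (hL : 4 ≤ L) (hd : 16 ≤ d) {χ : TV L d → Fin 3}
    (hχ : CayleyProper (torusGen L d) χ)
    (hz : L ^ d ≤ 4 * d * zeroEvenCount L d χ) {m : ℕ} {W : Fin m → Set (TV L d)}
    (hdisj : ∀ i j, i ≠ j → Disjoint (W i) (W j))
    (hW : ∀ i, StandardEvenCutset L d χ (W i) ∧ 2 * Nat.card ↥(W i) ≤ L ^ d ∧
      cutsetCard L d (W i) < L ^ (d - 1))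
    (hcov : ∀ v : TV L d, χ v = 0 → IsEvenVtx v → ∃ i, v ∈ W i) :
    ∃ A G, ClosedPair (torusGen L d) (evenVerts L d) A G ∧ ZeroFree (torusGen L d) A G χ ∧
      L ^ d ≤ 16 * d * (A ∪ G).card ∧ 4 * (A ∪ G).card ≤ 3 * L ^ d := by
  classical
  have hB : BipCayley (torusGen L d) (evenVerts L d) := torus_bipCayley hE
  have hL2 : 2 ≤ L := by omega
  set O : Fin m → Finset (TV L d) := fun i => univ.filter (· ∈ oddPart (W i)) with hO
  set Z : Fin m → Finset (TV L d) := fun i => univ.filter (fun v => χ v = 0 ∧ v ∈ evenPart (W i))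
    with hZ
  have hOdisj : ∀ i j, i ≠ j → Disjoint (O i) (O j) := fun i j hij => disjoint_left.2
    fun v hv hv' => Set.disjoint_left.1 (hdisj i j hij) (mem_filter.1 hv).2.1
      (mem_filter.1 hv').2.1
  have hZdisj : ∀ i j, i ≠ j → Disjoint (Z i) (Z j) := fun i j hij => disjoint_left.2
    fun v hv hv' => Set.disjoint_left.1 (hdisj i j hij) (mem_filter.1 hv).2.2.1
      (mem_filter.1 hv').2.2.1
  have h8 : 8 ∣ L ^ d := by
    obtain ⟨n, rfl⟩ : ∃ n, d = n + 3 := ⟨d - 3, by omega⟩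
    obtain ⟨l, rfl⟩ := hE.two_dvd
    rw [pow_add, mul_pow 2 l 3]
    exact Dvd.dvd.mul_left (Dvd.intro _ rfl) _
  obtain ⟨M, hM⟩ := h8
  have hsumO : ∑ i, (O i).card ≤ 4 * M := by
    rw [← card_biUnion fun i _ j _ hij => hOdisj i j hij]
    have : univ.biUnion O ⊆ (evenVerts L d)ᶜ := by
      intro v hv
      obtain ⟨i, -, hv⟩ := mem_biUnion.1 hv
      rw [mem_compl, mem_evenVerts]
      exact (mem_filter.1 hv).2.2
    have h1 := card_le_card this
    have h2 := two_mul_card_odd (L := L) (d := d) hE (by omega)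
    omega
  have hOi : ∀ i, (O i).card ≤ 3 * M := fun i => by
    have := (hW i).1.card_oddPart_le hE hL (by omega) (hW i).2.1 (hW i).2.2
    rw [hM] at this
    simp only [hO]
    omega
  obtain ⟨I, hI1, hI2⟩ := exists_third_weight (fun i => (O i).card) (fun i => (Z i).card) hsumO hOi
  have hzc : zeroEvenCount L d χ ≤ ∑ i, (Z i).card := by
    rw [zeroEvenCount, Nat.card_eq_fintype_card, Fintype.card_subtype]
    refine (card_le_card fun v hv => ?_).trans card_biUnion_le
    obtain ⟨h1, h2⟩ := (mem_filter.1 hv).2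
    obtain ⟨i, hi⟩ := hcov v h1 h2
    exact mem_biUnion.2 ⟨i, mem_univ _, mem_filter.2 ⟨mem_univ _, h1, hi, h2⟩⟩
  set Z₀ := I.biUnion Z with hZ₀
  have hZ₀c : Z₀.card = ∑ i ∈ I, (Z i).card := card_biUnion fun i _ j _ hij => hZdisj i j hij
  set G : Finset (TV L d) := univ.filter fun u => ∃ f ∈ torusGen L d, u + f ∈ Z₀ with hG
  set A : Finset (TV L d) := univ.filter fun x => x ∈ evenVerts L d ∧ ∀ f ∈ torusGen L d, x + f ∈ G
    with hA
  have hZe : ∀ v ∈ Z₀, v ∈ evenVerts L d := fun v hv => by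
    obtain ⟨i, -, hv⟩ := mem_biUnion.1 hv
    exact mem_evenVerts.2 (mem_filter.1 hv).2.2.2
  have hZA : Z₀ ⊆ A := fun v hv => mem_filter.2 ⟨mem_univ _, hZe v hv, fun f hf =>
    mem_filter.2 ⟨mem_univ _, -f, hB.neg_mem f hf, by rwa [add_neg_cancel_right]⟩⟩
  have hZ0 : ∀ v ∈ Z₀, χ v = 0 := fun v hv => by
    obtain ⟨i, -, hv⟩ := mem_biUnion.1 hv
    exact (mem_filter.1 hv).2.1
  have hGO : ∀ u ∈ G, ∃ i ∈ I, u ∈ O i := fun u hu => by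
    obtain ⟨f, hf, hv⟩ := (mem_filter.1 hu).2
    obtain ⟨i, hi, hv⟩ := mem_biUnion.1 hv
    refine ⟨i, hi, ?_⟩
    have := ((hW i).1.closedPair hL2).nb (u + f) (mem_filter.2 ⟨mem_univ _, (mem_filter.1 hv).2.2⟩)
      (-f) (hB.neg_mem f hf)
    rwa [add_neg_cancel_right] at this
  have hGe : ∀ u ∈ G, u ∉ evenVerts L d := fun u hu => by
    obtain ⟨i, -, hu⟩ := hGO u hu
    rw [mem_evenVerts]
    exact (mem_filter.1 hu).2.2
  have hc : ClosedPair (torusGen L d) (evenVerts L d) A G :=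
    ⟨fun x hx => (mem_filter.1 hx).2.1, hGe, fun x hx => (mem_filter.1 hx).2.2,
      fun x hx hf => mem_filter.2 ⟨mem_univ _, hx, hf⟩⟩
  have hAG : Disjoint A G := disjoint_left.2 fun v hv hv' => hc.odd v hv' (hc.even v hv)
  obtain ⟨t, ht⟩ := hc.exists_surplus (by omega)
  have hGc : G.card ≤ 3 * M := by
    refine le_trans ((card_le_card fun u hu => ?_).trans card_biUnion_le) hI1
    obtain ⟨i, hi, hu⟩ := hGO u hu
    exact mem_biUnion.2 ⟨i, hi, hu⟩
  have hZc := card_le_card hZA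
  refine ⟨A, G, hc, ⟨fun u hu f hf huf => ?_, fun u hu f hf huf h0 => ?_, fun u hu f hf huf => ?_⟩,
    ?_, ?_⟩
  · obtain ⟨g, hg, hv⟩ := (mem_filter.1 hu).2
    have := hχ u g hg
    rwa [hZ0 _ hv] at this
  · obtain ⟨i, hi, huO⟩ := hGO u hu
    have huO := (mem_filter.1 huO).2
    have hev : IsEvenVtx (u + f) := mem_evenVerts.1 ((hB.parity u f hf).2 (hGe u hu))
    by_cases hWi : u + f ∈ W i
    · exact huf (hZA (mem_biUnion.2 ⟨i, hi, mem_filter.2 ⟨mem_univ _, h0, hWi, hev⟩⟩))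
    · refine (hW i).1.2.2.1 (u + f) (Or.inr ⟨hWi, u, huO.1, ?_⟩) h0
      exact (torusAdj_iff hL2 _ _).2 ⟨-f, hB.neg_mem f hf, by abel⟩
  · obtain ⟨g, hg, hv⟩ := (mem_filter.1 hu).2
    exact ⟨g, hg, hZA hv, hZ0 _ hv⟩
  · rw [card_union_of_disjoint hAG]
    have h1 : zeroEvenCount L d χ ≤ 3 * A.card := by omega
    have h2 : 4 * d * zeroEvenCount L d χ ≤ 4 * d * (3 * A.card) := Nat.mul_le_mul_left _ h1
    have h3 : 4 * d * (3 * A.card) ≤ 16 * d * (A.card + G.card) := by nlinarith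
    omega
  · rw [card_union_of_disjoint hAG]
    omega

end InitialRegion

section Thicken

variable {V : Type*} [AddCommGroup V] [DecidableEq V] {Γ E : Finset V}

/-- The vertices at distance at most `n` from `Q`. -/
def thicken (Γ : Finset V) (n : ℕ) (Q : Finset V) : Finset V :=
  Q.biUnion fun q => (cayleyBall Γ n).image (q + ·)

lemma mem_thicken {n : ℕ} {Q : Finset V} {w : V} :
    w ∈ thicken Γ n Q ↔ ∃ q ∈ Q, w - q ∈ cayleyBall Γ n := by
  simp only [thicken, mem_biUnion, mem_image]
  refine exists_congr fun q => and_congr_right fun _ => ⟨?_, fun h => ⟨_, h, by abel⟩⟩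
  rintro ⟨b, hb, rfl⟩
  rwa [add_sub_cancel_left]

lemma card_thicken_le (n : ℕ) (Q : Finset V) :
    (thicken Γ n Q).card ≤ Q.card * (Γ.card + 1) ^ n := by
  refine card_biUnion_le.trans ?_
  rw [← smul_eq_mul]
  exact sum_le_card_nsmul _ _ _ fun q _ => card_image_le.trans (card_cayleyBall_le n)

lemma thicken_mono {m n : ℕ} (h : m ≤ n) (Q : Finset V) : thicken Γ m Q ⊆ thicken Γ n Q := by
  intro w hw
  obtain ⟨q, hq, h1⟩ := mem_thicken.1 hw
  exact mem_thicken.2 ⟨q, hq, cayleyBall_mono h h1⟩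

lemma mem_thicken_of_add_mem (hB : BipCayley Γ E) {m n k : ℕ} {Q : Finset V} {w c : V}
    (hc : c ∈ cayleyBall Γ m) (h : w + c ∈ thicken Γ n Q) (hk : n + m ≤ k) :
    w ∈ thicken Γ k Q := by
  obtain ⟨q, hq, h1⟩ := mem_thicken.1 h
  refine thicken_mono hk Q (mem_thicken.2 ⟨q, hq, ?_⟩)
  have : w - q = (w + c - q) + -c := by abel
  rw [this]
  exact add_mem_cayleyBall h1 (hB.neg_mem_cayleyBall hc)

end Thicken

section CutData

variable {L d : ℕ} [NeZero L]

lemma sum_torusDir_mem_cayleyBall (T : Finset (Fin d)) :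
    ∑ i ∈ T, torusDir i ∈ cayleyBall (torusGen L d) T.card := by
  induction T using Finset.induction_on with
  | empty => simpa using zero_mem_cayleyBall 0
  | insert a T ha ih =>
    rw [sum_insert ha, card_insert_of_notMem ha, add_comm (torusDir a)]
    exact add_mem_cayleyBall ih (mem_cayleyBall_one (torusDir_mem a))

lemma roundDown_sub_mem_cayleyBall (hE : Even L) (K : Finset (Fin d)) (y : TV L d) :
    roundDown K y - y ∈ cayleyBall (torusGen L d) K.card := by
  have h := roundDown_add_sum (K := K) y
  have e : roundDown K y - y =
      -∑ i ∈ K.filter (fun i => (y i : ℕ) % 2 = 1), torusDir i := by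
    nth_rewrite 2 [← h]
    abel
  rw [e]
  exact (torus_bipCayley hE).neg_mem_cayleyBall
    (cayleyBall_mono (card_le_card (filter_subset _ _)) (sum_torusDir_mem_cayleyBall _))

lemma coarseDir_mem_cayleyBall (K : Finset (Fin d)) (j : Fin d) :
    coarseDir K j ∈ cayleyBall (torusGen L d) 2 := by
  have h1 : torusDir j ∈ cayleyBall (torusGen L d) 1 := 
    mem_cayleyBall_one (torusDir_mem j)
  rw [coarseDir]
  split_ifs
  · rw [two_nsmul]; exact add_mem_cayleyBall h1 h1
  · rw [one_nsmul]; exact cayleyBall_mono (by norm_num) h1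

/-- The rough guess for the even part of a region obtained from its coarsening. -/
def coarseEven (K : Finset (Fin d)) (τ : TV L d) (W : Finset (TV L d)) : Finset (TV L d) :=
  evenVerts L d ∩ coarsen K τ W

/-- The exploration neighbourhoods of the boundary net. -/
def netNbhd (L d : ℕ) [NeZero L] (v : TV L d) : Finset (TV L d) :=
  (cayleyBall (torusGen L d) 18).image (v + ·)

/-- A region with boundary free of zeros, together with the data from which an approximation of the
region can be reconstructed. -/
structure CutData (s t : ℕ) (χ : TV L d → Fin 3) (A G R Q : Finset (TV L d)) (K : Finset (Fin d))
    (τ : TV L d) (M : Fin 6 → Finset (TV L d)) : Prop where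
  closed : ClosedPair (torusGen L d) (evenVerts L d) A G
  zeroFree : ZeroFree (torusGen L d) A G χ
  surplus : G.card = A.card + t
  large : L ^ d ≤ 160 * d ^ 2 * L * t
  roots : (R.card : ℝ) * Real.log (d * (L : ℝ) ^ d / t) ≤ 92 * t / s ^ 2
  card_roots : R.card * d ≤ 2 * t
  card_net : Q.card * d ≤ 2 * t
  disjoint : Disjoint Q R
  linked : LinkedFrom (netNbhd L d) R Q
  net : innerBdry (torusGen L d) A G ⊆ thicken (torusGen L d) 8 (R ∪ Q)
  near : ∀ i, M i ⊆ thicken (torusGen L d) (s + 12) (R ∪ Q)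
  card_near : ∀ i, (M i).card * s ^ 3 ≤ 18 * t
  coarse_in : M 0 = coarseBdry K τ (A ∪ G) ∩ (A ∪ G)
  coarse_out : M 1 = coarseBdry K τ (A ∪ G) \ (A ∪ G)
  approx : ApproxPair (torusGen L d) A G
    (approxOdd (torusGen L d) (evenVerts L d) (coarseEven K τ (A ∪ G)) (M 2) (M 3) (M 4) (M 5)
      (s ^ 4))
    (approxEven (torusGen L d) (evenVerts L d) (coarseEven K τ (A ∪ G)) (M 2) (M 3) (M 4) (M 5)
      (s ^ 4)) (s ^ 4)
  gap : G \ approxOdd (torusGen L d) (evenVerts L d) (coarseEven K τ (A ∪ G)) (M 2) (M 3) (M 4)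
    (M 5) (s ^ 4) ⊆ innerBdry (torusGen L d) A G
  excess : s * (approxEven (torusGen L d) (evenVerts L d) (coarseEven K τ (A ∪ G)) (M 2) (M 3)
    (M 4) (M 5) (s ^ 4)).card ≤ s * (approxOdd (torusGen L d) (evenVerts L d)
      (coarseEven K τ (A ∪ G)) (M 2) (M 3) (M 4) (M 5) (s ^ 4)).card + 2 * t

/-- A set of roots for clusters of size `m` is cheap to describe. -/
lemma card_roots_mul_log_le {r m t p : ℕ} {x a c : ℝ} (hm : 0 < m) (ht : 0 < t) (ha : 0 < a)
    (ham : a ^ 2 ≤ m) (hx : 0 < x) (hr : (r : ℝ) * m ≤ c * t) (hxm : x ≤ (m : ℝ) ^ p * t) :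
    (r : ℝ) * Real.log (x / t) ≤ 2 * p * (c * t) / a := by
  have ht' : (0 : ℝ) < t := by exact_mod_cast ht
  have hm' : (0 : ℝ) < m := by exact_mod_cast hm
  have h1 : Real.log (x / t) ≤ p * (2 * √m) := by
    have e1 : x / t ≤ (m : ℝ) ^ p := by rw [div_le_iff₀ ht']; exact hxm
    have e2 := Real.log_le_log (by positivity) e1
    rw [Real.log_pow] at e2
    refine e2.trans (mul_le_mul_of_nonneg_left ?_ (by positivity))
    have e3 := Real.log_le_sub_one_of_pos (Real.sqrt_pos.2 hm')
    rw [Real.log_sqrt hm'.le] at e3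
    linarith
  have h2 : a ≤ √m := Real.le_sqrt_of_sq_le ham
  have h3 : (r : ℝ) * √m * a ≤ c * t := by
    refine le_trans ?_ hr
    rw [mul_assoc]
    refine mul_le_mul_of_nonneg_left ?_ (by positivity)
    calc √(m : ℝ) * a ≤ √m * √m := mul_le_mul_of_nonneg_left h2 (by positivity)
      _ = m := Real.mul_self_sqrt hm'.le
  rw [le_div_iff₀ ha]
  calc (r : ℝ) * Real.log (x / t) * a ≤ r * (p * (2 * √m)) * a := by gcongr
    _ = 2 * p * (r * √m * a) := by ring
    _ ≤ 2 * p * (c * t) := by gcongr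

lemma roots_bound_of_volume {r d t N s : ℕ} (hs : 1 ≤ s) (hd : s ^ 5 ≤ d) (hd2 : 2 ≤ d)
    (ht : 0 < t) (hN : 0 < N) (hr : r * (2 * d) ≤ 4 * t) (h : N ≤ d ^ 20 * (2 * d * t)) :
    (r : ℝ) * Real.log (d * (N : ℝ) / t) ≤ 92 * t / s ^ 2 := by
  have hs' : (1 : ℝ) ≤ s := by exact_mod_cast hs
  have h1 := card_roots_mul_log_le (r := r) (m := d) (t := t) (p := 23) (x := d * (N : ℝ))
    (a := (s : ℝ) ^ 2) (c := 2) (by omega) ht (by positivity) ?_ (by positivity) ?_ ?_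
  · refine h1.trans (le_of_eq ?_)
    push_cast; ring
  · have : s ^ 4 ≤ d := le_trans (Nat.pow_le_pow_right hs (by norm_num)) hd
    calc ((s : ℝ) ^ 2) ^ 2 = ((s ^ 4 : ℕ) : ℝ) := by push_cast; ring
      _ ≤ d := by exact_mod_cast this
  · have : r * d ≤ 2 * t := by linarith
    exact_mod_cast this
  · have h2 : d * N ≤ d ^ 23 * t := by
      calc d * N ≤ d * (d ^ 20 * (2 * d * t)) := Nat.mul_le_mul_left _ h
        _ = 2 * (d ^ 22 * t) := by ring
        _ ≤ d * (d ^ 22 * t) := Nat.mul_le_mul_right _ hd2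
        _ = d ^ 23 * t := by ring
    exact_mod_cast h2

lemma roots_bound_of_clumps {r d m t N s : ℕ} (hs : 1 ≤ s) (hd : s ^ 5 ≤ d) (hd2 : 2 ≤ d)
    (ht : 0 < t) (hN : 0 < N) (hm : d ^ 3 ≤ m) (hr : r * m ≤ 2 * d * t)
    (h : N ≤ m ^ 4 * (2 * d * t)) :
    (r : ℝ) * Real.log (d * (N : ℝ) / t) ≤ 92 * t / s ^ 2 := by
  have hs' : (1 : ℝ) ≤ s := by exact_mod_cast hs
  have hd' : (0 : ℝ) < d := by exact_mod_cast (by omega : 0 < d)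
  have hm0 : 0 < m := lt_of_lt_of_le (by positivity) hm
  have h1 := card_roots_mul_log_le (r := r) (m := m) (t := t) (p := 5) (x := d * (N : ℝ))
    (a := d * (s : ℝ) ^ 2) (c := 2 * d) hm0 ht (by positivity) ?_ (by positivity) ?_ ?_
  · refine h1.trans ?_
    have : 2 * ((5 : ℕ) : ℝ) * (2 * d * t) / (d * (s : ℝ) ^ 2) = 20 * t / s ^ 2 := by
      push_cast; field_simp; norm_num
    rw [this]
    gcongr
    norm_num
  · have h3 : s ^ 4 ≤ d := le_trans (Nat.pow_le_pow_right hs (by norm_num)) hd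
    have h4 : d ^ 2 * s ^ 4 ≤ m := le_trans (by nlinarith [Nat.mul_le_mul_left (d ^ 2) h3]) hm
    calc (d * (s : ℝ) ^ 2) ^ 2 = ((d ^ 2 * s ^ 4 : ℕ) : ℝ) := by push_cast; ring
      _ ≤ m := by exact_mod_cast h4
  · exact_mod_cast hr
  · have h3 : 2 * d ^ 2 ≤ m := le_trans (by nlinarith [Nat.mul_le_mul_left (d ^ 2) hd2]) hm
    have h2 : d * N ≤ m ^ 5 * t := by
      calc d * N ≤ d * (m ^ 4 * (2 * d * t)) := Nat.mul_le_mul_left _ h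
        _ = (2 * d ^ 2) * (m ^ 4 * t) := by ring
        _ ≤ m * (m ^ 4 * t) := Nat.mul_le_mul_right _ h3
        _ = m ^ 5 * t := by ring
    exact_mod_cast h2

set_option maxHeartbeats 800000 in
/-- A region as found by `ClosedPair.exists_scale` admits the data of `CutData`. -/
theorem exists_cutData (hE : Even L) (hL : 4 ≤ L) {s : ℕ} (hs : 2 ≤ s) (hs2 : d * s ^ 3 ≤ 2 ^ s)
    (hd : s ^ 5 ≤ d) (hd1 : 100 ≤ d) {χ : TV L d → Fin 3} {A₀ G₀ : Finset (TV L d)}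
    (hc₀ : ClosedPair (torusGen L d) (evenVerts L d) A₀ G₀)
    (hz₀ : ZeroFree (torusGen L d) A₀ G₀ χ)
    (hlow : L ^ d ≤ 16 * d * (A₀ ∪ G₀).card) (hhigh : 4 * (A₀ ∪ G₀).card ≤ 3 * L ^ d) :
    ∃ t A G R Q K τ M, 0 < t ∧ t ≤ L ^ d ∧ CutData s t χ A G R Q K τ M := by
  obtain ⟨A, G, hc, hsub, hcut, hscale⟩ := hc₀.exists_scale hE hL hd1 hlow hhigh
  have hz := hsub.zeroFree hz₀
  have hB : BipCayley (torusGen L d) (evenVerts L d) := torus_bipCayley hE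
  have hL3 : 3 ≤ L := by omega
  obtain ⟨t, ht⟩ := hc.exists_surplus (by omega)
  rw [hc.card_cutEdges hE hL3 ht] at hcut hscale
  have hN : 0 < L ^ d := by positivity
  have ht0 : 0 < t := by
    rcases Nat.eq_zero_or_pos t with rfl | h
    · simp at hcut; omega
    · exact h
  have hcard : Fintype.card (TV L d) = L ^ d := by simp
  have htN : t ≤ L ^ d := by
    have := card_le_univ G
    rw [hcard] at this
    omega
  have hΓ := card_torusGen (L := L) (d := d) hL3
  have htouch : ∀ u ∈ innerBdry (torusGen L d) A G, ∃ f ∈ torusGen L d, u + f ∈ A := by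
    intro u hu
    obtain ⟨hu, f, hf, huf⟩ := mem_innerBdry.1 hu
    obtain ⟨g, hg, hgA, -⟩ := hz.touch u hu f hf huf
    exact ⟨g, hg, hgA⟩
  obtain ⟨Q₀, hQ₀, hQ₀c, hnet⟩ := hc.exists_net hB htouch ht (card_pos.1 (by omega))
  rw [hΓ] at hQ₀c
  obtain ⟨R, hRQ, hRlog, hRlink⟩ : ∃ R ⊆ Q₀,
      (R.card : ℝ) * Real.log (d * (L : ℝ) ^ d / t) ≤ 92 * t / s ^ 2 ∧
      LinkedFrom (netNbhd L d) R (Q₀ \ R) := by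
    rcases hscale with h | ⟨m, hm, hclump, h⟩
    · refine ⟨Q₀, subset_rfl, ?_, ?_⟩
      · have := roots_bound_of_volume (by omega) hd (by omega) ht0 hN hQ₀c h
        rwa [Nat.cast_pow] at this
      · intro U hU hne
        rw [sdiff_self, bot_eq_empty, subset_empty] at hU
        exact absurd hU hne.ne_empty
    · obtain ⟨R, hR, h1, h2⟩ := hc.exists_roots hB ht hQ₀ hnet hclump
      rw [hΓ] at h1
      refine ⟨R, hR, ?_, h2⟩
      have := roots_bound_of_clumps (by omega) hd (by omega) ht0 hN hm h1 h
      rwa [Nat.cast_pow] at this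
  have hRQ' : R ∪ Q₀ \ R = Q₀ := union_sdiff_of_subset hRQ
  have hnet8 : innerBdry (torusGen L d) A G ⊆ thicken (torusGen L d) 8 Q₀ :=
    fun u hu => mem_thicken.2 (hnet u hu)
  have hdir := hc.sum_shiftDiff_torusDir hE hL3 ht
  have hs5 : s ^ 4 * s ≤ d := by rw [← pow_succ]; exact hd
  have hs3 : 2 * s ≤ d := by
    have : s * 2 ≤ s * s ^ 4 := Nat.mul_le_mul_left _ (le_trans hs (Nat.le_self_pow (by norm_num) s))
    linarith
  obtain ⟨K, hK, hKs⟩ := exists_quiet_directions hs3 ht0 hdir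
  obtain ⟨τ, hτ1, hτ2⟩ := exists_translate hE ht0 (by omega) (by omega : 0 < K.card) hKs hdir
  rw [hK] at hτ1 hτ2
  set W := A ∪ G with hW
  set S := coarseEven K τ W with hS
  have hAW : A \ S ⊆ univ.filter fun x => ¬ (x ∈ W ↔ x ∈ coarsen K τ W) := by
    intro x hx
    obtain ⟨h1, h2⟩ := mem_sdiff.1 hx
    refine mem_filter.2 ⟨mem_univ _, fun h => h2 (mem_inter.2 ⟨hc.even x h1, h.1 ?_⟩)⟩
    exact mem_union_left _ h1
  have hSW : S \ A ⊆ univ.filter fun x => ¬ (x ∈ W ↔ x ∈ coarsen K τ W) := by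
    intro x hx
    obtain ⟨h1, h2⟩ := mem_sdiff.1 hx
    obtain ⟨h3, h4⟩ := mem_inter.1 h1
    refine mem_filter.2 ⟨mem_univ _, fun h => ?_⟩
    rcases mem_union.1 (h.2 h4) with h5 | h5
    · exact h2 h5
    · exact hc.odd x h5 h3
  have hdis : ∀ x ∈ univ.filter (fun x => ¬ (x ∈ W ↔ x ∈ coarsen K τ W)),
      x ∈ thicken (torusGen L d) (s + 8) Q₀ := by
    intro x hx
    have hx := (mem_filter.1 hx).2
    have ha := roundDown_sub_mem_cayleyBall hE K (x + τ)
    obtain ⟨b, hb, hxb⟩ := hc.exists_innerBdry_of_disagree hB (x := x) ha (by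
      have e : x + (roundDown K (x + τ) - (x + τ)) = roundDown K (x + τ) - τ := by abel
      rw [e]
      intro h
      exact hx (h.trans (by simp only [coarsen, mem_filter, mem_univ, true_and, hW])))
    exact mem_thicken_of_add_mem hB hb (hnet8 hxb) (by omega)
  have hψ : 2 * s ^ 4 < (torusGen L d).card := by
    rw [hΓ]
    have : s ^ 4 * 2 ≤ s ^ 4 * s := Nat.mul_le_mul_left _ hs
    have : 0 < s ^ 4 := by positivity
    omega
  obtain ⟨M₁, M₂, M₃, M₄, c1, c2, c3, c4, l1, l2, l3, l4, happ, hgap, hex⟩ :=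
    hc.exists_approx hB ht hψ S ((card_le_card hAW).trans hτ1) ((card_le_card hSW).trans hτ1)
  have one {f : TV L d} (hf : f ∈ torusGen L d) : f ∈ cayleyBall (torusGen L d) 1 :=
    mem_cayleyBall_one hf
  have hR1 : R.card ≤ Q₀.card := card_le_card hRQ
  have hQ1 : (Q₀ \ R).card ≤ Q₀.card := card_le_card sdiff_subset
  have hbdry : coarseBdry K τ W ⊆ thicken (torusGen L d) 10 Q₀ := by
    intro c hcc
    obtain ⟨-, j, hj⟩ := (mem_filter.1 hcc).2
    rcases hj with hj | hj
    · obtain ⟨b, hb, hcb⟩ := hc.exists_innerBdry_of_disagree hB (coarseDir_mem_cayleyBall K j) hj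
      exact mem_thicken_of_add_mem hB hb (hnet8 hcb) (by omega)
    · obtain ⟨b, hb, hcb⟩ := hc.exists_innerBdry_of_disagree hB
        (hB.neg_mem_cayleyBall (coarseDir_mem_cayleyBall K j)) hj
      exact mem_thicken_of_add_mem hB hb (hnet8 hcb) (by omega)
  have hbc : (coarseBdry K τ W).card * s ^ 3 ≤ 18 * t := by
    refine Nat.le_of_mul_le_mul_left (c := d) ?_ (by omega)
    calc d * ((coarseBdry K τ W).card * s ^ 3) = d * s ^ 3 * (coarseBdry K τ W).card := by ring
      _ ≤ 2 ^ s * (coarseBdry K τ W).card := Nat.mul_le_mul_right _ hs2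
      _ ≤ 16 * d * t := hτ2
      _ = d * (16 * t) := by ring
      _ ≤ d * (18 * t) := Nat.mul_le_mul_left _ (by omega)
  have hs34 : ∀ c : ℕ, c * s ^ 4 ≤ 18 * (s * t) → c * s ^ 3 ≤ 18 * t := by
    intro c h
    refine Nat.le_of_mul_le_mul_left (c := s) ?_ (by omega)
    calc s * (c * s ^ 3) = c * s ^ 4 := by ring
      _ ≤ 18 * (s * t) := h
      _ = s * (18 * t) := by ring
  have hst : t ≤ s * t := Nat.le_mul_of_pos_left _ (by omega)
  refine ⟨t, A, G, R, Q₀ \ R, K, τ, ![coarseBdry K τ W ∩ W, coarseBdry K τ W \ W, M₁, M₂, M₃, M₄],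
    ht0, htN, hc, hz, ht, ?_, hRlog, ?_, ?_, sdiff_disjoint, hRlink, ?_, ?_, ?_, rfl, rfl, ?_, ?_, ?_⟩
  · calc L ^ d ≤ 80 * d * L * (2 * d * t) := hcut
      _ = 160 * d ^ 2 * L * t := by ring
  · have := Nat.mul_le_mul_right d hR1
    linarith
  · have := Nat.mul_le_mul_right d hQ1
    linarith
  · rw [hRQ']; exact hnet8
  · rw [hRQ']
    intro i
    fin_cases i
    · exact inter_subset_left.trans (hbdry.trans (thicken_mono (by omega) _))
    · exact sdiff_subset.trans (hbdry.trans (thicken_mono (by omega) _))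
    · intro w hw
      obtain ⟨f, hf, h⟩ := l1 w hw
      exact mem_thicken_of_add_mem hB (one hf) (hdis _ (hSW h)) (by omega)
    · intro w hw
      obtain ⟨f, hf, h | ⟨g, hg, h⟩⟩ := l2 w hw
      · exact mem_thicken_of_add_mem hB (one hf) (hnet8 h) (by omega)
      · rw [add_assoc] at h
        exact mem_thicken_of_add_mem hB (add_mem_cayleyBall (one hf) (one hg)) (hdis _ (hAW h))
          (by omega)
    · intro w hw
      obtain ⟨f, hf, g, hg, h⟩ := l3 w hw
      rw [add_assoc] at h
      exact mem_thicken_of_add_mem hB (add_mem_cayleyBall (one hf) (one hg)) (hnet8 h) (by omega)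
    · intro w hw
      obtain ⟨f, hf, h⟩ := l4 w hw
      exact mem_thicken_of_add_mem hB (one hf) (hnet8 h) (by omega)
  · intro i
    fin_cases i
    · exact (Nat.mul_le_mul_right _ (card_le_card inter_subset_left)).trans hbc
    · exact (Nat.mul_le_mul_right _ (card_le_card sdiff_subset)).trans hbc
    · exact hs34 _ (c1.trans (by linarith))
    · exact hs34 _ (c2.trans (by linarith))
    · exact hs34 _ (c3.trans (by linarith))
    · exact hs34 _ (c4.trans (by linarith))
  · exact happ
  · exact hgap
  · rw [hΓ] at hex
    refine Nat.le_of_mul_le_mul_left (c := 2 * d) ?_ (by omega)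
    have h1 := Nat.mul_le_mul_left s hex
    have h2 : s * (4 * s ^ 4 * t) ≤ 2 * d * (2 * t) := by
      have := Nat.mul_le_mul_right (4 * t) hs5
      linarith
    refine le_trans (le_of_eq ?_) (h1.trans ?_)
    · simp only [Matrix.cons_val]; ring
    · rw [mul_add s, mul_add (2 * d)]
      refine add_le_add (le_of_eq ?_) h2
      simp only [Matrix.cons_val]; ring

end CutData

section Leaves

variable {L d : ℕ} [NeZero L] {s t : ℕ} {R Q : Finset (TV L d)} {K : Finset (Fin d)}
  {τ : TV L d} {M : Fin 6 → Finset (TV L d)}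

lemma ClosedPair.even_eq {V : Type*} [AddCommGroup V] {Γ E A A' G : Finset V}
    (h : ClosedPair Γ E A G) (h' : ClosedPair Γ E A' G) : A = A' := by
  ext x
  exact ⟨fun hx => h'.closed x (h.even x hx) (h.nb x hx),
    fun hx => h.closed x (h'.even x hx) (h'.nb x hx)⟩

/-- The odd part of the approximation described by the data. -/
def codeOdd (s : ℕ) (K : Finset (Fin d)) (τ : TV L d) (M : Fin 6 → Finset (TV L d))
    (W : Finset (TV L d)) : Finset (TV L d) :=
  approxOdd (torusGen L d) (evenVerts L d) (coarseEven K τ W) (M 2) (M 3) (M 4) (M 5) (s ^ 4)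

/-- The even part of the approximation described by the data. -/
def codeEven (s : ℕ) (K : Finset (Fin d)) (τ : TV L d) (M : Fin 6 → Finset (TV L d))
    (W : Finset (TV L d)) : Finset (TV L d) :=
  approxEven (torusGen L d) (evenVerts L d) (coarseEven K τ W) (M 2) (M 3) (M 4) (M 5) (s ^ 4)

/-- The data determine the coarsening of the region. -/
lemma CutData.coarseEven_eq (hE : Even L) {χ χ' : TV L d → Fin 3} {A G A' G' : Finset (TV L d)}
    (h : CutData s t χ A G R Q K τ M) (h' : CutData s t χ' A' G' R Q K τ M)
    (hb : -τ ∈ A ∪ G ↔ -τ ∈ A' ∪ G') : coarseEven K τ (A ∪ G) = coarseEven K τ (A' ∪ G') := by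
  rw [coarseEven, coarseEven, coarsen_eq_of_coarseBdry hE hb (h.coarse_in.symm.trans h'.coarse_in)
    (h.coarse_out.symm.trans h'.coarse_out)]

open Classical in
/-- The number of proper colourings. -/
noncomputable def numProper (L d : ℕ) [NeZero L] : ℕ :=
  (univ.filter fun χ : TV L d → Fin 3 => CayleyProper (torusGen L d) χ).card

open Classical in
/-- Few colourings share the same data when the odd part of the approximation is far from full. -/
lemma card_of_large_gap (hE : Even L) (hL : 3 ≤ L) (hs : 0 < s) (hψ : s ^ 4 < d) (b : Prop)
    (C : Finset (TV L d → Fin 3)) (hC : ∀ χ ∈ C, CayleyProper (torusGen L d) χ ∧ ∃ A G,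
      CutData s t χ A G R Q K τ M ∧ (b ↔ -τ ∈ A ∪ G) ∧
        6 * t < s * (G \ codeOdd s K τ M (A ∪ G)).card) :
    C.card * 2 ^ (4 * t / s) ≤ numProper L d := by
  rcases C.eq_empty_or_nonempty with rfl | ⟨χ₀, hχ₀⟩
  · simp
  choose! hp A G hdata hb hgap using hC
  have hce : ∀ χ ∈ C, coarseEven K τ (A χ ∪ G χ) = coarseEven K τ (A χ₀ ∪ G χ₀) := fun χ hχ =>
    (hdata χ hχ).coarseEven_eq hE (hdata χ₀ hχ₀) ((hb χ hχ).symm.trans (hb χ₀ hχ₀))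
  refine card_mul_two_pow_le_of_approx (E := evenVerts L d)
    (F := codeOdd s K τ M (A χ₀ ∪ G χ₀)) (S := codeEven s K τ M (A χ₀ ∪ G χ₀))
    (ψ := s ^ 4) (torus_bipCayley hE)
    (by rw [card_torusGen hL]; omega) C A G _ hp
    (fun χ hχ => (hdata χ hχ).closed) (fun χ hχ => (hdata χ hχ).zeroFree) (fun χ hχ => ?_)
    (fun χ hχ => ?_)
  · rw [codeOdd, codeEven, ← hce χ hχ]
    exact (hdata χ hχ).approx
  · have h1 := (hdata χ hχ).excess
    have h2 := hgap χ hχ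
    have h3 := (hdata χ hχ).approx.sub_odd
    rw [codeOdd] at h2
    rw [codeEven, ← hce χ hχ]
    set F := approxOdd (torusGen L d) (evenVerts L d) (coarseEven K τ (A χ ∪ G χ)) (M 2) (M 3)
      (M 4) (M 5) (s ^ 4)
    have h4 : (G χ \ F).card + F.card = (G χ).card := card_sdiff_add_card_eq_card h3
    have h5 := Nat.mul_div_le (4 * t) s
    refine Nat.le_of_mul_le_mul_left (c := s) ?_ hs
    rw [← h4]
    linarith

open Classical in
/-- Few colourings share the same data when the missing odd vertices are recorded as well. -/
lemma card_of_recorded_gap (hE : Even L) (hL : 3 ≤ L) (hd : 0 < d) (b : Prop)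
    (D : Finset (TV L d)) (C : Finset (TV L d → Fin 3))
    (hC : ∀ χ ∈ C, CayleyProper (torusGen L d) χ ∧ ∃ A G,
      CutData s t χ A G R Q K τ M ∧ (b ↔ -τ ∈ A ∪ G) ∧ G \ codeOdd s K τ M (A ∪ G) = D) :
    C.card * 2 ^ t ≤ numProper L d := by
  rcases C.eq_empty_or_nonempty with rfl | ⟨χ₀, hχ₀⟩
  · simp
  choose! hp A G hdata hb hgap using hC
  have hG : ∀ χ ∈ C, G χ = codeOdd s K τ M (A χ₀ ∪ G χ₀) ∪ D := fun χ hχ => by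
    have hce := (hdata χ hχ).coarseEven_eq hE (hdata χ₀ hχ₀) ((hb χ hχ).symm.trans (hb χ₀ hχ₀))
    have h1 := hgap χ hχ
    rw [codeOdd] at h1
    rw [codeOdd, ← hce, ← h1]
    exact (union_sdiff_of_subset (hdata χ hχ).approx.sub_odd).symm
  have hA : ∀ χ ∈ C, A χ = A χ₀ := fun χ hχ => by
    have h1 := (hdata χ hχ).closed
    rw [hG χ hχ, ← hG χ₀ hχ₀] at h1
    exact h1.even_eq (hdata χ₀ hχ₀).closed
  refine card_mul_two_pow_le_of_approx (E := evenVerts L d) (F := G χ₀) (S := A χ₀) (ψ := 0)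
    (torus_bipCayley hE) (by rw [card_torusGen hL]; omega) C A G _ hp
    (fun χ hχ => (hdata χ hχ).closed) (fun χ hχ => (hdata χ hχ).zeroFree) (fun χ hχ => ?_)
    (fun χ hχ => ?_)
  · rw [hA χ hχ, hG χ hχ, ← hG χ₀ hχ₀]
    refine ⟨fun u hu => hu, fun x hx => hx, fun x hx => ?_, fun u hu hu' => absurd hu hu'⟩
    rw [filter_false_of_mem fun f hf => not_not.2 ((hdata χ₀ hχ₀).closed.nb x hx f hf)]
    simp
  · rw [← hA χ hχ]
    exact (hdata χ hχ).surplus.ge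

end Leaves

section Counting

lemma card_le_mul_of_cover {α β : Type*} [DecidableEq α] (C : Finset α) (I : Finset β)
    (P : β → α → Prop) [∀ i, DecidablePred (P i)] {B : ℝ} (hcov : ∀ a ∈ C, ∃ i ∈ I, P i a)
    (hB : ∀ i ∈ I, ((C.filter (P i)).card : ℝ) ≤ B) : (C.card : ℝ) ≤ I.card * B := by
  have h1 : C ⊆ I.biUnion fun i => C.filter (P i) := fun a ha => by
    obtain ⟨i, hi, h⟩ := hcov a ha
    exact mem_biUnion.2 ⟨i, hi, mem_filter.2 ⟨ha, h⟩⟩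
  have h2 : (C.card : ℝ) ≤ ∑ i ∈ I, ((C.filter (P i)).card : ℝ) := by
    exact_mod_cast (card_le_card h1).trans card_biUnion_le
  refine h2.trans ((sum_le_card_nsmul _ _ _ hB).trans (le_of_eq (nsmul_eq_mul _ _)))

variable {L d : ℕ} [NeZero L]

/-- The number of small sets near a given set. -/
lemma card_near_le (hL : 3 ≤ L) (n : ℕ) (Y : Finset (TV L d)) {y β : ℝ} (hy : (Y.card : ℝ) ≤ y)
    (hβ : 0 ≤ β) :
    (((thicken (torusGen L d) n Y).powerset.filter fun M => M.card ≤ ⌊β⌋₊).card : ℝ) ≤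
      Real.exp (y + β * (n * Real.log (2 * d + 1))) := by
  have hD : (1 : ℝ) ≤ 2 * d + 1 := by linarith [(Nat.cast_nonneg d : (0 : ℝ) ≤ d)]
  have hD0 : (0 : ℝ) < 2 * d + 1 := by linarith
  have h1 := card_powerset_filter_le (thicken (torusGen L d) n Y) (x := ((2 * (d : ℝ) + 1) ^ n)⁻¹)
    (by positivity) (inv_le_one_of_one_le₀ (one_le_pow₀ hD)) ⌊β⌋₊
  refine h1.trans ?_
  rw [Real.exp_add]
  refine mul_le_mul (Real.exp_le_exp.2 ?_) ?_ (by positivity) (by positivity)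
  · refine le_trans ?_ hy
    rw [inv_mul_le_iff₀ (by positivity)]
    have h2 := card_thicken_le (Γ := torusGen L d) n Y
    rw [card_torusGen hL] at h2
    rw [mul_comm]
    exact_mod_cast h2
  · rw [inv_inv, ← pow_mul, ← Real.rpow_natCast, Real.rpow_def_of_pos hD0]
    refine Real.exp_le_exp.2 ?_
    have h3 := Nat.floor_le hβ
    have h4 : 0 ≤ Real.log (2 * d + 1) := Real.log_nonneg hD
    push_cast
    calc Real.log (2 * d + 1) * (n * (⌊β⌋₊ : ℝ)) = (⌊β⌋₊ : ℝ) * (n * Real.log (2 * d + 1)) := by ring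
      _ ≤ β * (n * Real.log (2 * d + 1)) := by gcongr

/-- The number of admissible sets of roots. -/
lemma card_roots_le {t N : ℕ} (ht : 0 < t) (htN : t ≤ N) (hd : 2 ≤ d) {β : ℝ} (hβ : 0 ≤ β)
    (X : Finset (TV L d)) (hX : X.card ≤ N) :
    ((X.powerset.filter fun R => (R.card : ℝ) * Real.log (d * (N : ℝ) / t) ≤ β).card : ℝ) ≤
      Real.exp (t / d + β) := by
  have ht' : (0 : ℝ) < t := by exact_mod_cast ht
  have hN' : (t : ℝ) ≤ N := by exact_mod_cast htN
  have hN0 : (0 : ℝ) < N := ht'.trans_le hN'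
  have hd' : (2 : ℝ) ≤ d := by exact_mod_cast hd
  have hx1 : 1 < d * (N : ℝ) / t := by
    rw [one_lt_div ht']; nlinarith
  set ℓ := Real.log (d * (N : ℝ) / t) with hℓ
  have hℓ0 : 0 < ℓ := Real.log_pos hx1
  have h1 := card_powerset_filter_le X (x := (d * (N : ℝ) / t)⁻¹) (by positivity)
    (inv_le_one_of_one_le₀ hx1.le) ⌊β / ℓ⌋₊
  have h2 : (X.powerset.filter fun R => (R.card : ℝ) * ℓ ≤ β) ⊆
      X.powerset.filter fun R => R.card ≤ ⌊β / ℓ⌋₊ := by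
    intro R hR
    obtain ⟨hR1, hR2⟩ := mem_filter.1 hR
    exact mem_filter.2 ⟨hR1, Nat.le_floor ((le_div_iff₀ hℓ0).2 hR2)⟩
  refine (Nat.cast_le.2 (card_le_card h2)).trans (h1.trans ?_)
  rw [Real.exp_add]
  refine mul_le_mul (Real.exp_le_exp.2 ?_) ?_ (by positivity) (by positivity)
  · rw [inv_div]
    have : (X.card : ℝ) ≤ N := by exact_mod_cast hX
    calc (t : ℝ) / (d * N) * X.card ≤ t / (d * N) * N := by gcongr
      _ = t / d := by field_simp
  · rw [inv_inv, ← Real.rpow_natCast, Real.rpow_def_of_pos (by linarith)]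
    refine Real.exp_le_exp.2 ?_
    have h3 := Nat.floor_le (div_nonneg hβ hℓ0.le)
    rw [← hℓ, mul_comm]
    exact (le_div_iff₀ hℓ0).1 h3

open Classical in
/-- The number of nets explored from a given set of roots. -/
lemma card_nets_le {t : ℕ} (hL : 3 ≤ L) (hd : 1 ≤ d) (R : Finset (TV L d)) (hR : R.card * d ≤ 2 * t) :
    ((univ.filter fun Q : Finset (TV L d) => Q.card ≤ 2 * t / d ∧ Disjoint Q R ∧
      LinkedFrom (netNbhd L d) R Q).card : ℝ) ≤
      Real.exp (42 * Real.log (2 * d + 1) * t / d) := by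
  have hd' : (1 : ℝ) ≤ d := by exact_mod_cast hd
  have hN : ∀ v, (netNbhd L d v).card ≤ (2 * d + 1) ^ 18 := fun v => by
    refine card_image_le.trans ?_
    have := card_cayleyBall_le (Γ := torusGen L d) 18
    rwa [card_torusGen hL] at this
  refine (card_linkedFrom_le (netNbhd L d) hN (by positivity) R (2 * t / d)).trans ?_
  set ℓ := Real.log (2 * d + 1) with hℓ
  have h2ℓ : Real.log 2 ≤ ℓ := Real.log_le_log (by norm_num) (by linarith)
  have h20 : 0 < Real.log 2 := Real.log_pos (by norm_num)
  have e1 : (2 : ℝ) ^ R.card = Real.exp (R.card * Real.log 2) := by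
    rw [Real.exp_nat_mul, Real.exp_log (by norm_num)]
  have e2 : (4 * (((2 * d + 1) ^ 18 : ℕ) : ℝ)) = Real.exp (2 * Real.log 2 + 18 * ℓ) := by
    rw [Real.exp_add, hℓ]
    have a1 : Real.exp (2 * Real.log 2) = 4 := by
      have := Real.exp_nat_mul (Real.log 2) 2
      rw [Real.exp_log (by norm_num)] at this
      push_cast at this
      rw [this]; norm_num
    have a2 : Real.exp (18 * Real.log (2 * d + 1)) = (2 * d + 1) ^ 18 := by
      have := Real.exp_nat_mul (Real.log (2 * d + 1)) 18
      rw [Real.exp_log (by positivity)] at this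
      exact_mod_cast this
    rw [a1, a2]; push_cast; ring
  rw [e1, e2, ← Real.exp_nat_mul, ← Real.exp_add]
  refine Real.exp_le_exp.2 ?_
  have b1 : (R.card : ℝ) ≤ 2 * t / d := by
    rw [le_div_iff₀ (by linarith)]; exact_mod_cast hR
  have b2 : ((2 * t / d : ℕ) : ℝ) ≤ 2 * t / d := by
    refine Nat.cast_div_le.trans (le_of_eq (by push_cast; ring))
  have hℓ0 : 0 ≤ 2 * Real.log 2 + 18 * ℓ := by linarith
  calc (R.card : ℝ) * Real.log 2 + ((2 * t / d : ℕ) : ℝ) * (2 * Real.log 2 + 18 * ℓ)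
      ≤ 2 * t / d * ℓ + 2 * t / d * (2 * ℓ + 18 * ℓ) := by gcongr
    _ = 42 * ℓ * t / d := by ring

end Counting

section Assembly

variable {L d : ℕ} [NeZero L] {s t : ℕ}

open Classical in
/-- Counting colourings by the data describing a region of theirs. -/
lemma card_le_of_cutData (hL : 3 ≤ L) (hs : 0 < s) (hd : 2 ≤ d) (ht : 0 < t) (htN : t ≤ L ^ d)
    (X : Finset (TV L d) → Finset (TV L d) → Finset (Fin d) → TV L d →
      (Fin 6 → Finset (TV L d)) → Prop)
    (C : Finset (TV L d → Fin 3)) (hC : ∀ χ ∈ C, ∃ A G R Q K τ M, CutData s t χ A G R Q K τ M ∧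
      X A G K τ M) {B : ℝ} (hB : 0 ≤ B)
    (hleaf : ∀ R Q K τ M, ((R ∪ Q).card : ℝ) ≤ 4 * t / d → ∀ C' : Finset (TV L d → Fin 3),
      C' ⊆ C → (∀ χ ∈ C', ∃ A G, CutData s t χ A G R Q K τ M ∧ X A G K τ M) →
      (C'.card : ℝ) ≤ B) :
    (C.card : ℝ) ≤ Real.exp (t / d + 92 * t / s ^ 2) * (Real.exp (42 * Real.log (2 * d + 1) * t / d)
      * (2 ^ d * (L : ℝ) ^ d * (Real.exp (4 * t / d + 18 * t / s ^ 3 *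
        ((s + 12 : ℕ) * Real.log (2 * d + 1))) ^ 6 * B))) := by
  have hd0 : (0 : ℝ) < d := by exact_mod_cast (by omega : 0 < d)
  have hs0 : (0 : ℝ) < s := by exact_mod_cast hs
  have hRoots := card_roots_le (L := L) (d := d) (β := 92 * t / (s : ℝ) ^ 2) ht htN hd
    (by positivity) univ (by simp [TV])
  refine (card_le_mul_of_cover C ((univ.powerset.filter fun R : Finset (TV L d) =>
    (R.card : ℝ) * Real.log (d * ((L ^ d : ℕ) : ℝ) / t) ≤ 92 * t / (s : ℝ) ^ 2).filter
      fun R => R.card * d ≤ 2 * t) (fun R χ => ∃ A G Q K τ M, CutData s t χ A G R Q K τ M ∧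
      X A G K τ M) (fun χ hχ => ?_) (fun R hR => ?_)).trans
    (mul_le_mul_of_nonneg_right ((Nat.cast_le.2 (card_filter_le _ _)).trans hRoots) ?_)
  · obtain ⟨A, G, R, Q, K, τ, M, h, hX⟩ := hC χ hχ
    refine ⟨R, mem_filter.2 ⟨mem_filter.2 ⟨by simp, ?_⟩, h.card_roots⟩, A, G, Q, K, τ, M, h, hX⟩
    have := h.roots
    push_cast
    exact this
  rotate_left
  · positivity
  have hRc := (mem_filter.1 hR).2
  refine (card_le_mul_of_cover _ (univ.filter fun Q : Finset (TV L d) => Q.card ≤ 2 * t / d ∧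
      Disjoint Q R ∧ LinkedFrom (netNbhd L d) R Q) (fun Q χ => ∃ A G K τ M,
      CutData s t χ A G R Q K τ M ∧ X A G K τ M) (fun χ hχ => ?_) (fun Q hQ => ?_)).trans
    (mul_le_mul_of_nonneg_right (card_nets_le hL (by omega) R hRc) ?_)
  · obtain ⟨A, G, Q, K, τ, M, h, hX⟩ := (mem_filter.1 hχ).2
    exact ⟨Q, mem_filter.2 ⟨mem_univ _, (Nat.le_div_iff_mul_le (by omega)).2 h.card_net,
      h.disjoint, h.linked⟩, A, G, K, τ, M, h, hX⟩
  rotate_left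
  · positivity
  have hQc : Q.card * d ≤ 2 * t :=
    (Nat.le_div_iff_mul_le (by omega)).1 (mem_filter.1 hQ).2.1
  have hRQ : ((R ∪ Q).card : ℝ) ≤ 4 * t / d := by
    rw [le_div_iff₀ hd0]
    have h1 := card_union_le R Q
    have h2 : (R ∪ Q).card * d ≤ 4 * t := by nlinarith
    exact_mod_cast h2
  have hI : ((univ : Finset (Finset (Fin d) × TV L d)).card : ℝ) = 2 ^ d * (L : ℝ) ^ d := by
    simp [TV]
  rw [← hI]
  refine card_le_mul_of_cover _ univ (fun (k : Finset (Fin d) × TV L d) χ => ∃ A G M,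
      CutData s t χ A G R Q k.1 k.2 M ∧ X A G k.1 k.2 M) (fun χ hχ => ?_) (fun k _ => ?_)
  · obtain ⟨A, G, K, τ, M, h, hX⟩ := (mem_filter.1 hχ).2
    exact ⟨(K, τ), mem_univ _, A, G, M, h, hX⟩
  have hβ : (0 : ℝ) ≤ 18 * t / (s : ℝ) ^ 3 := by positivity
  have hnear := card_near_le hL (s + 12) (R ∪ Q) hRQ hβ
  refine (card_le_mul_of_cover _ (Fintype.piFinset fun _ : Fin 6 =>
      (thicken (torusGen L d) (s + 12) (R ∪ Q)).powerset.filter fun M =>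
        M.card ≤ ⌊18 * t / (s : ℝ) ^ 3⌋₊) (fun M χ => ∃ A G,
      CutData s t χ A G R Q k.1 k.2 M ∧ X A G k.1 k.2 M) (fun χ hχ => ?_) (fun M _ => ?_)).trans
    (mul_le_mul_of_nonneg_right ?_ hB)
  · obtain ⟨A, G, M, h, hX⟩ := (mem_filter.1 hχ).2
    refine ⟨M, Fintype.mem_piFinset.2 fun i => mem_filter.2 ⟨mem_powerset.2 (h.near i),
      Nat.le_floor ?_⟩, A, G, h, hX⟩
    rw [le_div_iff₀ (by positivity)]
    exact_mod_cast h.card_near i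
  · refine hleaf R Q k.1 k.2 M hRQ _ (fun χ hχ => ?_) (fun χ hχ => (mem_filter.1 hχ).2)
    exact (mem_filter.1 (mem_filter.1 (mem_filter.1 (mem_filter.1 hχ).1).1).1).1
  · rw [Fintype.card_piFinset_const, Nat.cast_pow]
    exact pow_le_pow_left₀ (by positivity) hnear 6

open Classical in
/-- The number of colourings with a region of given surplus. -/
lemma card_cutData_le (hE : Even L) (hL : 3 ≤ L) (hs : 0 < s) (hψ : s ^ 4 < d) (hd : 2 ≤ d)
    (ht : 0 < t) (htN : t ≤ L ^ d) (C : Finset (TV L d → Fin 3))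
    (hC : ∀ χ ∈ C, CayleyProper (torusGen L d) χ ∧
      ∃ A G R Q K τ M, CutData s t χ A G R Q K τ M) :
    (C.card : ℝ) ≤ Real.exp (t / d + 92 * t / s ^ 2) * (Real.exp (42 * Real.log (2 * d + 1) * t / d)
      * (2 ^ d * (L : ℝ) ^ d * (Real.exp (4 * t / d + 18 * t / s ^ 3 *
        ((s + 12 : ℕ) * Real.log (2 * d + 1))) ^ 6 * (2 * (numProper L d / 2 ^ (4 * t / s) +
          Real.exp (4 * t / d + 6 * t / s * ((8 : ℕ) * Real.log (2 * d + 1))) *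
            (numProper L d / 2 ^ t)))))) := by
  have hd0 : (0 : ℝ) < d := by exact_mod_cast (by omega : 0 < d)
  have hs0 : (0 : ℝ) < s := by exact_mod_cast hs
  refine card_le_of_cutData hL hs hd ht htN (fun _ _ _ _ _ => True) C (fun χ hχ => ?_)
    (by positivity) (fun R Q K τ M hRQ C' hC' hdata => ?_)
  · obtain ⟨A, G, R, Q, K, τ, M, h⟩ := (hC χ hχ).2
    exact ⟨A, G, R, Q, K, τ, M, h, trivial⟩
  have h2 : ((univ : Finset Bool).card : ℝ) = 2 := by simp
  rw [← h2]
  refine card_le_mul_of_cover C' univ (fun b χ => ∃ A G, CutData s t χ A G R Q K τ M ∧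
    (b = true ↔ -τ ∈ A ∪ G)) (fun χ hχ => ?_) (fun b _ => ?_)
  · obtain ⟨A, G, h, -⟩ := hdata χ hχ
    exact ⟨decide (-τ ∈ A ∪ G), mem_univ _, A, G, h, by simp⟩
  set Cb := C'.filter fun χ => ∃ A G, CutData s t χ A G R Q K τ M ∧ (b = true ↔ -τ ∈ A ∪ G)
  have hCb : ∀ χ ∈ Cb, CayleyProper (torusGen L d) χ := fun χ hχ =>
    (hC χ (hC' (mem_filter.1 hχ).1)).1
  set P : (TV L d → Fin 3) → Prop := fun χ => ∃ A G, CutData s t χ A G R Q K τ M ∧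
    (b = true ↔ -τ ∈ A ∪ G) ∧ 6 * t < s * (G \ codeOdd s K τ M (A ∪ G)).card
  rw [← card_filter_add_card_filter_not (s := Cb) P, Nat.cast_add]
  refine add_le_add ?_ ?_
  · rw [le_div_iff₀ (by positivity)]
    exact_mod_cast card_of_large_gap hE hL hs hψ (b = true) _ fun χ hχ =>
      ⟨hCb χ (mem_filter.1 hχ).1, (mem_filter.1 hχ).2⟩
  · have hβ : (0 : ℝ) ≤ 6 * t / (s : ℝ) := by positivity
    refine (card_le_mul_of_cover _ ((thicken (torusGen L d) 8 (R ∪ Q)).powerset.filter fun D =>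
        D.card ≤ ⌊6 * t / (s : ℝ)⌋₊) (fun D χ => ∃ A G, CutData s t χ A G R Q K τ M ∧
        (b = true ↔ -τ ∈ A ∪ G) ∧ G \ codeOdd s K τ M (A ∪ G) = D) (fun χ hχ => ?_)
        (fun D _ => ?_)).trans (mul_le_mul_of_nonneg_right (card_near_le hL 8 _ hRQ hβ)
          (by positivity : (0 : ℝ) ≤ numProper L d / 2 ^ t))
    · obtain ⟨h1, h3⟩ := mem_filter.1 hχ
      obtain ⟨A, G, h, hb⟩ := (mem_filter.1 h1).2
      refine ⟨_, mem_filter.2 ⟨mem_powerset.2 (h.gap.trans h.net), Nat.le_floor ?_⟩, A, G, h, hb,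
        rfl⟩
      rw [le_div_iff₀ hs0, mul_comm]
      exact_mod_cast not_lt.1 fun h4 => h3 ⟨A, G, h, hb, h4⟩
    · rw [le_div_iff₀ (by positivity)]
      exact_mod_cast card_of_recorded_gap hE hL (by omega) (b = true) D _ fun χ hχ =>
        ⟨hCb χ (mem_filter.1 (mem_filter.1 hχ).1).1, (mem_filter.1 hχ).2⟩

end Assembly

section Numerics

/-- The scale `s` is about the fifth root of the dimension. -/
lemma exists_fifth_root {S d : ℕ} (hd : S ^ 5 ≤ d) :
    ∃ s, S ≤ s ∧ s ^ 5 ≤ d ∧ d < (s + 1) ^ 5 := by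
  have hSd : S ≤ d := (Nat.le_self_pow (by norm_num) S).trans hd
  refine ⟨Nat.findGreatest (fun s => s ^ 5 ≤ d) d, Nat.le_findGreatest hSd hd,
    Nat.findGreatest_spec (P := fun s => s ^ 5 ≤ d) hSd hd, ?_⟩
  by_contra h
  push Not at h
  have h1 := Nat.le_findGreatest (P := fun s => s ^ 5 ≤ d)
    ((Nat.le_self_pow (by norm_num) _).trans h) h
  omega

lemma exists_log_le_nat : ∃ S : ℕ, 1000 ≤ S ∧ ∀ s : ℕ, S ≤ s → Real.log s ≤ s / 10000 := by
  have h := (Real.isLittleO_log_id_atTop.comp_tendsto tendsto_natCast_atTop_atTop).bound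
    (c := 1 / 10000) (by norm_num)
  obtain ⟨S, hS⟩ := Filter.eventually_atTop.1 h
  refine ⟨max S 1000, le_max_right _ _, fun s hs => ?_⟩
  have h1 := hS s ((le_max_left _ _).trans hs)
  simp only [Function.comp, id, Real.norm_eq_abs, Nat.abs_cast] at h1
  linarith [le_abs_self (Real.log s)]

/-- Bounds on the scale in terms of its logarithm. -/
lemma scale_bounds {s d : ℕ} (hs : 1000 ≤ s) (hlog : Real.log s ≤ s / 10000)
    (hds : d < (s + 1) ^ 5) :
    d * s ^ 3 ≤ 2 ^ s ∧ Real.log (2 * d + 1) ≤ 6 * s / 10000 := by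
  have hs' : (1000 : ℝ) ≤ s := by exact_mod_cast hs
  have hd32 : (d : ℝ) ≤ 32 * s ^ 5 := by
    have h1 : (d : ℝ) ≤ (s + 1) ^ 5 := by exact_mod_cast hds.le
    have h2 : ((s : ℝ) + 1) ^ 5 ≤ (2 * s) ^ 5 := by gcongr; linarith
    nlinarith
  have hs5 : (0 : ℝ) < (s : ℝ) ^ 5 := by positivity
  have hd0 : (0 : ℝ) ≤ d := Nat.cast_nonneg d
  have hs51 : (1 : ℝ) ≤ (s : ℝ) ^ 5 := one_le_pow₀ (by linarith)
  constructor
  · have h1 : (d : ℝ) * s ^ 3 ≤ (s : ℝ) ^ 9 := by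
      calc (d : ℝ) * s ^ 3 ≤ 32 * s ^ 5 * s ^ 3 := by gcongr
        _ = 32 * (s : ℝ) ^ 8 := by ring
        _ ≤ s * (s : ℝ) ^ 8 := by gcongr; linarith
        _ = (s : ℝ) ^ 9 := by ring
    have h2 : (s : ℝ) ^ 9 ≤ 2 ^ s := by
      rw [← Real.log_le_log_iff (by positivity) (by positivity), Real.log_pow, Real.log_pow]
      have := Real.log_two_gt_d9
      push_cast
      nlinarith
    exact_mod_cast h1.trans h2
  · have h1 : 2 * (d : ℝ) + 1 ≤ (s : ℝ) ^ 6 := by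
      calc 2 * (d : ℝ) + 1 ≤ 65 * s ^ 5 := by linarith
        _ ≤ s * s ^ 5 := by gcongr; linarith
        _ = (s : ℝ) ^ 6 := by ring
    have h2 := Real.log_le_log (by positivity) h1
    rw [Real.log_pow] at h2
    push_cast at h2
    linarith

/-- The cost of the data is small compared with the gain. -/
lemma data_cost_le {s d ℓ t : ℝ} (hs : 1000 ≤ s) (hℓ0 : 0 ≤ ℓ) (hℓ : ℓ ≤ 6 * s / 10000)
    (hsd : s ^ 5 ≤ d) (ht : 0 ≤ t) :
    (t / d + 92 * t / s ^ 2) + 42 * ℓ * t / d + 6 * (4 * t / d + 18 * t / s ^ 3 * ((s + 12) * ℓ)) ≤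
      9 / 10 * t / s ∧ 4 * t / d + 6 * t / s * (8 * ℓ) ≤ 3 / 10 * t := by
  have hs0 : 0 < s := by linarith
  have hs4 : (1000 : ℝ) ^ 4 ≤ s ^ 4 := by gcongr
  have hds : 1000 ^ 4 * s ≤ d := by
    refine le_trans ?_ hsd
    calc 1000 ^ 4 * s ≤ s ^ 4 * s := by gcongr
      _ = s ^ 5 := by ring
  have hd0 : 0 < d := by nlinarith
  have e1 : t / d ≤ t / s / 1000 ^ 4 := by
    rw [div_div, mul_comm]
    gcongr
  have e2 : 92 * t / s ^ 2 ≤ 92 / 1000 * (t / s) := by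
    rw [show 92 * t / s ^ 2 = 92 * (t / s) / s by field_simp, div_le_iff₀ hs0]
    have : 0 ≤ t / s := by positivity
    nlinarith
  have e3 : 42 * ℓ * t / d ≤ 1 / 1000 * (t / s) := by
    have : 42 * ℓ / d ≤ 1 / 1000 / s := by
      rw [div_le_div_iff₀ hd0 hs0]
      have h2 : 1000 ^ 3 * s * s ≤ d := by
        refine le_trans ?_ hsd
        calc (1000 : ℝ) ^ 3 * s * s ≤ s ^ 3 * s * s := by gcongr
          _ = s ^ 5 := by ring
      nlinarith
    calc 42 * ℓ * t / d = 42 * ℓ / d * t := by ring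
      _ ≤ 1 / 1000 / s * t := by gcongr
      _ = 1 / 1000 * (t / s) := by ring
  have e4 : 18 * t / s ^ 3 * ((s + 12) * ℓ) ≤ 12 / 1000 * (t / s) := by
    calc 18 * t / s ^ 3 * ((s + 12) * ℓ)
        ≤ 18 * t / s ^ 3 * ((s + 12 / 1000 * s) * (6 * s / 10000)) := by gcongr; linarith
      _ = 18 * (1012 / 1000) * 6 / 10000 * (t / s) := by field_simp; ring
      _ ≤ 12 / 1000 * (t / s) := mul_le_mul_of_nonneg_right (by norm_num) (by positivity)
  have e5 : 6 * t / s * (8 * ℓ) ≤ 288 / 10000 * t := by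
    calc 6 * t / s * (8 * ℓ) ≤ 6 * t / s * (8 * (6 * s / 10000)) := by gcongr
      _ = 288 / 10000 * t := by field_simp; ring
  have e6 : t / s ≤ t := div_le_self ht (by linarith)
  have e7 : 0 ≤ t / s := by positivity
  have e8 : 4 * t / d = 4 * (t / d) := by ring
  rw [e8, show 9 / 10 * t / s = 9 / 10 * (t / s) by ring]
  constructor <;> linarith

lemma card_proper_factor_le {s t : ℕ} (hs : 1000 ≤ s) {T c c' : ℝ} (hT : 0 ≤ T)
    (hc : c ≤ 9 / 10 * t / s) (hc' : c' ≤ 3 / 10 * t) :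
    Real.exp c * (T / 2 ^ (4 * t / s) + Real.exp c' * (T / 2 ^ t)) ≤
      2 * T * Real.exp (1 - t / s) := by
  have hs' : (1000 : ℝ) ≤ s := by exact_mod_cast hs
  have hlog := Real.log_two_gt_d9
  have hlog' := Real.log_two_lt_d9
  have ht0 : (0 : ℝ) ≤ t := Nat.cast_nonneg t
  have hpow (n : ℕ) : T / 2 ^ n = T * Real.exp (-(n * Real.log 2)) := by
    rw [Real.exp_neg, Real.exp_nat_mul, Real.exp_log (by norm_num), div_eq_mul_inv]
  have hts : (0 : ℝ) ≤ t / s := by positivity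
  have hts' : (t : ℝ) / s ≤ t / 1000 := by gcongr
  have hfl : 4 * (t : ℝ) / s - 1 ≤ ((4 * t / s : ℕ) : ℝ) := by
    have h1 := Nat.lt_succ_floor ((4 * t : ℕ) / (s : ℝ))
    rw [Nat.floor_div_eq_div] at h1
    push_cast at h1 ⊢
    linarith
  rw [hpow, hpow]
  have e1 : Real.exp c * (T * Real.exp (-(((4 * t / s : ℕ) : ℝ) * Real.log 2))) ≤
      T * Real.exp (1 - t / s) := by
    rw [mul_left_comm, ← Real.exp_add]
    gcongr
    have : (4 * (t : ℝ) / s - 1) * Real.log 2 ≤ ((4 * t / s : ℕ) : ℝ) * Real.log 2 := by gcongr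
    have h3 : 4 * (t : ℝ) / s = 4 * (t / s) := by ring
    have h4 : 9 / 10 * (t : ℝ) / s = 9 / 10 * (t / s) := by ring
    rw [h3] at this
    rw [h4] at hc
    nlinarith
  have e2 : Real.exp c * (Real.exp c' * (T * Real.exp (-((t : ℝ) * Real.log 2)))) ≤
      T * Real.exp (1 - t / s) := by
    rw [mul_left_comm _ T, mul_left_comm _ T, ← Real.exp_add, ← Real.exp_add]
    gcongr
    have h4 : 9 / 10 * (t : ℝ) / s = 9 / 10 * (t / s) := by ring
    rw [h4] at hc
    nlinarith
  rw [mul_add]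
  linarith

lemma mul_pow_four_le {d : ℕ} (hd : 20 ≤ d) : 960 * d ^ 4 ≤ 4 ^ (d - 2) := by
  induction d, hd using Nat.le_induction with
  | base => norm_num
  | succ n hn ih =>
    rw [show n + 1 - 2 = (n - 2) + 1 by omega, pow_succ 4]
    have h1 : (n + 1) ^ 4 ≤ 4 * n ^ 4 := by
      calc (n + 1) ^ 4 = ((n + 1) ^ 2) ^ 2 := by ring
        _ ≤ (2 * n ^ 2) ^ 2 := by gcongr; nlinarith
        _ = 4 * n ^ 4 := by ring
    omega

/-- The sum over all surpluses is dominated by the exponential gain. -/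
lemma total_le {d L s : ℕ} (hL : 4 ≤ L) (hd : 1280 ≤ d) (hs : 0 < s) (hsd : s ≤ d) :
    (L : ℝ) ^ d * (2 ^ d * (L : ℝ) ^ d * (4 * Real.exp (1 - (L : ℝ) ^ (d - 1) / (160 * d ^ 2 * s))))
      ≤ Real.exp (-4 * (L : ℝ) ^ (d - 1) / ((d : ℝ) ^ 4 * (Real.log L) ^ 2)) := by
  have hL' : (4 : ℝ) ≤ L := by exact_mod_cast hL
  have hd' : (1280 : ℝ) ≤ d := by exact_mod_cast hd
  have hs' : (0 : ℝ) < s := by exact_mod_cast hs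
  have hsd' : (s : ℝ) ≤ d := by exact_mod_cast hsd
  have hL0 : (0 : ℝ) < L := by linarith
  have hd0 : (0 : ℝ) < d := by linarith
  have hlog2 := Real.log_two_gt_d9
  have hlog2' := Real.log_two_lt_d9
  have h4 : Real.log 4 = 2 * Real.log 2 := by
    rw [show (4 : ℝ) = 2 ^ 2 by norm_num, Real.log_pow]; norm_num
  have hlogL : 1 ≤ Real.log L := by
    have := Real.log_le_log (by norm_num) hL'
    linarith
  have hlogL' : Real.log L ≤ L := (Real.log_le_sub_one_of_pos hL0).trans (by linarith)
  set P : ℝ := (L : ℝ) ^ (d - 1) with hP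
  have hP0 : 0 < P := by positivity
  have hPbig : 960 * (d : ℝ) ^ 4 * L ≤ P := by
    have h1 : 960 * (d : ℝ) ^ 4 ≤ 4 ^ (d - 2) := by exact_mod_cast mul_pow_four_le (by omega)
    have h2 : (4 : ℝ) ^ (d - 2) ≤ (L : ℝ) ^ (d - 2) := by gcongr
    rw [hP, show d - 1 = (d - 2) + 1 by omega, pow_succ]
    exact mul_le_mul_of_nonneg_right (h1.trans h2) hL0.le
  have eN : (L : ℝ) ^ d = Real.exp (d * Real.log L) := by
    rw [Real.exp_nat_mul, Real.exp_log hL0]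
  have e2 : (2 : ℝ) ^ d = Real.exp (d * Real.log 2) := by
    rw [Real.exp_nat_mul, Real.exp_log (by norm_num)]
  have e4 : (4 : ℝ) = Real.exp (Real.log 4) := (Real.exp_log (by norm_num)).symm
  rw [eN, e2]
  conv_lhs => rw [e4]
  simp only [← Real.exp_add]
  refine Real.exp_le_exp.2 ?_
  have a1 : P / (160 * d ^ 3) ≤ P / (160 * d ^ 2 * s) := by
    refine div_le_div_of_nonneg_left hP0.le (by positivity) ?_
    calc 160 * (d : ℝ) ^ 2 * s ≤ 160 * (d : ℝ) ^ 2 * d := by gcongr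
      _ = 160 * (d : ℝ) ^ 3 := by ring
  have a2 : 4 * P / ((d : ℝ) ^ 4 * Real.log L ^ 2) ≤ P / (320 * d ^ 3) := by
    rw [div_le_div_iff₀ (by positivity) (by positivity)]
    have h1 : (1 : ℝ) ≤ Real.log L ^ 2 := one_le_pow₀ hlogL
    have h2 : 1280 * (d : ℝ) ^ 3 ≤ d ^ 4 * Real.log L ^ 2 := by
      calc 1280 * (d : ℝ) ^ 3 ≤ d * (d : ℝ) ^ 3 := by gcongr
        _ = (d : ℝ) ^ 4 * 1 := by ring
        _ ≤ d ^ 4 * Real.log L ^ 2 := by gcongr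
    nlinarith
  have a3 : 3 * d * L ≤ P / (320 * d ^ 3) := by
    rw [le_div_iff₀ (by positivity)]
    nlinarith
  have a4 : P / (160 * d ^ 3) = 2 * (P / (320 * d ^ 3)) := by field_simp; ring
  have a5 : -4 * P / ((d : ℝ) ^ 4 * Real.log L ^ 2) = -(4 * P / ((d : ℝ) ^ 4 * Real.log L ^ 2)) := by
    ring
  have a6 : (d : ℝ) * Real.log L ≤ d * L := by gcongr
  have a7 : (d : ℝ) * Real.log 2 + 4 ≤ d * L := by nlinarith
  rw [a5]
  linarith

end Numerics

section Conclusion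

variable {L d : ℕ} [NeZero L]

lemma properColoring_iff (hL : 2 ≤ L) (χ : TV L d → Fin 3) :
    ProperColoring L d χ ↔ CayleyProper (torusGen L d) χ := by
  constructor
  · intro h x f hf
    exact h x _ ((torusAdj_iff hL x _).2 ⟨f, hf, rfl⟩)
  · intro h x y hxy
    obtain ⟨f, hf, rfl⟩ := (torusAdj_iff hL x y).1 hxy
    exact h x f hf

open Classical in
lemma pi3_eq (hL : 2 ≤ L) (P : (TV L d → Fin 3) → Prop) :
    pi3 L d P = ((univ.filter fun χ => CayleyProper (torusGen L d) χ ∧ P χ).card : ℝ) /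
      numProper L d := by
  rw [pi3, numProper, Nat.card_eq_fintype_card, Nat.card_eq_fintype_card, Fintype.card_subtype,
    Fintype.card_subtype]
  simp only [properColoring_iff hL]

lemma card_cutData_le_of_scale (hE : Even L) (hL : 4 ≤ L) {s t : ℕ} (hs : 1000 ≤ s)
    (hsd : s ^ 5 ≤ d) (hℓ : Real.log (2 * d + 1) ≤ 6 * s / 10000)
    (ht : 0 < t) (htN : t ≤ L ^ d) (htL : L ^ d ≤ 160 * d ^ 2 * L * t)
    (C : Finset (TV L d → Fin 3))
    (hC : ∀ χ ∈ C, CayleyProper (torusGen L d) χ ∧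
      ∃ A G R Q K τ M, CutData s t χ A G R Q K τ M) :
    (C.card : ℝ) ≤ 2 ^ d * (L : ℝ) ^ d *
      (4 * Real.exp (1 - (L : ℝ) ^ (d - 1) / (160 * d ^ 2 * s))) * numProper L d := by
  have hsd' : s ≤ d := (Nat.le_self_pow (by norm_num) s).trans hsd
  have hψ : s ^ 4 < d := lt_of_lt_of_le (Nat.pow_lt_pow_right (by omega) (by norm_num)) hsd
  have hs0 : (0 : ℝ) < s := by exact_mod_cast (by omega : 0 < s)
  have hd0 : (0 : ℝ) < d := by exact_mod_cast (by omega : 0 < d)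
  have hL0 : (0 : ℝ) < L := by exact_mod_cast (by omega : 0 < L)
  refine (card_cutData_le hE (by omega) (by omega) hψ (by omega) ht htN C hC).trans ?_
  obtain ⟨hc, hc'⟩ := data_cost_le (s := s) (d := d) (ℓ := Real.log (2 * d + 1)) (t := t)
    (by exact_mod_cast hs) (Real.log_nonneg (by linarith)) hℓ (by exact_mod_cast hsd)
    (Nat.cast_nonneg t)
  have h1 := card_proper_factor_le hs (Nat.cast_nonneg (numProper L d)) hc hc'
  have h2 : (L : ℝ) ^ (d - 1) / (160 * d ^ 2 * s) ≤ t / s := by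
    rw [div_le_div_iff₀ (by positivity) hs0]
    have h3 : (L : ℝ) ^ (d - 1) * L ≤ 160 * d ^ 2 * t * L := by
      rw [← pow_succ, show d - 1 + 1 = d by omega]
      have h4 : (L : ℝ) ^ d ≤ 160 * d ^ 2 * L * t := by exact_mod_cast htL
      linarith
    have h5 := le_of_mul_le_mul_right h3 hL0
    calc (L : ℝ) ^ (d - 1) * s ≤ 160 * d ^ 2 * t * s := by gcongr
      _ = t * (160 * d ^ 2 * s) := by ring
  have h3 : Real.exp (1 - (t : ℝ) / s) ≤
      Real.exp (1 - (L : ℝ) ^ (d - 1) / (160 * d ^ 2 * s)) := Real.exp_le_exp.2 (by linarith)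
  have h4 := h1.trans (mul_le_mul_of_nonneg_left h3 (by positivity))
  have h5 := mul_le_mul_of_nonneg_left h4 (by positivity : (0 : ℝ) ≤ 2 ^ d * (L : ℝ) ^ d * 2)
  refine le_trans (le_of_eq ?_) (h5.trans (le_of_eq (by ring)))
  have hexp (a b c : ℝ) : Real.exp (a + b + 6 * c) = Real.exp a * Real.exp b * Real.exp c ^ 6 := by
    rw [Real.exp_add, Real.exp_add, ← Real.exp_nat_mul]
    norm_num
  rw [hexp]
  push_cast
  ring

open Classical in
lemma pi3_le_of_cutData (hE : Even L) (hL : 4 ≤ L) {s : ℕ} (hs : 1000 ≤ s)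
    (hsd : s ^ 5 ≤ d) (hℓ : Real.log (2 * d + 1) ≤ 6 * s / 10000)
    (P : (TV L d → Fin 3) → Prop) (hP : ∀ χ, CayleyProper (torusGen L d) χ → P χ →
      ∃ t A G R Q K τ M, 0 < t ∧ t ≤ L ^ d ∧ CutData s t χ A G R Q K τ M) :
    pi3 L d P ≤ Real.exp (-4 * (L : ℝ) ^ (d - 1) / ((d : ℝ) ^ 4 * (Real.log L) ^ 2)) := by
  have hsd' : s ≤ d := (Nat.le_self_pow (by norm_num) s).trans hsd
  have hd : 1280 ≤ d := le_trans (le_trans (by norm_num) (Nat.pow_le_pow_left hs 5)) hsd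
  rw [pi3_eq (by omega)]
  refine div_le_of_le_mul₀ (Nat.cast_nonneg _) (Real.exp_pos _).le ?_
  refine le_trans ?_ (mul_le_mul_of_nonneg_right (total_le hL hd (by omega) hsd')
    (Nat.cast_nonneg _))
  have hcard : ((Icc 1 (L ^ d)).card : ℝ) = (L : ℝ) ^ d := by simp
  rw [mul_assoc, ← hcard]
  refine card_le_mul_of_cover _ (Icc 1 (L ^ d)) (fun t χ => ∃ A G R Q K τ M,
    CutData s t χ A G R Q K τ M) (fun χ hχ => ?_) (fun t ht => ?_)
  · obtain ⟨-, h1, h2⟩ := mem_filter.1 hχ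
    obtain ⟨t, A, G, R, Q, K, τ, M, ht, htN, h⟩ := hP χ h1 h2
    exact ⟨t, mem_Icc.2 ⟨ht, htN⟩, A, G, R, Q, K, τ, M, h⟩
  · rw [hcard]
    set C := (univ.filter fun χ => CayleyProper (torusGen L d) χ ∧ P χ).filter fun χ =>
      ∃ A G R Q K τ M, CutData s t χ A G R Q K τ M with hCdef
    rcases C.eq_empty_or_nonempty with h0 | ⟨χ₀, hχ₀⟩
    · rw [h0]
      simp only [card_empty, Nat.cast_zero]
      positivity
    obtain ⟨A, G, R, Q, K, τ, M, h⟩ := (mem_filter.1 hχ₀).2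
    obtain ⟨ht, htN⟩ := mem_Icc.1 ht
    exact card_cutData_le_of_scale hE hL hs hsd hℓ ht htN h.large C fun χ hχ =>
      ⟨(mem_filter.1 (mem_filter.1 hχ).1).2.1, (mem_filter.1 hχ).2⟩

end Conclusion

/-- the measure of colorings with many 0-colored even vertices, all
covered by an ensemble of disjoint standard even cutsets each of size less than
`L^{d-1}`, is at most `exp(-4 L^{d-1} / (d^4 log² L))`. -/
theorem trivial_cutset_cover_bound :
    ∃ d0 : ℕ, 0 < d0 ∧ ∀ d L : ℕ, d0 ≤ d → Even L → 4 ≤ L →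
      pi3 L d (fun χ =>
          (L : ℝ) ^ d / (4 * Real.sqrt d) ≤ (zeroEvenCount L d χ : ℝ) ∧
          ∃ m : ℕ, ∃ W : Fin m → Set (TV L d),
            (∀ i j, i ≠ j → Disjoint (W i) (W j)) ∧
            (∀ i, StandardEvenCutset L d χ (W i) ∧ 2 * Nat.card ↥(W i) ≤ L ^ d ∧
              cutsetCard L d (W i) < L ^ (d - 1)) ∧
            ∀ v : TV L d, χ v = 0 → IsEvenVtx v → ∃ i, v ∈ W i) ≤
        Real.exp (-4 * (L : ℝ) ^ (d - 1) / ((d : ℝ) ^ 4 * (Real.log L) ^ 2)) := by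
  obtain ⟨S, hS, hlog⟩ := exists_log_le_nat
  refine ⟨S ^ 5, by positivity, fun d L hd hE hL => ?_⟩
  have : NeZero L := ⟨by omega⟩
  obtain ⟨s, hSs, hsd, hds⟩ := exists_fifth_root hd
  have hs : 1000 ≤ s := hS.trans hSs
  have hsd' : s ≤ d := (Nat.le_self_pow (by norm_num) s).trans hsd
  obtain ⟨hs2, hℓ⟩ := scale_bounds hs (hlog s hSs) hds
  refine pi3_le_of_cutData hE hL hs hsd hℓ _ fun χ hχ hP => ?_
  obtain ⟨hz, m, W, hdisj, hW, hcov⟩ := hP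
  have hd1 : (1 : ℝ) ≤ d := by exact_mod_cast (by omega : 1 ≤ d)
  have hsqrt : Real.sqrt d ≤ d := by
    rw [Real.sqrt_le_left (by linarith)]
    nlinarith
  have hz' : L ^ d ≤ 4 * d * zeroEvenCount L d χ := by
    have h0 : 0 < Real.sqrt d := Real.sqrt_pos.2 (by linarith)
    rw [div_le_iff₀ (by positivity)] at hz
    have h1 : (L : ℝ) ^ d ≤ 4 * d * zeroEvenCount L d χ := by
      calc (L : ℝ) ^ d ≤ zeroEvenCount L d χ * (4 * Real.sqrt d) := hz
        _ ≤ zeroEvenCount L d χ * (4 * d) := by gcongr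
        _ = 4 * d * zeroEvenCount L d χ := by ring
    exact_mod_cast h1
  obtain ⟨A₀, G₀, hc, hzf, hlow, hhigh⟩ :=
    exists_initial_region hE hL (by omega) hχ hz' hdisj hW hcov
  exact exists_cutData hE hL (by omega) hs2 hsd (by omega) hc hzf hlow hhigh
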